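/- arXiv:math/0507388 — 4 statements merged into one kernel-verified Lean document; each statement's English description precedes it below -/
import Mathlib

section
/- Suppose n = ∞ (F has countably infinite transcendence degree over k). Then G is topologically simple: every closed normal subgroup of G is either the trivial subgroup {1} or G itself. -/
/-- The topology of pointwise convergence on `Aut(F/k)`, where `F` carries the
discrete topology: a base of open neighbourhoods of the identity is given by
the pointwise stabilizers of finite subsets of `F`. -/
def autTop (k F : Type*) [Field k] [Field F] [Algebra k F] :
    TopologicalSpace (F ≃ₐ[k] F) :=
  TopologicalSpace.induced (fun g (x : F) => g x)
    (@Pi.topologicalSpace F (fun _ => F) (fun _ => ⊥))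

open IntermediateField Cardinal

universe u

namespace AutSimple

section Acl

variable (k : Type*) {F : Type*} [Field k] [Field F] [Algebra k F]

/-- The relative algebraic closure in `F` of the subfield generated by `s` over `k`. -/
def acl (s : Set F) : IntermediateField k F :=
  (algebraicClosure (adjoin k s) F).restrictScalars k

variable {k}

theorem mem_acl {s : Set F} {x : F} : x ∈ acl k s ↔ IsAlgebraic (adjoin k s) x :=
  mem_algebraicClosure_iff

theorem coe_acl (s : Set F) :
    (acl k s : Set F) = (AlgebraicIndependent.matroid k F).closure s := by
  ext x
  rw [AlgebraicIndependent.matroid_closure_eq, SetLike.mem_coe, SetLike.mem_coe,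
    Subalgebra.mem_algebraicClosure, mem_acl, IntermediateField.isAlgebraic_adjoin_iff]

theorem subset_acl (s : Set F) : s ⊆ acl k s := by
  rw [coe_acl]
  exact Matroid.subset_closure _ _

theorem acl_le_of_subset {s t : Set F} (h : s ⊆ acl k t) : acl k s ≤ acl k t := by
  rw [← SetLike.coe_subset_coe]
  rw [coe_acl] at *
  rw [coe_acl]
  exact Matroid.closure_subset_closure_of_subset_closure h

theorem acl_mono {s t : Set F} (h : s ⊆ t) : acl k s ≤ acl k t :=
  acl_le_of_subset (h.trans (subset_acl t))

theorem acl_exchange {s : Set F} {x y : F} (hx : x ∉ acl k s) (hxy : x ∈ acl k (insert y s)) :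
    y ∈ acl k (insert x s) := by
  rw [← SetLike.mem_coe, coe_acl] at *
  exact Matroid.mem_closure_insert hx hxy

theorem map_mem_acl {s t : Set F} (g : F ≃ₐ[k] F) (h : ∀ a ∈ s, g a ∈ acl k t) {x : F}
    (hx : x ∈ acl k s) : g x ∈ acl k t := by
  refine acl_le_of_subset (k := k) (s := (acl k t : Set F)) subset_rfl (mem_acl.2 ?_)
  have hle : (adjoin k s).map (g : F →ₐ[k] F) ≤ adjoin k (acl k t : Set F) := by
    rw [adjoin_map]
    refine adjoin_le_iff.2 ?_
    rintro _ ⟨a, ha, rfl⟩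
    exact subset_adjoin k _ (h a ha)
  let f : adjoin k s →+* adjoin k (acl k t : Set F) :=
    ((inclusion hle).comp ((adjoin k s).equivMap (g : F →ₐ[k] F)).toAlgHom).toRingHom
  exact (mem_acl.1 hx).ringHom_of_comp_eq f (g : F →+* F) f.injective rfl

theorem exists_algebraMap_eq_of_mem_acl_empty [IsAlgClosed k] {x : F} (hx : x ∈ acl k ∅) :
    ∃ c : k, algebraMap k F c = x := by
  rw [mem_acl, adjoin_empty] at hx
  have hx' : IsAlgebraic k x := hx.restrictScalars k
  obtain ⟨c, hc⟩ := IsAlgClosed.algebraMap_bijective_of_isIntegral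
    (k := k) (K := algebraicClosure k F) |>.2 ⟨x, mem_algebraicClosure_iff.2 hx'⟩
  exact ⟨c, congrArg Subtype.val hc⟩

theorem trdeg_acl_lt_aleph0 {s : Set F} (hs : s.Finite) : Algebra.trdeg k (acl k s) < ℵ₀ := by
  rw [← finTrdeg_iff_trdeg]
  have : Algebra.EssFiniteType k (adjoin k s) :=
    essFiniteType_iff.2 (fg_adjoin_of_finite hs)
  exact FinTrdeg.trans k (adjoin k s) (algebraicClosure (adjoin k s) F)

theorem exists_notMem_acl (hF : Algebra.trdeg k F = ℵ₀) {s : Set F} (hs : s.Finite) :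
    ∃ x, x ∉ acl k s := by
  by_contra! h
  have := trdeg_acl_lt_aleph0 (k := k) hs
  have htop : acl k s = ⊤ := eq_top_iff.2 fun x _ => h x
  rw [htop, (topEquiv (F := k) (E := F)).trdeg_eq, hF] at this
  exact lt_irrefl _ this

theorem finite_orbit {s : Set F} {x f : F} (hx : x ∈ acl k (insert f s)) :
    {y | ∃ g : F ≃ₐ[k] F, (∀ a ∈ acl k s, g a = a) ∧ g f = f ∧ g x = y}.Finite := by
  set K := adjoin k (insert f s)
  have hx' : IsAlgebraic K x := mem_acl.1 hx
  refine ((minpoly K x).rootSet_finite F).subset ?_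
  rintro _ ⟨g, hs, hf, rfl⟩
  have hg : ∀ a ∈ K, g a = a := by
    intro a ha
    induction ha using adjoin_induction with
    | mem a ha =>
      rcases ha with rfl | ha
      · exact hf
      · exact hs a (subset_acl s ha)
    | algebraMap c => exact g.commutes c
    | add a b _ _ ha hb => rw [map_add, ha, hb]
    | inv a _ ha => rw [map_inv₀, ha]
    | mul a b _ _ ha hb => rw [map_mul, ha, hb]
  let g' : F →ₐ[K] F := { (g : F →+* F) with commutes' := fun a => hg a a.2 }
  refine (Polynomial.mem_rootSet).2 ⟨minpoly.ne_zero hx'.isIntegral, ?_⟩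
  have : Polynomial.aeval (g' x) (minpoly K x) = 0 := by
    rw [Polynomial.aeval_algHom_apply, minpoly.aeval, map_zero]
  exact this

theorem transcendental_of_notMem_acl {s : Set F} {x : F} (hx : x ∉ acl k s) :
    Transcendental (acl k s) x := by
  intro h
  refine hx (acl_le_of_subset (s := (acl k s : Set F)) subset_rfl ?_)
  rw [mem_acl, adjoin_self]
  exact h

theorem eq_one_of_forall_notMem_acl (hF : Algebra.trdeg k F = ℵ₀) {s : Set F} (hs : s.Finite)
    {h : F ≃ₐ[k] F} (hh : ∀ x ∉ acl k s, h x = x) : h = 1 := by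
  ext a
  by_cases ha : a ∈ acl k s
  · obtain ⟨x, hx⟩ := exists_notMem_acl hF hs
    have := hh (a + x) fun hax => hx (by simpa using sub_mem hax ha)
    rwa [map_add, hh x hx, add_left_inj] at this
  · exact hh a ha

theorem add_algebraMap_notMem_acl {s : Set F} {x : F} (hx : x ∉ acl k s) (d : k) :
    x + algebraMap k F d ∉ acl k s := fun h =>
  hx (by simpa using sub_mem h ((acl k s).algebraMap_mem d))

/-- If every translate of `x` by a constant is a conjugate of `x` over `acl k s` and `f`, then
`x` is not algebraic over `s` and `f`. -/
theorem notMem_acl_insert_of_translations [Infinite k] {s : Set F} {x f : F}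
    (h : ∀ d : k, ∃ g : F ≃ₐ[k] F, (∀ a ∈ acl k s, g a = a) ∧ g f = f ∧
      g x = x + algebraMap k F d) : x ∉ acl k (insert f s) := by
  intro hx
  refine Set.infinite_range_of_injective (f := fun d : k => x + algebraMap k F d)
    (fun a b hab => (algebraMap k F).injective (add_left_cancel hab))
    ((finite_orbit hx).subset ?_)
  rintro _ ⟨d, rfl⟩
  exact h d

end Acl

section Extension

theorem nonempty_algEquiv_of_trdeg_eq {R : Type*} {K L : Type u} [CommRing R] [Field K] [Field L]
    [Algebra R K] [Algebra R L] [FaithfulSMul R K] [FaithfulSMul R L]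
    [IsAlgClosed K] [IsAlgClosed L] (h : Algebra.trdeg R K = Algebra.trdeg R L) :
    Nonempty (K ≃ₐ[R] L) := by
  obtain ⟨s, hs⟩ := exists_isTranscendenceBasis R K
  obtain ⟨t, ht⟩ := exists_isTranscendenceBasis R L
  have : Nontrivial R := RingHom.domain_nontrivial (algebraMap R K)
  have : IsDomain R := (FaithfulSMul.algebraMap_injective R K).isDomain (algebraMap R K)
  rw [← hs.cardinalMk_eq_trdeg, ← ht.cardinalMk_eq_trdeg] at h
  obtain ⟨e⟩ := Cardinal.eq.1 h
  let e' : Algebra.adjoin R (Set.range ((↑) : s → K)) ≃ₐ[R]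
      Algebra.adjoin R (Set.range ((↑) : t → L)) :=
    (hs.1.aevalEquiv.symm.trans (MvPolynomial.renameEquiv R e)).trans ht.1.aevalEquiv
  have := IsAlgClosed.isAlgClosure_of_transcendence_basis _ hs
  have := IsAlgClosed.isAlgClosure_of_transcendence_basis _ ht
  refine ⟨AlgEquiv.ofRingEquiv (f := IsAlgClosure.equivOfEquiv K L e'.toRingEquiv) fun r => ?_⟩
  have := IsAlgClosure.equivOfEquiv_algebraMap K L e'.toRingEquiv
    (algebraMap R (Algebra.adjoin R (Set.range ((↑) : s → K))) r)
  simpa [← IsScalarTower.algebraMap_apply] using this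

theorem exists_ringEquiv_of_trdeg_eq {R : Type*} {K L : Type u} [CommRing R] [Field K] [Field L]
    [IsAlgClosed K] [IsAlgClosed L] (i : R →+* K) (j : R →+* L) (hi : Function.Injective i)
    (hj : Function.Injective j)
    (h : @Algebra.trdeg R K _ _ i.toAlgebra = @Algebra.trdeg R L _ _ j.toAlgebra) :
    ∃ e : K ≃+* L, ∀ r, e (i r) = j r := by
  let := i.toAlgebra
  let := j.toAlgebra
  have : FaithfulSMul R K := (faithfulSMul_iff_algebraMap_injective R K).2 hi
  have : FaithfulSMul R L := (faithfulSMul_iff_algebraMap_injective R L).2 hj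
  obtain ⟨e⟩ := nonempty_algEquiv_of_trdeg_eq h
  exact ⟨e.toRingEquiv, fun r => e.commutes r⟩

variable {k F : Type*} [Field k] [Field F] [Algebra k F] [IsAlgClosed F]

theorem exists_algEquiv_extending (hF : Algebra.trdeg k F = ℵ₀) {R : Type*} [CommRing R]
    [Algebra k R] (i j : R →ₐ[k] F) (hi : Function.Injective i) (hj : Function.Injective j)
    {s : Set F} (hs : s.Finite) (his : ∀ r, i r ∈ acl k s) :
    ∃ g : F ≃ₐ[k] F, ∀ r, g (i r) = j r := by
  have htr : Algebra.trdeg k R < ℵ₀ := by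
    let i' : R →ₐ[k] acl k s := i.codRestrict (acl k s).toSubalgebra his
    have := lift_trdeg_le_of_injective i' (hi.codRestrict _)
    have h2 := trdeg_acl_lt_aleph0 (k := k) hs
    rw [← Cardinal.lift_lt_aleph0] at h2 ⊢
    exact this.trans_lt h2
  have key (i : R →ₐ[k] F) (hi : Function.Injective i) :
      @Algebra.trdeg R F _ _ i.toRingHom.toAlgebra = ℵ₀ := by
    let := i.toRingHom.toAlgebra
    have : IsScalarTower k R F := .of_algebraMap_eq fun r => (i.commutes r).symm
    have : FaithfulSMul R F := (faithfulSMul_iff_algebraMap_injective R F).2 hi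
    have : Nontrivial R := RingHom.domain_nontrivial i.toRingHom
    have h := lift_trdeg_add_eq k R F
    rw [hF, Cardinal.lift_aleph0] at h
    refine le_antisymm ?_ ?_
    · rw [← Cardinal.lift_le_aleph0, ← h]
      exact self_le_add_left _ _
    · by_contra! hlt
      refine h.not_lt (Cardinal.add_lt_aleph0 ?_ ?_) <;> rwa [Cardinal.lift_lt_aleph0]
  obtain ⟨e, he⟩ := exists_ringEquiv_of_trdeg_eq i.toRingHom j.toRingHom hi hj
    ((key i hi).trans (key j hj).symm)
  refine ⟨AlgEquiv.ofRingEquiv (f := e) fun c => ?_, he⟩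
  simpa using he (algebraMap k R c)

end Extension

section Homogeneity

variable {k F : Type*} [Field k] [Field F] [Algebra k F] [IsAlgClosed F]

/-- Any two elements transcendental over `acl k s` are conjugate by an automorphism fixing
`acl k s` pointwise. -/
theorem exists_fixing_map_eq (hF : Algebra.trdeg k F = ℵ₀) {s : Set F} (hs : s.Finite) {x y : F}
    (hx : x ∉ acl k s) (hy : y ∉ acl k s) :
    ∃ g : F ≃ₐ[k] F, (∀ a ∈ acl k s, g a = a) ∧ g x = y := by
  obtain ⟨g, hg⟩ := exists_algEquiv_extending hF
    ((Polynomial.aeval (R := acl k s) x).restrictScalars k)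
    ((Polynomial.aeval (R := acl k s) y).restrictScalars k)
    (transcendental_iff_injective.1 (transcendental_of_notMem_acl hx))
    (transcendental_iff_injective.1 (transcendental_of_notMem_acl hy))
    (hs.insert x) fun p => by
      rw [AlgHom.restrictScalars_apply, Polynomial.aeval_eq_sum_range]
      refine sum_mem fun i _ => ?_
      rw [Algebra.smul_def]
      exact mul_mem (acl_mono (Set.subset_insert x s) (p.coeff i).2)
        (pow_mem (subset_acl _ (Set.mem_insert x s)) i)
  refine ⟨g, fun a ha => ?_, ?_⟩
  · simpa using hg (Polynomial.C ⟨a, ha⟩)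
  · simpa using hg Polynomial.X

/-- An automorphism can be modified away from `acl k s` so as to take a prescribed value at an
element transcendental over `acl k s`. -/
theorem exists_eqOn_acl_map_eq (hF : Algebra.trdeg k F = ℵ₀) {s t : Set F} (ht : t.Finite)
    (g : F ≃ₐ[k] F) (hst : ∀ a ∈ s, g a ∈ acl k t) (hts : ∀ a ∈ t, g.symm a ∈ acl k s)
    {x y : F} (hx : x ∉ acl k s) (hy : y ∉ acl k t) :
    ∃ g' : F ≃ₐ[k] F, (∀ a ∈ acl k s, g' a = g a) ∧ g' x = y := by
  have hgx : g x ∉ acl k t := fun h => hx <| by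
    simpa using map_mem_acl g.symm hts h
  obtain ⟨u, hu, hux⟩ := exists_fixing_map_eq hF ht hgx hy
  exact ⟨g.trans u, fun a ha => hu _ (map_mem_acl g hst ha), hux⟩

/-- The pointwise stabilizer of a subfield of finite transcendence degree has trivial
centralizer. -/
theorem eq_one_of_commute_fixing [Infinite k] (hF : Algebra.trdeg k F = ℵ₀) {s : Set F} (hs : s.Finite)
    {h : F ≃ₐ[k] F} (hh : ∀ g : F ≃ₐ[k] F, (∀ a ∈ acl k s, g a = a) → ∀ x, h (g x) = g (h x)) :
    h = 1 := by
  have hsub {x : F} (hx : x ∉ acl k s) : h x - x ∈ acl k s := by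
    have hmem : h x ∈ acl k (insert x s) := by
      by_contra hmem
      obtain ⟨g, hg, hgx⟩ := exists_fixing_map_eq hF (hs.insert x) hmem
        (add_algebraMap_notMem_acl hmem 1)
      have := hh g (fun a ha => hg a (acl_mono (Set.subset_insert x s) ha)) x
      rw [hgx, hg x (subset_acl _ (Set.mem_insert x s))] at this
      simp at this
    by_contra hf
    refine notMem_acl_insert_of_translations (fun d => ?_)
      (acl_exchange hf (sub_mem hmem (subset_acl _ (Set.mem_insert x s))))
    obtain ⟨g, hg, hgx⟩ := exists_fixing_map_eq hF hs hx (add_algebraMap_notMem_acl hx d)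
    refine ⟨g, hg, ?_, hgx⟩
    rw [map_sub, ← hh g hg, hgx, map_add, h.commutes, add_sub_add_right_eq_sub]
  refine eq_one_of_forall_notMem_acl hF hs fun x hx => ?_
  obtain ⟨y, hy⟩ := exists_notMem_acl hF (hs.insert x)
  have hle : acl k s ≤ acl k (insert x s) := acl_mono (Set.subset_insert x s)
  have hxx : x ∈ acl k (insert x s) := subset_acl _ (Set.mem_insert x s)
  have hx0 : x ≠ 0 := by
    rintro rfl
    exact hx (zero_mem _)
  have hy' : y ∉ acl k s := fun h => hy (hle h)
  have hxy : x * y ∉ acl k s := fun h => hy <| by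
    simpa [hx0] using div_mem (hle h) hxx
  by_contra hne
  have hne' : h x - x ≠ 0 := sub_ne_zero.2 hne
  have e : y = (h (x * y) - x * y - h x * (h y - y)) / (h x - x) := by
    rw [map_mul]
    field_simp
    ring
  have hhx : h x ∈ acl k (insert x s) := by
    simpa using add_mem (hle (hsub hx)) hxx
  refine hy (e ▸ ?_)
  exact div_mem (sub_mem (hle (hsub hxy)) (mul_mem hhx (hle (hsub hy')))) (hle (hsub hx))

end Homogeneity

section NormalSubgroup

variable {k F : Type*} [Field k] [Field F] [Algebra k F] [IsAlgClosed F] [Infinite k]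
  {N : Subgroup (F ≃ₐ[k] F)}

theorem exists_ne_one_fixing (hF : Algebra.trdeg k F = ℵ₀) (hN : N.Normal) (hne : N ≠ ⊥)
    {s : Set F} (hs : s.Finite) : ∃ n ∈ N, n ≠ 1 ∧ ∀ a ∈ acl k s, n a = a := by
  obtain ⟨h, hhN, hh⟩ := N.bot_or_exists_ne_one.resolve_left hne
  by_contra! hcon
  refine hh (eq_one_of_commute_fixing hF (hs.union (hs.image h.symm)) fun g hg x => ?_)
  have hg1 : ∀ a ∈ acl k s, g a = a := fun a ha => hg a (acl_mono Set.subset_union_left ha)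
  have hg2 : ∀ a ∈ acl k s, g (h.symm a) = h.symm a := fun a ha => hg _ <|
    map_mem_acl h.symm (fun b hb => subset_acl _ (.inr ⟨b, hb, rfl⟩)) ha
  by_contra hne
  obtain ⟨a, ha, hna⟩ := hcon (h * (g * h⁻¹ * g⁻¹)) (N.mul_mem hhN (hN.conj_mem _ (inv_mem hhN) g))
    fun h1 => hne <| by
      have := congrArg (fun u : F ≃ₐ[k] F => u (g (h x))) h1
      simpa [AlgEquiv.aut_inv] using this
  refine hna ?_
  have : g.symm a = a := by rw [AlgEquiv.symm_apply_eq, hg1 a ha]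
  simp [AlgEquiv.aut_inv, this, hg2 a ha]

theorem exists_fixing_notMem_acl_insert (hF : Algebra.trdeg k F = ℵ₀) (hN : N.Normal) (hne : N ≠ ⊥)
    {s : Set F} (hs : s.Finite) :
    ∃ n ∈ N, (∀ a ∈ acl k s, n a = a) ∧ ∃ z ∉ acl k s, n z ∉ acl k (insert z s) := by
  obtain ⟨y, hy⟩ := exists_notMem_acl hF hs
  obtain ⟨n, hnN, hn1, hn⟩ := exists_ne_one_fixing hF hN hne (hs.insert y)
  have hle : acl k s ≤ acl k (insert y s) := acl_mono (Set.subset_insert y s)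
  have hyy : y ∈ acl k (insert y s) := subset_acl _ (Set.mem_insert y s)
  refine ⟨n, hnN, fun a ha => hn a (hle ha), ?_⟩
  by_contra! hcon
  have hsub {x : F} (hx : x ∉ acl k (insert y s)) : n x - x ∈ acl k s := by
    have hxs : x ∉ acl k s := fun h => hx (hle h)
    have hxx : x ∈ acl k (insert x s) := subset_acl _ (Set.mem_insert x s)
    have hfx : n x - x ∈ acl k (insert x s) := sub_mem (hcon x hxs) hxx
    have hfxy : n x - x ∈ acl k (insert (x + y) s) := by
      have h1 := hcon (x + y) fun h => hx (by simpa using sub_mem (hle h) hyy)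
      have h2 := sub_mem h1 (subset_acl _ (Set.mem_insert (x + y) s))
      rwa [map_add, hn y hyy, add_sub_add_right_eq_sub] at h2
    by_contra hf
    have hy' : y ∈ acl k (insert (n x - x) s) := by
      simpa using sub_mem (acl_exchange hf hfxy) (acl_exchange hf hfx)
    exact hx <| acl_exchange hy <| acl_le_of_subset (Set.insert_subset hfx
      ((Set.subset_insert x s).trans (subset_acl _))) hy'
  refine hn1 (eq_one_of_forall_notMem_acl hF (hs.insert y) fun x hx => ?_)
  have hy0 : y ≠ 0 := by
    rintro rfl
    exact hy (zero_mem _)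
  have hxy : x * y ∉ acl k (insert y s) := fun h => hx <| by
    simpa [hy0] using div_mem h hyy
  by_contra hne
  have hne' : n x - x ≠ 0 := sub_ne_zero.2 hne
  refine hy ?_
  have e : y = (n (x * y) - x * y) / (n x - x) := by
    rw [map_mul, hn y hyy]
    field_simp
  exact e ▸ div_mem (hsub hxy) (hsub hx)

theorem exists_fixing_map_notMem_acl (hF : Algebra.trdeg k F = ℵ₀) (hN : N.Normal) (hne : N ≠ ⊥)
    {s t : Set F} (hs : s.Finite) (ht : t.Finite) (hst : s ⊆ t) {x : F} (hx : x ∉ acl k s) :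
    ∃ n ∈ N, (∀ a ∈ acl k s, n a = a) ∧ n x ∉ acl k t := by
  obtain ⟨n, hnN, hn, z, hz, hnz⟩ := exists_fixing_notMem_acl_insert hF hN hne hs
  obtain ⟨w, hw⟩ := exists_notMem_acl hF (ht.insert x)
  have hwx : w ∉ acl k (insert x s) := fun h => hw (acl_mono (Set.insert_subset_insert hst) h)
  obtain ⟨u, hu, hux⟩ := exists_fixing_map_eq hF hs hz hx
  have hus : ∀ a ∈ acl k s, u.symm a = a := fun a ha => by
    rw [AlgEquiv.symm_apply_eq, hu a ha]
  obtain ⟨v, hv, hvw⟩ := exists_eqOn_acl_map_eq hF (hs.insert x) u (s := insert z s)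
    (by
      rintro a (rfl | ha)
      · exact hux ▸ subset_acl _ (Set.mem_insert _ _)
      · rw [hu a (subset_acl _ ha)]
        exact subset_acl _ (Set.mem_insert_of_mem _ ha))
    (by
      rintro a (rfl | ha)
      · rw [← hux, AlgEquiv.symm_apply_apply]
        exact subset_acl _ (Set.mem_insert _ _)
      · rw [hus a (subset_acl _ ha)]
        exact subset_acl _ (Set.mem_insert_of_mem _ ha)) hnz hwx
  have hle : acl k s ≤ acl k (insert z s) := acl_mono (Set.subset_insert z s)
  refine ⟨v * n * v⁻¹, hN.conj_mem n hnN v, fun a ha => ?_, ?_⟩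
  · have hva : v a = a := by rw [hv a (hle ha), hu a ha]
    have : v.symm a = a := by rw [AlgEquiv.symm_apply_eq, hva]
    simp [AlgEquiv.aut_inv, this, hn a ha, hva]
  · have hvz : v z = x := by rw [hv z (subset_acl _ (Set.mem_insert z s)), hux]
    have : v.symm x = z := by rw [AlgEquiv.symm_apply_eq, hvz]
    simp only [AlgEquiv.mul_apply, AlgEquiv.aut_inv, this, hvw]
    exact fun h => hw (acl_mono (Set.subset_insert x t) h)

end NormalSubgroup

section Independence

variable {k F : Type*} [Field k] [Field F] [Algebra k F]

variable (k) in
/-- `IndepOver k C t` says that `t` is finite and algebraically independent over `k(C)`. -/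
inductive IndepOver (C : Set F) : Set F → Prop
  | empty : IndepOver C ∅
  | cons {y : F} {t : Set F} (ht : IndepOver C t) (hy : y ∉ acl k (C ∪ t)) :
      IndepOver C (insert y t)

theorem IndepOver.finite {C t : Set F} (ht : IndepOver k C t) : t.Finite := by
  induction ht with
  | empty => exact Set.finite_empty
  | cons _ _ ih => exact ih.insert _

variable [IsAlgClosed k] [IsAlgClosed F]

theorem IndepOver.exists_fixing_map_ne (hF : Algebra.trdeg k F = ℵ₀) {C t : Set F}
    (hC : C.Finite) (ht : IndepOver k C t) {b : F} (hb : b ∈ acl k t)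
    (hbk : ∀ c : k, algebraMap k F c ≠ b) :
    ∃ g : F ≃ₐ[k] F, (∀ a ∈ acl k C, g a = a) ∧ (∀ a ∈ t, g a ∈ acl k t) ∧
      (∀ a ∈ t, g.symm a ∈ acl k t) ∧ g b ≠ b := by
  have : Infinite k := IsAlgClosed.instInfinite
  induction ht with
  | empty =>
    obtain ⟨c, hc⟩ := exists_algebraMap_eq_of_mem_acl_empty hb
    exact absurd hc (hbk c)
  | @cons y t ht hy ih =>
    have hCt := hC.union ht.finite
    have hle : acl k t ≤ acl k (insert y t) := acl_mono (Set.subset_insert y t)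
    have hyy : y ∈ acl k (insert y t) := subset_acl _ (Set.mem_insert y t)
    by_cases hbt : b ∈ acl k t
    · obtain ⟨g, hgC, hgt, hgt', hgb⟩ := ih hbt
      obtain ⟨g', hg', hg'y⟩ := exists_eqOn_acl_map_eq hF hCt g (s := C ∪ t)
        (by
          rintro a (ha | ha)
          · rw [hgC a (subset_acl _ ha)]
            exact subset_acl _ (.inl ha)
          · exact acl_mono Set.subset_union_right (hgt a ha))
        (by
          rintro a (ha | ha)
          · rw [(AlgEquiv.symm_apply_eq g).2 (hgC a (subset_acl _ ha)).symm]
            exact subset_acl _ (.inl ha)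
          · exact acl_mono Set.subset_union_right (hgt' a ha)) hy hy
      have hg't : ∀ a ∈ acl k t, g' a = g a := fun a ha =>
        hg' a (acl_mono Set.subset_union_right ha)
      refine ⟨g', fun a ha => ?_, ?_, ?_, ?_⟩
      · rw [hg' a (acl_mono Set.subset_union_left ha), hgC a ha]
      · rintro a (rfl | ha)
        · rwa [hg'y]
        · rw [hg't a (subset_acl _ ha)]
          exact hle (hgt a ha)
      · rintro a (rfl | ha)
        · rwa [(AlgEquiv.symm_apply_eq g').2 hg'y.symm]
        · have : g'.symm a = g.symm a := by
            rw [AlgEquiv.symm_apply_eq, hg't _ (hgt' a ha), AlgEquiv.apply_symm_apply]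
          rw [this]
          exact hle (hgt' a ha)
      · rwa [hg't b hbt]
    · by_contra! hcon
      refine notMem_acl_insert_of_translations (s := C ∪ t) (x := y) (f := b) (fun d => ?_)
        (acl_mono (Set.insert_subset_insert Set.subset_union_right) (acl_exchange hbt hb))
      obtain ⟨g, hg, hgy⟩ := exists_fixing_map_eq hF hCt hy (add_algebraMap_notMem_acl hy d)
      have hgt : ∀ a ∈ t, g a = a := fun a ha => hg a (subset_acl _ (.inr ha))
      refine ⟨g, hg, hcon g (fun a ha => hg a (acl_mono Set.subset_union_left ha)) ?_ ?_, hgy⟩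
      · rintro a (rfl | ha)
        · rw [hgy]
          exact add_mem hyy (IntermediateField.algebraMap_mem _ d)
        · rw [hgt a ha]
          exact hle (subset_acl _ ha)
      · rintro a (rfl | ha)
        · have : g.symm a = a - algebraMap k F d := by
            rw [AlgEquiv.symm_apply_eq, map_sub, hgy, g.commutes, add_sub_cancel_right]
          rw [this]
          exact sub_mem hyy (IntermediateField.algebraMap_mem _ d)
        · rw [(AlgEquiv.symm_apply_eq g).2 (hgt a ha).symm]
          exact hle (subset_acl _ ha)

/-- If `t` is independent over `C`, then `acl k C` and `acl k t` are linearly disjoint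
over `k`. -/
theorem IndepOver.eq_zero_of_linearCombination_eq_zero (hF : Algebra.trdeg k F = ℵ₀)
    {C t : Set F} (hC : C.Finite) (ht : IndepOver k C t) {ι : Type*} {v : ι → F}
    (hv : LinearIndependent k v) (hvC : ∀ i, v i ∈ acl k C) (c : ι →₀ F)
    (hc : ∀ i, c i ∈ acl k t) (h0 : Finsupp.linearCombination F v c = 0) : c = 0 := by
  induction hn : c.support.card using Nat.strong_induction_on generalizing c with
  | _ m ih =>
  by_contra hne
  obtain ⟨i, hi⟩ := Finsupp.ne_iff.1 hne
  rw [Finsupp.zero_apply] at hi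
  let e : ι →₀ F := (c i)⁻¹ • c
  have hei : e i = 1 := inv_mul_cancel₀ hi
  have het (j : ι) : e j ∈ acl k t := mul_mem (inv_mem (hc i)) (hc j)
  have he0 : Finsupp.linearCombination F v e = 0 := by rw [map_smul, h0, smul_zero]
  have hconst (j : ι) : ∃ a : k, algebraMap k F a = e j := by
    by_contra! hj
    obtain ⟨g, hgC, hgt, -, hgj⟩ := ht.exists_fixing_map_ne hF hC (het j) hj
    let d : ι →₀ F := e - e.mapRange g (map_zero g)
    have hd (l : ι) : d l = e l - g (e l) := rfl
    have hd0 : Finsupp.linearCombination F v (e.mapRange g (map_zero g)) = 0 := by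
      have := congrArg g he0
      rw [Finsupp.linearCombination_apply, Finsupp.sum, map_sum, map_zero] at this
      rw [Finsupp.linearCombination_apply, Finsupp.sum_mapRange_index (by simp), Finsupp.sum,
        ← this]
      refine Finset.sum_congr rfl fun l _ => ?_
      rw [smul_eq_mul, smul_eq_mul, map_mul, hgC _ (hvC l)]
    have hsupp : d.support ⊂ c.support := by
      refine (Finset.ssubset_iff_of_subset fun l hl => ?_).2 ⟨i, ?_, ?_⟩
      · rw [Finsupp.mem_support_iff] at hl ⊢
        rintro hl'
        apply hl
        have : e l = 0 := by simp [e, hl']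
        rw [hd, this, map_zero, sub_zero]
      · rwa [Finsupp.mem_support_iff]
      · rw [Finsupp.notMem_support_iff, hd, hei, map_one, sub_self]
    have hd' := ih _ (hn ▸ Finset.card_lt_card hsupp) d
      (fun l => sub_mem (het l) (map_mem_acl g hgt (het l)))
      (by rw [map_sub, he0, hd0, sub_zero]) rfl
    have := hd j
    rw [hd', Finsupp.zero_apply] at this
    exact hgj (sub_eq_zero.1 this.symm).symm
  choose a ha using hconst
  have := linearIndependent_iff'.1 hv e.support a (by
    rw [Finsupp.linearCombination_apply, Finsupp.sum] at he0
    rw [← he0]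
    exact Finset.sum_congr rfl fun j _ => by rw [Algebra.smul_def, ha, smul_eq_mul]) i
    (by simp [hei])
  rw [← ha i, this, map_zero] at hei
  exact zero_ne_one hei

open TensorProduct in
theorem IndepOver.productMap_injective (hF : Algebra.trdeg k F = ℵ₀) {C t : Set F}
    (hC : C.Finite) (ht : IndepOver k C t) {A : Type*} [Field A] [Algebra k A] (f : A →ₐ[k] F)
    (hf : ∀ a, f a ∈ acl k C) :
    Function.Injective (Algebra.TensorProduct.productMap f (acl k t).val) := by
  rw [injective_iff_map_eq_zero]
  intro z hz
  let B := Module.Basis.ofVectorSpace k A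
  obtain ⟨c, rfl⟩ := TensorProduct.eq_repr_basis_left B z
  have hc := ht.eq_zero_of_linearCombination_eq_zero hF hC
    (B.linearIndependent.map' f.toLinearMap (LinearMap.ker_eq_bot.2 f.injective))
    (fun i => hf (B i)) (c.mapRange Subtype.val rfl) (fun i => (c i).2) (by
      rw [Finsupp.linearCombination_apply, Finsupp.sum_mapRange_index (by simp), ← hz,
        Finsupp.sum, Finsupp.sum, map_sum]
      refine Finset.sum_congr rfl fun i _ => ?_
      rw [Algebra.TensorProduct.productMap_apply_tmul, smul_eq_mul, mul_comm]
      rfl)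
  have : c = 0 := by
    ext i
    exact DFunLike.congr_fun hc i
  rw [this, Finsupp.sum_zero_index]

/-- Stationarity: an automorphism on `acl k S` and the identity on an independent `acl k t` have
a common extension. -/
theorem IndepOver.exists_eqOn_fixing (hF : Algebra.trdeg k F = ℵ₀) {S t : Set F} (hS : S.Finite)
    (g : F ≃ₐ[k] F) (ht : IndepOver k (S ∪ g '' S) t) :
    ∃ r : F ≃ₐ[k] F, (∀ a ∈ acl k S, r a = g a) ∧ ∀ b ∈ acl k t, r b = b := by
  have hC : (S ∪ g '' S).Finite := hS.union (hS.image g)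
  obtain ⟨r, hr⟩ := exists_algEquiv_extending hF
    (Algebra.TensorProduct.productMap (acl k S).val (acl k t).val)
    (Algebra.TensorProduct.productMap ((g : F →ₐ[k] F).comp (acl k S).val) (acl k t).val)
    (ht.productMap_injective hF hC _ fun a => acl_mono Set.subset_union_left a.2)
    (ht.productMap_injective hF hC _ fun a => map_mem_acl g
      (fun b hb => subset_acl _ (.inr ⟨b, hb, rfl⟩)) a.2)
    (hS.union ht.finite) fun z => by
      induction z with
      | zero => rw [map_zero]; exact zero_mem _
      | add x y hx hy => rw [map_add]; exact add_mem hx hy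
      | tmul a b =>
        rw [Algebra.TensorProduct.productMap_apply_tmul]
        exact mul_mem (acl_mono Set.subset_union_left a.2) (acl_mono Set.subset_union_right b.2)
  refine ⟨r, fun a ha => ?_, fun b hb => ?_⟩
  · simpa using hr (⟨a, ha⟩ ⊗ₜ 1)
  · simpa using hr (1 ⊗ₜ ⟨b, hb⟩)

end Independence

section Density

variable {k F : Type*} [Field k] [Field F] [Algebra k F] [IsAlgClosed k] [IsAlgClosed F]
  {N : Subgroup (F ≃ₐ[k] F)}

theorem exists_map_mem_acl_indepOver (hF : Algebra.trdeg k F = ℵ₀) (hN : N.Normal) (hne : N ≠ ⊥)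
    {S C : Set F} (hS : S.Finite) (hC : C.Finite) :
    ∃ n ∈ N, ∃ t, IndepOver k C t ∧ ∀ a ∈ S, n a ∈ acl k t := by
  have : Infinite k := IsAlgClosed.instInfinite
  induction S, hS using Set.Finite.induction_on with
  | empty => exact ⟨1, one_mem N, ∅, .empty, by simp⟩
  | @insert x S _ _ ih =>
    obtain ⟨n, hnN, t, ht, hnt⟩ := ih
    by_cases hx : n x ∈ acl k t
    · exact ⟨n, hnN, t, ht, by rintro a (rfl | ha); exacts [hx, hnt a ha]⟩
    · obtain ⟨m, hmN, hm, hmx⟩ := exists_fixing_map_notMem_acl hF hN hne ht.finite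
        (hC.union ht.finite) Set.subset_union_right hx
      refine ⟨m * n, mul_mem hmN hnN, insert (m (n x)) t, ht.cons hmx, ?_⟩
      rintro a (rfl | ha)
      · exact subset_acl _ (Set.mem_insert _ _)
      · rw [AlgEquiv.mul_apply, hm _ (hnt a ha)]
        exact acl_mono (Set.subset_insert _ _) (hnt a ha)

theorem exists_mem_eqOn (hF : Algebra.trdeg k F = ℵ₀) (hN : N.Normal) (hne : N ≠ ⊥)
    (g : F ≃ₐ[k] F) {S : Set F} (hS : S.Finite) : ∃ n ∈ N, ∀ a ∈ S, n a = g a := by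
  obtain ⟨n, hnN, t, ht, hnt⟩ := exists_map_mem_acl_indepOver hF hN hne hS (hS.union (hS.image g))
  obtain ⟨r, hrS, hrt⟩ := ht.exists_eqOn_fixing hF hS g
  refine ⟨r * n⁻¹ * r⁻¹ * n, mul_mem (hN.conj_mem _ (inv_mem hnN) r) hnN, fun a ha => ?_⟩
  have : r.symm (n a) = n a := (AlgEquiv.symm_apply_eq r).2 (hrt _ (hnt a ha)).symm
  simp [AlgEquiv.aut_inv, this, hrS a (subset_acl _ ha)]

end Density

theorem mem_of_isClosed_autTop {k F : Type*} [Field k] [Field F] [Algebra k F]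
    {T : Set (F ≃ₐ[k] F)} (hT : @IsClosed _ (autTop k F) T) {g : F ≃ₐ[k] F}
    (hg : ∀ S : Set F, S.Finite → ∃ n ∈ T, ∀ a ∈ S, n a = g a) : g ∈ T := by
  by_contra hgT
  let : TopologicalSpace F := ⊥
  obtain ⟨U, hU, hUT⟩ := isOpen_induced_iff.1 (@IsClosed.isOpen_compl _ (autTop k F) _ hT)
  have hgU : (fun x => g x) ∈ U := by
    have : g ∈ Tᶜ := hgT
    rwa [← hUT] at this
  obtain ⟨I, u, hu, huU⟩ := isOpen_pi_iff.1 hU _ hgU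
  obtain ⟨n, hnT, hn⟩ := hg I I.finite_toSet
  have hnU : n ∈ (fun (g : F ≃ₐ[k] F) (x : F) => g x) ⁻¹' U := huU fun a ha => by
    simpa only [hn a ha] using (hu a ha).2
  rw [hUT] at hnU
  exact hnU hnT

end AutSimple

/-- If `F/k` is an extension of algebraically closed fields of characteristic zero
of countably infinite transcendence degree, then `G = Aut(F/k)` is topologically
simple: every closed normal subgroup is trivial or everything. -/
theorem statement0 (k F : Type*) [Field k] [Field F] [Algebra k F]
    [IsAlgClosed k] [IsAlgClosed F] [CharZero k] [CharZero F]
    (hn : ∃ x : ℕ → F, IsTranscendenceBasis k x)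
    (N : Subgroup (F ≃ₐ[k] F)) (hnorm : N.Normal)
    (hclosed : @IsClosed _ (autTop k F) (N : Set (F ≃ₐ[k] F))) :
    N = ⊥ ∨ N = ⊤ := by
  have hF : Algebra.trdeg k F = ℵ₀ := by
    obtain ⟨x, hx⟩ := hn
    simpa using hx.lift_cardinalMk_eq_trdeg.symm
  refine or_iff_not_imp_left.2 fun hne => eq_top_iff.2 fun g _ => ?_
  exact AutSimple.mem_of_isClosed_autTop hclosed fun S hS =>
    AutSimple.exists_mem_eqOn hF hnorm hne g hS
end

section
/- Suppose 1 ≤ n < ∞. Let G° be the subgroup of G generated by the union of all compact subgroups of G. Then G° is an open subgroup of G, and G° is topologically simple: every subgroup of G° which is normal in G°, closed in the topology of G°, and proper, is the trivial subgroup {1}. -/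
/-- `G°`: the subgroup of `G = Aut(F/k)` generated by the union of all
compact subgroups of `G`. -/
def Gcirc (k F : Type*) [Field k] [Field F] [Algebra k F] : Subgroup (F ≃ₐ[k] F) :=
  Subgroup.closure {g | ∃ K : Subgroup (F ≃ₐ[k] F),
    @IsCompact _ (autTop k F) (K : Set (F ≃ₐ[k] F)) ∧ g ∈ K}

section TranscendenceBasis

variable {k F ι : Type*} [Field k] [Field F] [Algebra k F]

/-- A finite family over which a transcendence basis of the same size is algebraic is itself a
transcendence basis. -/
theorem IsTranscendenceBasis.of_forall_isAlgebraic [Finite ι] {x x' : ι → F}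
    (hx : IsTranscendenceBasis k x)
    (h : ∀ i, IsAlgebraic (Algebra.adjoin k (Set.range x')) (x i)) :
    IsTranscendenceBasis k x' := by
  have : Algebra.IsAlgebraic (Algebra.adjoin k (Set.range x')) F := by
    refine ⟨fun a => IsAlgebraic.adjoin_of_forall_isAlgebraic (s := Set.range x) ?_
      (hx.isAlgebraic.isAlgebraic a)⟩
    rintro _ ⟨⟨i, rfl⟩, -⟩
    exact h i
  exact Algebra.IsAlgebraic.isTranscendenceBasis_of_lift_le_trdeg_of_finite k x'
    hx.lift_cardinalMk_eq_trdeg.le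

theorem IsTranscendenceBasis.update_of_isAlgebraic [Finite ι] [DecidableEq ι] {x : ι → F}
    (hx : IsTranscendenceBasis k x) (i : ι) (w : F)
    (h : IsAlgebraic (Algebra.adjoin k (Set.range (Function.update x i w))) (x i)) :
    IsTranscendenceBasis k (Function.update x i w) := by
  refine hx.of_forall_isAlgebraic fun j => ?_
  rcases eq_or_ne j i with rfl | hj
  · exact h
  · have : x j ∈ Algebra.adjoin k (Set.range (Function.update x i w)) :=
      Algebra.subset_adjoin ⟨j, by simp [hj]⟩
    exact isAlgebraic_algebraMap (⟨x j, this⟩ : Algebra.adjoin k _)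

/-- Interpolation of a transcendence basis with prescribed index type. -/
theorem IsTranscendenceBasis.exists_between {x : ι → F} (hx : IsTranscendenceBasis k x)
    {s t : Set F} (hst : s ⊆ t) (hs : AlgebraicIndepOn k id s)
    (ht : Algebra.IsAlgebraic (Algebra.adjoin k t) F) :
    ∃ z : ι → F, IsTranscendenceBasis k z ∧ s ⊆ Set.range z ∧ Set.range z ⊆ t := by
  obtain ⟨u, hsu, hut, hu⟩ := exists_isTranscendenceBasis_between s t hst hs
  obtain ⟨e⟩ := Cardinal.lift_mk_eq'.mp (hx.lift_cardinalMk_eq hu)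
  have hr : Set.range (fun i => (e i : F)) = u := by
    ext a
    exact ⟨by rintro ⟨i, rfl⟩; exact (e i).2, fun h => ⟨e.symm ⟨a, h⟩, by simp⟩⟩
  refine ⟨fun i => (e i : F), ?_, hr.symm ▸ hsu, hr.symm ▸ hut⟩
  exact (isTranscendenceBasis_equiv e (f := ((↑) : u → F))).mpr hu

theorem IsTranscendenceBasis.exists_superset {x : ι → F} (hx : IsTranscendenceBasis k x)
    {s : Set F} (hs : AlgebraicIndepOn k id s) :
    ∃ z : ι → F, IsTranscendenceBasis k z ∧ s ⊆ Set.range z := by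
  have : Algebra.IsAlgebraic (Algebra.adjoin k (Set.univ : Set F)) F :=
    ⟨fun a => isAlgebraic_algebraMap
      (⟨a, Algebra.subset_adjoin trivial⟩ : Algebra.adjoin k (Set.univ : Set F))⟩
  obtain ⟨z, hz, hsz, -⟩ := hx.exists_between (Set.subset_univ s) hs this
  exact ⟨z, hz, hsz⟩

/-- The automorphism group of an algebraically closed field is transitive on transcendence
bases. -/
theorem IsTranscendenceBasis.exists_algEquiv [IsAlgClosed F] {x x' : ι → F}
    (hx : IsTranscendenceBasis k x) (hx' : IsTranscendenceBasis k x') :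
    ∃ φ : F ≃ₐ[k] F, ∀ i, φ (x i) = x' i := by
  have := IsAlgClosed.isAlgClosure_of_transcendence_basis x hx
  have := IsAlgClosed.isAlgClosure_of_transcendence_basis x' hx'
  let e : Algebra.adjoin k (Set.range x) ≃ₐ[k] Algebra.adjoin k (Set.range x') :=
    hx.1.aevalEquiv.symm.trans hx'.1.aevalEquiv
  let φ : F ≃+* F := IsAlgClosure.equivOfEquiv F F e.toRingEquiv
  have hφ (a) : φ (algebraMap (Algebra.adjoin k (Set.range x)) F a) =
      algebraMap (Algebra.adjoin k (Set.range x')) F (e a) :=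
    IsAlgClosure.equivOfEquiv_algebraMap F F e.toRingEquiv a
  refine ⟨AlgEquiv.ofRingEquiv (f := φ) fun c => ?_, fun i => ?_⟩
  · rw [IsScalarTower.algebraMap_apply k (Algebra.adjoin k (Set.range x)) F, hφ, e.commutes]
    rfl
  · have h1 : x i = algebraMap (Algebra.adjoin k (Set.range x)) F
        (hx.1.aevalEquiv (MvPolynomial.X i)) := by
      rw [hx.1.algebraMap_aevalEquiv, MvPolynomial.aeval_X]
    change φ (x i) = _
    rw [h1, hφ]
    simp only [e, AlgEquiv.trans_apply, AlgEquiv.symm_apply_apply]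
    rw [hx'.1.algebraMap_aevalEquiv, MvPolynomial.aeval_X]

/-- An automorphism acting as `x i ↦ c - x i` on one member of a transcendence basis and fixing
the others, where `c` is a polynomial in those others. It fixes another transcendence basis. -/
theorem IsTranscendenceBasis.exists_reflection [Finite ι] [IsAlgClosed F] [CharZero F]
    {x : ι → F} (hx : IsTranscendenceBasis k x) (i : ι) {c : F}
    (hc : c ∈ Algebra.adjoin k (x '' {i}ᶜ)) :
    ∃ s : F ≃ₐ[k] F, s (x i) = c - x i ∧ (∀ j ≠ i, s (x j) = x j) ∧
      ∃ x' : ι → F, IsTranscendenceBasis k x' ∧ ∀ j, s (x' j) = x' j := by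
  classical
  have hsub (w : F) : Algebra.adjoin k (x '' {i}ᶜ) ≤
      Algebra.adjoin k (Set.range (Function.update x i w)) := by
    refine Algebra.adjoin_mono ?_
    rintro _ ⟨j, hj, rfl⟩
    exact ⟨j, by simp [show j ≠ i from hj]⟩
  have hw (w : F) : w ∈ Algebra.adjoin k (Set.range (Function.update x i w)) :=
    Algebra.subset_adjoin ⟨i, by simp⟩
  have h1 : IsTranscendenceBasis k (Function.update x i (c - x i)) := by
    refine hx.update_of_isAlgebraic i _ ?_
    have := sub_mem (hsub (c - x i) hc) (hw (c - x i))
    rw [sub_sub_cancel] at this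
    exact isAlgebraic_algebraMap (⟨x i, this⟩ : Algebra.adjoin k _)
  have h2 : IsTranscendenceBasis k (Function.update x i ((2 * x i - c) ^ 2)) := by
    refine hx.update_of_isAlgebraic i _ ?_
    set A := Algebra.adjoin k (Set.range (Function.update x i ((2 * x i - c) ^ 2)))
    have e1 : IsAlgebraic A (2 * x i - c) :=
      .of_pow two_pos (isAlgebraic_algebraMap (⟨_, hw ((2 * x i - c) ^ 2)⟩ : A))
    have e2 : IsAlgebraic A c := isAlgebraic_algebraMap (⟨c, hsub _ hc⟩ : A)
    have e3 : IsAlgebraic A ((2 : F)⁻¹) := by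
      have : IsAlgebraic A (2 : F) := isAlgebraic_algebraMap (2 : A)
      exact this.inv
    have e4 : (2 * x i - c + c) * 2⁻¹ = x i := by
      rw [sub_add_cancel, mul_comm, inv_mul_cancel_left₀ two_ne_zero]
    exact e4 ▸ (e1.add e2).mul e3
  obtain ⟨s, hs⟩ := hx.exists_algEquiv h1
  have hsi : s (x i) = c - x i := by simpa using hs i
  have hsj (j) (hj : j ≠ i) : s (x j) = x j := by simpa [hj] using hs j
  have hsc : s c = c := by
    have : Algebra.adjoin k (x '' {i}ᶜ) ≤ AlgHom.equalizer (s : F →ₐ[k] F) (AlgHom.id k F) := by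
      refine Algebra.adjoin_le ?_
      rintro _ ⟨j, hj, rfl⟩
      exact hsj j hj
    exact this hc
  refine ⟨s, hsi, hsj, _, h2, fun j => ?_⟩
  rcases eq_or_ne j i with rfl | hj
  · simp only [Function.update_self, map_pow, map_sub, map_mul, hsi, hsc, map_ofNat]
    ring
  · simp [hj, hsj j hj]

end TranscendenceBasis

section DegreeFiltration

open Polynomial

variable (ι k : Type*) [Field k]

/-- The Rees ring of the filtration of a polynomial ring by total degree. -/
def degreeRees : Subring (MvPolynomial ι k)[X] where
  carrier := {r | ∀ j, (r.coeff j).totalDegree ≤ j}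
  mul_mem' {a b} ha hb j := by
    rw [coeff_mul]
    refine MvPolynomial.totalDegree_finsetSum_le fun p hp => ?_
    rw [← Finset.HasAntidiagonal.mem_antidiagonal.mp hp]
    exact (MvPolynomial.totalDegree_mul _ _).trans (add_le_add (ha _) (hb _))
  one_mem' j := by
    rw [coeff_one]
    split_ifs <;> simp
  add_mem' {a b} ha hb j := by
    rw [coeff_add]
    exact (MvPolynomial.totalDegree_add _ _).trans (max_le (ha j) (hb j))
  zero_mem' j := by simp
  neg_mem' {a} ha j := by
    rw [coeff_neg, MvPolynomial.totalDegree_neg]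
    exact ha j

variable {ι k}

theorem mem_degreeRees {r : (MvPolynomial ι k)[X]} :
    r ∈ degreeRees ι k ↔ ∀ j, (r.coeff j).totalDegree ≤ j := Iff.rfl

theorem monomial_mem_degreeRees {m : ℕ} {P : MvPolynomial ι k} (h : P.totalDegree ≤ m) :
    monomial m P ∈ degreeRees ι k := fun j => by
  rw [coeff_monomial]
  split_ifs with hj
  · exact hj ▸ h
  · simp

variable (ι k) in
/-- The structure map from the Rees ring to polynomials over an algebra. -/
noncomputable def degreeReesHom (M : Type*) [Field M] [Algebra (MvPolynomial ι k) M] :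
    degreeRees ι k →+* M[X] :=
  (mapRingHom (algebraMap (MvPolynomial ι k) M)).comp (degreeRees ι k).subtype

section

variable {M : Type*} [Field M] [Algebra (MvPolynomial ι k) M]

theorem isIntegral_of_isIntegralElem_degreeReesHom {m : ℕ} {f : M}
    (hf : (degreeReesHom ι k M).IsIntegralElem (monomial m f)) :
    IsIntegral (MvPolynomial ι k) f := by
  obtain ⟨p, hp, he⟩ := hf
  refine ⟨p.map ((evalRingHom 1).comp (degreeRees ι k).subtype), hp.map _, ?_⟩
  have h1 : (algebraMap (MvPolynomial ι k) M).comp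
      ((evalRingHom 1).comp (degreeRees ι k).subtype) =
      (evalRingHom 1).comp (degreeReesHom ι k M) := by
    ext r
    simp [degreeReesHom, eval_map, eval₂_at_one]
  rw [eval₂_map, h1]
  have h2 : f = evalRingHom 1 (monomial m f) := by simp
  rw [h2, ← hom_eval₂, he, map_zero]

theorem totalDegree_le_of_isIntegralElem_degreeReesHom
    (hinj : Function.Injective (algebraMap (MvPolynomial ι k) M)) {m : ℕ}
    {P : MvPolynomial ι k}
    (hP : (degreeReesHom ι k M).IsIntegralElem (monomial m (algebraMap _ M P))) :
    P.totalDegree ≤ m := by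
  obtain ⟨p, hp, he⟩ := hP
  have he' : eval₂ (degreeRees ι k).subtype (monomial m P) p = 0 := by
    apply map_injective _ hinj
    rw [← coe_mapRingHom, hom_eval₂, map_zero, ← he]
    simp [degreeReesHom]
  by_contra! hlt
  have hP0 : P ≠ 0 := by rintro rfl; simp at hlt
  have hpow (n : ℕ) : (P ^ n).totalDegree = n * P.totalDegree := by
    induction n with
    | zero => simp
    | succ n ih =>
      rw [pow_succ, MvPolynomial.totalDegree_mul_of_isDomain (pow_ne_zero _ hP0) hP0, ih]
      ring
  set N := p.natDegree with hN
  have hN0 : N ≠ 0 := by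
    intro h0
    have : p = 1 := eq_one_of_monic_natDegree_zero hp h0
    rw [this] at he'
    simp at he'
  rw [eval₂_eq_sum_range, Finset.sum_range_succ, ← hN, hp.coeff_natDegree, map_one, one_mul,
    monomial_pow] at he'
  have hc := congrArg (fun r => coeff r (m * N)) he'
  simp only [coeff_add, coeff_monomial, if_true, finsetSum_coeff, coeff_zero] at hc
  have hc' : P ^ N = -∑ i ∈ Finset.range N,
      ((degreeRees ι k).subtype (p.coeff i) * monomial m P ^ i).coeff (m * N) :=
    eq_neg_of_add_eq_zero_right hc
  have : (P ^ N).totalDegree ≤ N * P.totalDegree - 1 := by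
    rw [hc', MvPolynomial.totalDegree_neg]
    refine MvPolynomial.totalDegree_finsetSum_le fun i hi => ?_
    have hi := Finset.mem_range.mp hi
    obtain ⟨l, hl⟩ := Nat.exists_eq_add_of_lt hi
    have e1 : m * N = m * (l + 1) + m * i := by rw [hl]; ring
    rw [monomial_pow, e1, coeff_mul_monomial]
    refine (MvPolynomial.totalDegree_mul _ _).trans ?_
    rw [hpow]
    have e2 := mem_degreeRees.mp (p.coeff i).2 (m * (l + 1))
    refine (Nat.add_le_add_right e2 _).trans ?_
    have e3 : m * (l + 1) < P.totalDegree * (l + 1) := Nat.mul_lt_mul_of_pos_right hlt l.succ_pos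
    have e4 : N * P.totalDegree = P.totalDegree * (l + 1) + i * P.totalDegree := by rw [hl]; ring
    omega
  rw [hpow] at this
  have : 0 < N * P.totalDegree := Nat.mul_pos (Nat.pos_of_ne_zero hN0) (by omega)
  omega

theorem exists_isIntegralElem_degreeReesHom {h : M} (hh : IsIntegral (MvPolynomial ι k) h) :
    ∃ m, (degreeReesHom ι k M).IsIntegralElem (monomial m h) := by
  obtain ⟨p, hp, he⟩ := hh
  set m := (Finset.range p.natDegree).sup fun i => (p.coeff i).totalDegree with hm
  have hle (i) (hi : i < p.natDegree) : (p.coeff i).totalDegree ≤ m :=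
    Finset.le_sup (f := fun i => (p.coeff i).totalDegree) (Finset.mem_range.mpr hi)
  let q : (MvPolynomial ι k)[X][X] := (p.map C).scaleRoots (X ^ m)
  have hq : q.Monic := (monic_scaleRoots_iff _).mpr (hp.map _)
  have hqc : q ∈ lifts (degreeRees ι k).subtype := by
    rw [lifts_iff_coeff_lifts]
    intro i
    simp only [Subring.coe_subtype, Subtype.range_coe_subtype, Set.mem_ofPred_eq]
    have hd : (p.map (C : MvPolynomial ι k →+* _)).natDegree = p.natDegree := hp.natDegree_map _
    simp only [q, coeff_scaleRoots, coeff_map, hd, ← pow_mul]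
    rw [C_mul_X_pow_eq_monomial]
    refine monomial_mem_degreeRees ?_
    rcases lt_trichotomy i p.natDegree with hi | hi | hi
    · exact (hle i hi).trans (Nat.le_mul_of_pos_right _ (by omega))
    · rw [hi, hp.coeff_natDegree]; simp
    · rw [coeff_eq_zero_of_natDegree_lt hi]; simp
  obtain ⟨r, hr, -, hrm⟩ := lifts_and_natDegree_eq_and_monic hqc hq
  refine ⟨m, r, hrm, ?_⟩
  have h1 : (monomial m h : M[X]) =
      mapRingHom (algebraMap (MvPolynomial ι k) M) (X ^ m) * C h := by
    rw [coe_mapRingHom, Polynomial.map_pow, map_X, mul_comm, C_mul_X_pow_eq_monomial]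
  rw [degreeReesHom, ← eval₂_map, hr, h1]
  refine scaleRoots_eval₂_eq_zero _ ?_
  have h2 : (mapRingHom (algebraMap (MvPolynomial ι k) M)).comp C =
      (C : M →+* M[X]).comp (algebraMap (MvPolynomial ι k) M) := by
    ext <;> simp
  rw [eval₂_map, h2, ← hom_eval₂, he, map_zero]

theorem isIntegralElem_degreeReesHom_map (g : M →+* M)
    (τ : MvPolynomial ι k →+* MvPolynomial ι k) (hτ : ∀ P, (τ P).totalDegree ≤ P.totalDegree)
    (hg : ∀ P, g (algebraMap (MvPolynomial ι k) M P) = algebraMap _ M (τ P)) {m : ℕ} {f : M}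
    (hf : (degreeReesHom ι k M).IsIntegralElem (monomial m f)) :
    (degreeReesHom ι k M).IsIntegralElem (monomial m (g f)) := by
  obtain ⟨p, hp, he⟩ := hf
  have hmem (r) (hr : r ∈ degreeRees ι k) : mapRingHom τ r ∈ degreeRees ι k := fun j => by
    rw [coe_mapRingHom, coeff_map]
    exact (hτ _).trans (hr j)
  let T : degreeRees ι k →+* degreeRees ι k := (mapRingHom τ).restrict _ _ hmem
  refine ⟨p.map T, hp.map _, ?_⟩
  have h1 : (degreeReesHom ι k M).comp T = (mapRingHom g).comp (degreeReesHom ι k M) := by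
    refine RingHom.ext fun r => ?_
    change map (algebraMap _ M) (map τ r.1) = map g (map (algebraMap _ M) r.1)
    rw [map_map, map_map]
    congr 1
    exact RingHom.ext fun P => (hg P).symm
  have h2 : monomial m (g f) = mapRingHom g (monomial m f) := by simp
  rw [eval₂_map, h1, h2, ← hom_eval₂, he, map_zero]

variable [Algebra k M] [IsScalarTower k (MvPolynomial ι k) M]

variable (ι k M) in
/-- The elements of degree at most `m` in an extension of the field of rational functions. -/
noncomputable def extDegreeLE (m : ℕ) : Submodule k M where
  carrier := {f | (degreeReesHom ι k M).IsIntegralElem (monomial m f)}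
  add_mem' {a b} ha hb := by
    rw [Set.mem_ofPred_eq, map_add]
    exact RingHom.IsIntegralElem.add _ ha hb
  zero_mem' := by
    rw [Set.mem_ofPred_eq, map_zero]
    exact RingHom.isIntegralElem_zero _
  smul_mem' c f hf := by
    have h : (monomial m (c • f) : M[X]) = degreeReesHom ι k M
        ⟨monomial 0 (MvPolynomial.C c), monomial_mem_degreeRees (by simp)⟩ * monomial m f := by
      simp only [degreeReesHom, RingHom.comp_apply, Subring.subtype_apply, coe_mapRingHom,
        map_monomial, monomial_mul_monomial, zero_add, Algebra.smul_def]
      rw [IsScalarTower.algebraMap_apply k (MvPolynomial ι k) M, MvPolynomial.algebraMap_eq]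
    rw [Set.mem_ofPred_eq, h]
    exact RingHom.IsIntegralElem.mul _ (RingHom.isIntegralElem_map _) hf

theorem mem_extDegreeLE {m : ℕ} {f : M} :
    f ∈ extDegreeLE ι k M m ↔ (degreeReesHom ι k M).IsIntegralElem (monomial m f) := Iff.rfl

theorem mul_mem_extDegreeLE {m m' : ℕ} {f f' : M} (hf : f ∈ extDegreeLE ι k M m)
    (hf' : f' ∈ extDegreeLE ι k M m') : f * f' ∈ extDegreeLE ι k M (m + m') := by
  rw [mem_extDegreeLE, ← monomial_mul_monomial]
  exact RingHom.IsIntegralElem.mul _ hf hf'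

end

end DegreeFiltration

theorem IsAlgebraic.mem_range_algebraMap {k M : Type*} [Field k] [IsAlgClosed k] [Field M]
    [Algebra k M] {f : M} (hf : IsAlgebraic k f) : ∃ c : k, algebraMap k M c = f :=
  minpoly.mem_range_of_degree_eq_one k f
    (IsAlgClosed.degree_eq_one_of_irreducible k (minpoly.irreducible hf.isIntegral))

/-- Commuting endomorphisms preserving a nonzero finite-dimensional subspace have a common
eigenvector in it. -/
theorem Module.End.exists_common_eigenvector {k V ι : Type*} [Field k] [IsAlgClosed k]
    [AddCommGroup V] [Module k V] [Finite ι] (g : ι → Module.End k V)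
    (hg : ∀ i j v, g i (g j v) = g j (g i v)) (W : Submodule k V) [FiniteDimensional k W]
    (hW : W ≠ ⊥) (hgW : ∀ i, ∀ v ∈ W, g i v ∈ W) :
    ∃ v ∈ W, v ≠ 0 ∧ ∀ i, ∃ c : k, g i v = c • v := by
  classical
  have := Fintype.ofFinite ι
  have key (s : Finset ι) : ∃ W' ≤ W, W' ≠ ⊥ ∧ (∀ i, ∀ v ∈ W', g i v ∈ W') ∧
      ∀ i ∈ s, ∃ c : k, ∀ v ∈ W', g i v = c • v := by
    induction s using Finset.induction with
    | empty => exact ⟨W, le_rfl, hW, hgW, by simp⟩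
    | insert i s _ ih =>
      obtain ⟨W', hle, hne, hst, hs⟩ := ih
      have : FiniteDimensional k W' := Submodule.finiteDimensional_of_le hle
      have : Nontrivial W' := (Submodule.nontrivial_iff_ne_bot).mpr hne
      obtain ⟨c, hc⟩ := Module.End.exists_eigenvalue ((g i).restrict (hst i))
      obtain ⟨v, hv⟩ := hc.exists_hasEigenvector
      refine ⟨W' ⊓ (g i).eigenspace c, inf_le_left.trans hle, ?_, ?_, ?_⟩
      · refine (Submodule.ne_bot_iff _).mpr ⟨v, ⟨v.2, ?_⟩, fun h => hv.2 (Subtype.ext h)⟩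
        exact Module.End.mem_eigenspace_iff.mpr (congrArg Subtype.val hv.apply_eq_smul)
      · rintro j v ⟨hv, hv'⟩
        refine ⟨hst j v hv, Module.End.mem_eigenspace_iff.mpr ?_⟩
        rw [hg, Module.End.mem_eigenspace_iff.mp hv', map_smul]
      · intro j hj
        rcases Finset.mem_insert.mp hj with rfl | hj
        · exact ⟨c, fun v hv => Module.End.mem_eigenspace_iff.mp hv.2⟩
        · obtain ⟨d, hd⟩ := hs j hj
          exact ⟨d, fun v hv => hd v hv.1⟩
  obtain ⟨W', hle, hne, -, h⟩ := key Finset.univ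
  obtain ⟨v, hv, hv0⟩ := W'.ne_bot_iff.mp hne
  refine ⟨v, hle hv, hv0, fun i => ?_⟩
  obtain ⟨c, hc⟩ := h i (Finset.mem_univ i)
  exact ⟨c, hc v hv⟩

namespace MvPolynomial

variable {ι k : Type*} [Field k]

/-- Translation of the variables of a polynomial by a vector. -/
noncomputable def translate (v : ι → k) : MvPolynomial ι k →ₐ[k] MvPolynomial ι k :=
  aeval fun j => X j + C (v j)

theorem totalDegree_translate_le (v : ι → k) (P : MvPolynomial ι k) :
    (translate v P).totalDegree ≤ P.totalDegree := by
  rw [translate, aeval_def, eval₂_eq]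
  refine totalDegree_finsetSum_le fun s hs => ?_
  refine (totalDegree_mul _ _).trans ?_
  rw [algebraMap_eq, totalDegree_C, zero_add]
  refine (totalDegree_finsetProd _ _).trans (le_trans ?_ (le_totalDegree hs))
  refine Finset.sum_le_sum fun j _ => (totalDegree_pow _ _).trans ?_
  refine (Nat.mul_le_mul_left _ ?_).trans_eq (mul_one _)
  refine (totalDegree_add _ _).trans (max_le ?_ ?_)
  · rw [totalDegree_X]
  · simp

theorem eval_translate (v a : ι → k) (P : MvPolynomial ι k) :
    eval a (translate v P) = eval (a + v) P := by
  induction P using MvPolynomial.induction_on with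
  | C c => simp [translate]
  | add p q hp hq => simp only [map_add, hp, hq]
  | mul_X p i hp => simp only [map_mul, hp]; simp [translate]

theorem _root_.Polynomial.eval_eq_eval_zero_of_eval_add_one {k : Type*} [Field k] [CharZero k]
    {p : Polynomial k} {μ : k} (hp : ∀ t, p.eval (t + 1) = μ * p.eval t) (t : k) :
    p.eval t = p.eval 0 := by
  have h1 : p.comp (Polynomial.X + Polynomial.C 1) = Polynomial.C μ * p :=
    Polynomial.funext fun t => by simpa using hp t
  have h2 : p.leadingCoeff = μ * p.leadingCoeff := by
    have := congrArg Polynomial.leadingCoeff h1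
    rwa [Polynomial.leadingCoeff_comp (by rw [Polynomial.natDegree_X_add_C]; exact one_ne_zero),
      Polynomial.leadingCoeff_mul,
      Polynomial.leadingCoeff_X_add_C, one_pow, mul_one, Polynomial.leadingCoeff_C] at this
  rcases eq_or_ne p 0 with rfl | h0
  · simp
  have hμ : μ = 1 := by
    have := Polynomial.leadingCoeff_ne_zero.mpr h0
    exact mul_right_cancel₀ this (by rw [← h2, one_mul])
  have h3 (n : ℕ) : p.eval (n : k) = p.eval 0 := by
    induction n with
    | zero => simp
    | succ n ih => rw [Nat.cast_succ, hp, hμ, one_mul, ih]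
  have h4 : p = Polynomial.C (p.eval 0) := by
    refine Polynomial.eq_of_infinite_eval_eq _ _ ?_
    refine (Set.infinite_range_of_injective (Nat.cast_injective (R := k))).mono ?_
    rintro _ ⟨n, rfl⟩
    simp [h3 n]
  rw [h4]
  simp

/-- A polynomial that is an eigenvector of all the unit translations is constant. -/
theorem exists_eq_C_of_translate_eq_smul [CharZero k] [Finite ι] [DecidableEq ι]
    {P : MvPolynomial ι k} (h : ∀ i, ∃ μ : k, translate (Pi.single i 1) P = C μ * P) :
    ∃ c, P = C c := by
  have := Fintype.ofFinite ι
  have step (a : ι → k) (i : ι) (t : k) : eval (a + Pi.single i t) P = eval a P := by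
    obtain ⟨μ, hμ⟩ := h i
    let p : Polynomial k := eval₂ Polynomial.C
      (fun j => Polynomial.C (a j) + Polynomial.C ((Pi.single i 1 : ι → k) j) * Polynomial.X) P
    have hp (t : k) : p.eval t = eval (a + Pi.single i t) P := by
      have h1 : (Polynomial.evalRingHom t).comp Polynomial.C = RingHom.id k := by ext; simp
      rw [polynomial_eval_eval₂, h1]
      refine congrArg (fun b : ι → k => eval₂ (RingHom.id k) b P) (_root_.funext fun j => ?_)
      rcases eq_or_ne j i with rfl | hj
      · simp
      · simp [hj]
    have hs (t : k) : p.eval (t + 1) = μ * p.eval t := by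
      rw [hp, hp, Pi.single_add, ← add_assoc, ← eval_translate, hμ]
      simp
    rw [← hp, Polynomial.eval_eq_eval_zero_of_eval_add_one hs, hp]
    simp
  refine ⟨eval 0 P, MvPolynomial.funext fun a => ?_⟩
  have key (s : Finset ι) : eval (∑ i ∈ s, Pi.single i (a i)) P = eval 0 P := by
    induction s using Finset.induction with
    | empty => simp
    | insert i s hi ih => rw [Finset.sum_insert hi, add_comm, step, ih]
  rw [eval_C, ← key Finset.univ, Finset.univ_sum_single]

end MvPolynomial

section Translations

open MvPolynomial

variable {ι k K M : Type*} [Field k] [Field K] [Field M] [Algebra (MvPolynomial ι k) K]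
  [Algebra K M] [Algebra (MvPolynomial ι k) M] [IsScalarTower (MvPolynomial ι k) K M]
  [Algebra k M] [IsScalarTower k (MvPolynomial ι k) M]

theorem trace_mem_extDegreeLE [FiniteDimensional K M] [IsGalois K M] {m : ℕ} {f : M}
    (hf : f ∈ extDegreeLE ι k M m) :
    algebraMap K M (Algebra.trace K M f) ∈ extDegreeLE ι k M m := by
  rw [trace_eq_sum_automorphisms]
  refine Submodule.sum_mem _ fun γ _ => ?_
  refine isIntegralElem_degreeReesHom_map (γ : M →+* M) (RingHom.id _) (fun _ => le_rfl)
    (fun P => ?_) hf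
  rw [RingHom.id_apply, IsScalarTower.algebraMap_apply (MvPolynomial ι k) K M]
  exact γ.commutes _

variable [IsFractionRing (MvPolynomial ι k) K]

theorem exists_totalDegree_le_of_mem_extDegreeLE {m : ℕ} {a : K}
    (ha : algebraMap K M a ∈ extDegreeLE ι k M m) :
    ∃ P : MvPolynomial ι k, P.totalDegree ≤ m ∧ algebraMap _ K P = a := by
  have hinj : Function.Injective (algebraMap (MvPolynomial ι k) M) := by
    rw [IsScalarTower.algebraMap_eq (MvPolynomial ι k) K M]
    exact (algebraMap K M).injective.comp (IsFractionRing.injective _ K)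
  have h1 : IsIntegral (MvPolynomial ι k) (algebraMap K M a) :=
    isIntegral_of_isIntegralElem_degreeReesHom ha
  rw [isIntegral_algebraMap_iff (algebraMap K M).injective] at h1
  obtain ⟨P, rfl⟩ := IsIntegrallyClosed.isIntegral_iff.mp h1
  refine ⟨P, totalDegree_le_of_isIntegralElem_degreeReesHom hinj ?_, rfl⟩
  rwa [IsScalarTower.algebraMap_apply (MvPolynomial ι k) K M]

variable (K) in
theorem exists_smul_mem_extDegreeLE [Algebra.IsAlgebraic K M] (f : M) :
    ∃ q : MvPolynomial ι k, q ≠ 0 ∧ ∃ m, algebraMap _ M q * f ∈ extDegreeLE ι k M m := by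
  have : Algebra.IsAlgebraic (MvPolynomial ι k) M :=
    (IsFractionRing.comap_isAlgebraic_iff (A := MvPolynomial ι k) (K := K)).mpr inferInstance
  obtain ⟨q, hq, hi⟩ := (this.isAlgebraic f).exists_integral_multiple
  obtain ⟨m, hm⟩ := exists_isIntegralElem_degreeReesHom hi
  rw [Algebra.smul_def] at hm
  exact ⟨q, hq, m, hm⟩

variable [FiniteDimensional K M]

variable [Algebra k K] [IsScalarTower k (MvPolynomial ι k) K] [IsScalarTower k K M]

variable (K) in
theorem finiteDimensional_extDegreeLE [Finite ι] [CharZero k] [IsGalois K M] (m : ℕ) :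
    FiniteDimensional k (extDegreeLE ι k M m) := by
  let b := Module.finBasis K M
  choose q hq m' hm' using fun j => exists_smul_mem_extDegreeLE (ι := ι) (k := k) K (b j)
  let S (m : ℕ) : Submodule k K :=
    (restrictTotalDegree ι k m).map (IsScalarTower.toAlgHom k (MvPolynomial ι k) K).toLinearMap
  have hS {m : ℕ} {f : M} (hf : f ∈ extDegreeLE ι k M m) : Algebra.trace K M f ∈ S m := by
    obtain ⟨P, hP, he⟩ :=
      exists_totalDegree_le_of_mem_extDegreeLE (trace_mem_extDegreeLE (K := K) hf)
    exact ⟨P, (mem_restrictTotalDegree _ _ _).mpr hP, he⟩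
  let T : extDegreeLE ι k M m →ₗ[k] (j : Fin (Module.finrank K M)) → S (m + m' j) :=
    { toFun := fun f j => ⟨_, hS (mul_mem_extDegreeLE f.2 (hm' j))⟩
      map_add' := fun f f' => by
        ext j
        simp [add_mul]
      map_smul' := fun c f => by
        ext j
        simp only [Submodule.coe_smul, smul_mul_assoc, RingHom.id_apply, Pi.smul_apply]
        rw [← algebraMap_smul K c, map_smul, algebraMap_smul] }
  refine FiniteDimensional.of_injective T ((injective_iff_map_eq_zero T).mpr fun f hf => ?_)
  have h0 (j) : Algebra.trace K M (f * b j) = 0 := by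
    have h1 : Algebra.trace K M (f * (algebraMap _ M (q j) * b j)) = 0 :=
      congrArg Subtype.val (congrFun hf j)
    rw [IsScalarTower.algebraMap_apply (MvPolynomial ι k) K M, ← Algebra.smul_def,
      mul_smul_comm, map_smul, smul_eq_mul] at h1
    refine (mul_eq_zero.mp h1).resolve_left ?_
    exact fun h => hq j ((map_eq_zero_iff _ (IsFractionRing.injective _ K)).mp h)
  have h2 : Algebra.traceForm K M f = 0 := b.ext fun j => by simpa using h0 j
  have : Algebra.IsSeparable K M := IsGalois.to_isSeparable
  exact Subtype.ext ((traceForm_nondegenerate K M).1 f fun y => by rw [h2]; rfl)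

/-- A finite Galois extension of a field of rational functions in characteristic zero is trivial
as soon as the unit translations lift to it so as to commute with each other and with the Galois
group. -/
theorem surjective_algebraMap_of_translations [IsAlgClosed k] [CharZero k] [Finite ι]
    [DecidableEq ι] [IsGalois K M] (g : ι → M →ₐ[k] M)
    (hgX : ∀ i P, g i (algebraMap (MvPolynomial ι k) M P) =
      algebraMap _ M (translate (Pi.single i 1) P))
    (hgγ : ∀ i (γ : M ≃ₐ[K] M) f, g i (γ f) = γ (g i f))
    (hgg : ∀ i j f, g i (g j f) = g j (g i f)) :
    Function.Surjective (algebraMap K M) := by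
  have hinj : Function.Injective (algebraMap (MvPolynomial ι k) M) := by
    rw [IsScalarTower.algebraMap_eq (MvPolynomial ι k) K M]
    exact (algebraMap K M).injective.comp (IsFractionRing.injective _ K)
  by_contra hsur
  obtain ⟨f₀, hf₀⟩ : ∃ f, ∀ a, algebraMap K M a ≠ f := by
    simpa [Function.Surjective] using hsur
  have : CharZero K := charZero_of_injective_algebraMap (algebraMap k K).injective
  have hd : ((Module.finrank K M : ℕ) : K) ≠ 0 :=
    Nat.cast_ne_zero.mpr Module.finrank_pos.ne'
  let f₁ := f₀ - algebraMap K M ((Module.finrank K M : K)⁻¹ * Algebra.trace K M f₀)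
  have hf₁ : f₁ ≠ 0 := fun h => hf₀ _ (sub_eq_zero.mp h).symm
  have htr : Algebra.trace K M f₁ = 0 := by
    rw [map_sub, Algebra.trace_algebraMap, nsmul_eq_mul, mul_inv_cancel_left₀ hd, sub_self]
  obtain ⟨q, hq, m, hm⟩ := exists_smul_mem_extDegreeLE (ι := ι) (k := k) K f₁
  let W : Submodule k M :=
    extDegreeLE ι k M m ⊓ LinearMap.ker ((Algebra.trace K M).restrictScalars k)
  have hmW {f : M} : f ∈ W ↔ f ∈ extDegreeLE ι k M m ∧ Algebra.trace K M f = 0 := Iff.rfl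
  have := finiteDimensional_extDegreeLE (ι := ι) (k := k) (M := M) K m
  have : FiniteDimensional k W := Submodule.finiteDimensional_of_le inf_le_left
  have hW : W ≠ ⊥ := by
    refine W.ne_bot_iff.mpr ⟨_, hmW.mpr ⟨hm, ?_⟩, ?_⟩
    · rw [IsScalarTower.algebraMap_apply (MvPolynomial ι k) K M, ← Algebra.smul_def, map_smul,
        htr, smul_zero]
    · exact mul_ne_zero (fun h => hq ((map_eq_zero_iff _ hinj).mp h)) hf₁
  obtain ⟨f, hfW, hf0, hf⟩ := Module.End.exists_common_eigenvector
    (fun i => (g i).toLinearMap) hgg W hW fun i f hf => by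
      obtain ⟨h1, h2⟩ := hmW.mp hf
      refine hmW.mpr ⟨isIntegralElem_degreeReesHom_map (g i : M →+* M)
        (translate (Pi.single i 1) : MvPolynomial ι k →ₐ[k] _).toRingHom
        (totalDegree_translate_le _) (hgX i) h1, ?_⟩
      apply (algebraMap K M).injective
      have h3 := trace_eq_sum_automorphisms (K := K) f
      rw [h2, map_zero] at h3
      rw [trace_eq_sum_automorphisms, map_zero, ← map_zero (g i), h3, map_sum]
      exact Finset.sum_congr rfl fun γ _ => (hgγ i γ f).symm
  obtain ⟨hfm, hft⟩ := hmW.mp hfW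
  have hfint : IsIntegral (MvPolynomial ι k) f := isIntegral_of_isIntegralElem_degreeReesHom hfm
  set Q := minpoly (MvPolynomial ι k) f with hQdef
  have hQ : Q.Monic := minpoly.monic hfint
  have : Module.IsTorsionFree (MvPolynomial ι k) M :=
    Module.isTorsionFree_iff_algebraMap_injective.mpr hinj
  have hconst (l : ℕ) : ∃ c, Q.coeff l = C c := by
    refine exists_eq_C_of_translate_eq_smul fun i => ?_
    obtain ⟨c, hc⟩ := hf i
    have hc : g i f = algebraMap k M c * f := by rw [← Algebra.smul_def]; exact hc
    have hc0 : c ≠ 0 := by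
      rintro rfl
      rw [map_zero, zero_mul, map_eq_zero] at hc
      exact hf0 hc
    let τ : MvPolynomial ι k →+* MvPolynomial ι k :=
      (translate (Pi.single i 1) : MvPolynomial ι k →ₐ[k] _).toRingHom
    have h1 : Polynomial.aeval (g i f) (Q.map τ) = 0 := by
      have h2 : (algebraMap (MvPolynomial ι k) M).comp τ =
          (g i : M →+* M).comp (algebraMap _ M) := RingHom.ext fun P => (hgX i P).symm
      rw [Polynomial.aeval_def, Polynomial.eval₂_map, h2]
      change Polynomial.eval₂ _ ((g i : M →+* M) f) Q = 0
      rw [← Polynomial.hom_eval₂, ← Polynomial.aeval_def, minpoly.aeval, map_zero]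
    have h3 := Polynomial.scaleRoots_aeval_eq_zero (r := (C c⁻¹ : MvPolynomial ι k)) h1
    have h4 : algebraMap (MvPolynomial ι k) M (C c⁻¹) * g i f = f := by
      rw [hc, ← MvPolynomial.algebraMap_eq, ← IsScalarTower.algebraMap_apply, ← mul_assoc,
        ← map_mul, inv_mul_cancel₀ hc0, map_one, one_mul]
    rw [h4] at h3
    have h5 := Polynomial.eq_of_monic_of_dvd_of_natDegree_le hQ
      ((Polynomial.monic_scaleRoots_iff _).mpr (hQ.map τ))
      (minpoly.isIntegrallyClosed_dvd hfint h3)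
      (by rw [Polynomial.natDegree_scaleRoots, hQ.natDegree_map])
    have h6 := congrArg (fun p => Polynomial.coeff p l) h5
    simp only [Polynomial.coeff_scaleRoots, Polynomial.coeff_map] at h6
    refine ⟨c ^ ((Q.map τ).natDegree - l), ?_⟩
    conv_rhs => rw [← h6]
    rw [mul_left_comm, C_pow, ← mul_pow, ← C_mul, mul_inv_cancel₀ hc0, C_1, one_pow, mul_one]
    rfl
  have hfk : IsAlgebraic k f := by
    choose c hc using hconst
    have hl : Q ∈ Polynomial.lifts (C : k →+* MvPolynomial ι k) := by
      rw [Polynomial.lifts_iff_coeff_lifts]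
      exact fun l => ⟨c l, (hc l).symm⟩
    obtain ⟨p, hp, -, hpm⟩ := Polynomial.lifts_and_natDegree_eq_and_monic hl hQ
    refine ⟨p, hpm.ne_zero, ?_⟩
    have := minpoly.aeval (MvPolynomial ι k) f
    rw [← hQdef, ← hp, Polynomial.aeval_def, Polynomial.eval₂_map, ← MvPolynomial.algebraMap_eq,
      ← IsScalarTower.algebraMap_eq] at this
    exact this
  obtain ⟨c, rfl⟩ := hfk.mem_range_algebraMap
  rw [IsScalarTower.algebraMap_apply k K M, Algebra.trace_algebraMap, nsmul_eq_mul] at hft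
  refine hf0 ?_
  rw [IsScalarTower.algebraMap_apply k K M, (mul_eq_zero.mp hft).resolve_left hd, map_zero]

end Translations

section FixingSubgroup

variable {k F ι : Type*} [Field k] [Field F] [Algebra k F]

/-- An automorphism fixing a set fixes the field it generates. -/
theorem AlgEquiv.apply_eq_of_mem_adjoin (u : F ≃ₐ[k] F) {s : Set F} (hu : ∀ a ∈ s, u a = a)
    {a : F} (ha : a ∈ IntermediateField.adjoin k s) : u a = a := by
  induction ha using IntermediateField.adjoin_induction with
  | mem a h => exact hu a h
  | algebraMap c => exact u.commutes c
  | add a b _ _ ha hb => rw [map_add, ha, hb]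
  | inv a _ ha => rw [map_inv₀, ha]
  | mul a b _ _ ha hb => rw [map_mul, ha, hb]

theorem AlgEquiv.exists_restrictScalars_eq (u : F ≃ₐ[k] F) {s : Set F} (hu : ∀ a ∈ s, u a = a) :
    ∃ γ : F ≃ₐ[IntermediateField.adjoin k s] F, ∀ a, γ a = u a :=
  ⟨AlgEquiv.ofRingEquiv (f := u.toRingEquiv) fun a => u.apply_eq_of_mem_adjoin hu a.2,
    fun _ => rfl⟩

theorem IntermediateField.isGalois_of_isAlgClosed [IsAlgClosed F] [CharZero k]
    (L : IntermediateField k F) [Algebra.IsAlgebraic L F] : IsGalois L F := by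
  have : CharZero L := charZero_of_injective_algebraMap (algebraMap k L).injective
  have : Normal L F := ⟨fun _ => IsAlgClosed.splits _⟩
  constructor

theorem IsTranscendenceBasis.isGalois [IsAlgClosed F] [CharZero k] {y : ι → F}
    (hy : IsTranscendenceBasis k y) :
    IsGalois (IntermediateField.adjoin k (Set.range y)) F := by
  have := hy.isAlgebraic_field
  exact IntermediateField.isGalois_of_isAlgClosed _

/-- A group of automorphisms is pointwise closed if it contains every automorphism agreeing with
one of its members on any given finite set. -/
def IsPointwiseClosed (N : Subgroup (F ≃ₐ[k] F)) : Prop :=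
  ∀ h : F ≃ₐ[k] F, (∀ S : Finset F, ∃ ν ∈ N, ∀ a ∈ S, ν a = h a) → h ∈ N

/-- The part of a pointwise closed group of automorphisms that fixes a transcendence basis is
closed in the Krull topology. -/
theorem IsPointwiseClosed.isClosed_comap [IsAlgClosed F] [CharZero k] {y : ι → F}
    (hy : IsTranscendenceBasis k y) {N : Subgroup (F ≃ₐ[k] F)} (hN : IsPointwiseClosed N) :
    IsClosed ((N.comap (AlgEquiv.restrictScalarsHom k) :
      Subgroup (F ≃ₐ[IntermediateField.adjoin k (Set.range y)] F)) :
      Set (F ≃ₐ[IntermediateField.adjoin k (Set.range y)] F)) := by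
  have := hy.isAlgebraic_field
  rw [← isOpen_compl_iff, isOpen_iff_forall_mem_open]
  intro h hh
  have : ∃ S : Finset F, ∀ ν ∈ N, ∃ a ∈ S, ν a ≠ h a := by
    by_contra! hc
    exact hh (hN (AlgEquiv.restrictScalarsHom k h) hc)
  obtain ⟨S, hS⟩ := this
  refine ⟨⋂ a ∈ S, {γ | h⁻¹ * γ ∈ MulAction.stabilizer _ a}, ?_, ?_, ?_⟩
  · intro γ hγ hγN
    obtain ⟨a, ha, hne⟩ := hS _ hγN
    refine hne ?_
    have h1 : h⁻¹ (γ a) = a := (Set.mem_iInter₂.mp hγ a ha :)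
    change γ a = h a
    rw [← h1]
    change _ = h (h.symm _)
    simp [h1]
  · refine isOpen_biInter_finset fun a _ => ?_
    exact (stabilizer_isOpen_of_isIntegral a).preimage (continuous_const_mul h⁻¹)
  · refine Set.mem_iInter₂.mpr fun a _ => ?_
    rw [Set.mem_ofPred_eq, inv_mul_cancel]
    exact one_mem _

theorem IsTranscendenceBasis.isFractionRing_adjoin {y : ι → F} (hy : AlgebraicIndependent k y)
    [Algebra (MvPolynomial ι k) (IntermediateField.adjoin k (Set.range y))]
    (halg : ∀ P, (algebraMap (MvPolynomial ι k) (IntermediateField.adjoin k (Set.range y)) P : F) =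
      MvPolynomial.aeval y P) :
    IsFractionRing (MvPolynomial ι k) (IntermediateField.adjoin k (Set.range y)) := by
  refine IsLocalization.isLocalization_of_algEquiv _
    (AlgEquiv.ofRingEquiv (f := hy.aevalEquivField.toRingEquiv) fun P => Subtype.ext ?_)
  rw [halg]
  exact hy.aevalEquivField_algebraMap_apply_coe P

/-- A pointwise closed group of automorphisms, normalized by the stabilizer of a transcendence
basis and containing the unit translations of that basis, contains the stabilizer. -/
theorem IsPointwiseClosed.mem_of_translations [IsAlgClosed k] [IsAlgClosed F] [CharZero k]
    [Finite ι] [DecidableEq ι] {y : ι → F} (hy : IsTranscendenceBasis k y)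
    {N : Subgroup (F ≃ₐ[k] F)} (hN : IsPointwiseClosed N)
    (hnorm : ∀ u : F ≃ₐ[k] F, (∀ i, u (y i) = y i) → ∀ σ ∈ N, u * σ * u⁻¹ ∈ N)
    (g : ι → F ≃ₐ[k] F) (hgN : ∀ i, g i ∈ N)
    (hgy : ∀ i j, g i (y j) = y j + algebraMap k F ((Pi.single i 1 : ι → k) j))
    {u : F ≃ₐ[k] F} (hu : ∀ i, u (y i) = y i) : u ∈ N := by
  have := hy.isGalois
  let L := IntermediateField.adjoin k (Set.range y)
  let ρ : (F ≃ₐ[L] F) →* (F ≃ₐ[k] F) := AlgEquiv.restrictScalarsHom k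
  have hρ (γ : F ≃ₐ[L] F) (a : F) : ρ γ a = γ a := rfl
  have hyL (i) : y i ∈ L := IntermediateField.subset_adjoin k _ ⟨i, rfl⟩
  have hγy (γ : F ≃ₐ[L] F) (i) : γ (y i) = y i := γ.commutes (⟨y i, hyL i⟩ : L)
  let H : ClosedSubgroup (F ≃ₐ[L] F) := ⟨N.comap ρ, hN.isClosed_comap hy⟩
  have hmemH (γ : F ≃ₐ[L] F) : γ ∈ H.toSubgroup ↔ ρ γ ∈ N := Iff.rfl
  have hHn : H.toSubgroup.Normal := ⟨fun σ hσ γ => by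
    rw [hmemH, map_mul, map_mul, map_inv]
    exact hnorm _ (hγy γ) _ hσ⟩
  let E := IntermediateField.fixedField H.toSubgroup
  have hEH : E.fixingSubgroup = H.toSubgroup := InfiniteGalois.fixingSubgroup_fixedField H
  have hEgal : IsGalois L E := by
    rw [← InfiniteGalois.normal_iff_isGalois, hEH]
    exact hHn
  have hEfix {f : F} (hf : f ∈ E) {c : F ≃ₐ[k] F} (hc : c ∈ N) (hcy : ∀ i, c (y i) = y i) :
      c f = f := by
    obtain ⟨γ, hγ⟩ := c.exists_restrictScalars_eq (s := Set.range y)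
      (by rintro _ ⟨i, rfl⟩; exact hcy i)
    rw [← hγ]
    refine (IntermediateField.mem_fixedField_iff _ _).mp hf γ ((hmemH γ).mpr ?_)
    rwa [show ρ γ = c from AlgEquiv.ext hγ]
  have hginv (i j) : (g i)⁻¹ (y j) = y j - algebraMap k F ((Pi.single i 1 : ι → k) j) := by
    change (g i).symm _ = _
    rw [AlgEquiv.symm_apply_eq, map_sub, hgy, AlgEquiv.commutes, add_sub_cancel_right]
  have hcommγ (i) (γ : F ≃ₐ[L] F) {f : F} (hf : f ∈ E) : g i (γ f) = γ (g i f) := by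
    have h1 : ((ρ γ)⁻¹ * (g i)⁻¹ * ρ γ) * g i ∈ N := by
      refine mul_mem ?_ (hgN i)
      have := hnorm (ρ γ)⁻¹ (fun j => by rw [← map_inv, hρ, hγy]) _ (inv_mem (hgN i))
      rwa [inv_inv] at this
    have hγinv (j) : (ρ γ)⁻¹ (y j) = y j := by rw [← map_inv, hρ, hγy]
    have h2 := hEfix hf h1 fun j => by
      simp only [AlgEquiv.mul_apply, hgy, map_add, map_sub, AlgEquiv.commutes, hρ, hγy, hginv,
        hγinv, sub_add_cancel]
    simp only [AlgEquiv.mul_apply] at h2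
    have h3 := congrArg (fun a => g i (ρ γ a)) h2
    simp only [← AlgEquiv.mul_apply, ← mul_assoc, mul_inv_cancel, one_mul] at h3
    exact h3.symm
  have hcommg (i j) {f : F} (hf : f ∈ E) : g i (g j f) = g j (g i f) := by
    have h1 : (g j)⁻¹ * (g i)⁻¹ * g j * g i ∈ N :=
      mul_mem (mul_mem (mul_mem (inv_mem (hgN j)) (inv_mem (hgN i))) (hgN j)) (hgN i)
    have h2 := hEfix hf h1 fun l => by
      simp only [AlgEquiv.mul_apply, hgy, map_add, AlgEquiv.commutes, hginv, map_sub]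
      ring
    have h3 := congrArg (fun a => g i (g j a)) h2
    simp only [← AlgEquiv.mul_apply, ← mul_assoc, mul_inv_cancel, one_mul] at h3
    exact h3.symm
  have hEbot : E ≤ ⊥ := by
    intro β hβ
    let M' : IntermediateField L F :=
      (FiniteGaloisIntermediateField.adjoin L {β}).toIntermediateField
    have hβM : β ∈ M' := FiniteGaloisIntermediateField.subset_adjoin L {β} (Set.mem_singleton β)
    have hM'E : M' ≤ E := by
      change IntermediateField.normalClosure L (IntermediateField.adjoin L {β}) F ≤ E
      rw [IntermediateField.normalClosure_le_iff_of_normal]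
      exact IntermediateField.adjoin_le_iff.mpr (Set.singleton_subset_iff.mpr hβ)
    have hgM (i) {f : F} (hf : f ∈ M') : g i f ∈ M' := by
      rw [← InfiniteGalois.fixedField_fixingSubgroup M', IntermediateField.mem_fixedField_iff]
      intro γ hγ
      rw [← hcommγ i γ (hM'E hf), (IntermediateField.mem_fixingSubgroup_iff _ _).mp hγ f hf]
    let φ : MvPolynomial ι k →ₐ[k] L := MvPolynomial.aeval fun i => ⟨y i, hyL i⟩
    have hφ (P) : (φ P : F) = MvPolynomial.aeval y P :=
      DFunLike.congr_fun (MvPolynomial.algHom_ext (fun i => by simp [φ]) :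
        L.val.comp φ = MvPolynomial.aeval y) P
    let _ : Algebra (MvPolynomial ι k) L := φ.toRingHom.toAlgebra
    have : IsFractionRing (MvPolynomial ι k) L := IsTranscendenceBasis.isFractionRing_adjoin hy.1 hφ
    let _ : Algebra (MvPolynomial ι k) M' := ((algebraMap L M').comp φ.toRingHom).toAlgebra
    have : IsScalarTower (MvPolynomial ι k) L M' := .of_algebraMap_eq fun _ => rfl
    have : IsScalarTower k (MvPolynomial ι k) L := .of_algebraMap_eq fun c => (φ.commutes c).symm
    have : IsScalarTower k (MvPolynomial ι k) M' := .of_algebraMap_eq fun c => by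
      rw [IsScalarTower.algebraMap_apply (MvPolynomial ι k) L M',
        ← IsScalarTower.algebraMap_apply k _ L, ← IsScalarTower.algebraMap_apply]
    have halg (P) : ((algebraMap (MvPolynomial ι k) M' P : M') : F) = MvPolynomial.aeval y P := hφ P
    let g' (i : ι) : M' →ₐ[k] M' :=
      { toFun := fun f => ⟨g i f, hgM i f.2⟩
        map_one' := Subtype.ext (map_one (g i))
        map_mul' := fun a b => Subtype.ext (map_mul (g i) (a : F) b)
        map_zero' := Subtype.ext (map_zero (g i))
        map_add' := fun a b => Subtype.ext (map_add (g i) (a : F) b)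
        commutes' := fun c => Subtype.ext ((g i).commutes c) }
    have : IsGalois L M' := (FiniteGaloisIntermediateField.adjoin L {β}).isGalois
    have : FiniteDimensional L M' := (FiniteGaloisIntermediateField.adjoin L {β}).finiteDimensional
    obtain ⟨a, ha⟩ := surjective_algebraMap_of_translations (K := L) g'
      (fun i P => Subtype.ext <| by
        change g i (algebraMap (MvPolynomial ι k) M' P : M') = _
        rw [halg, halg, MvPolynomial.translate]
        induction P using MvPolynomial.induction_on with
        | C c => simp
        | add p q hp hq => simp only [map_add, hp, hq]
        | mul_X p j hp => simp only [map_mul, hp]; simp [hgy])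
      (fun i γ f => Subtype.ext <| by
        have h1 (f : M') : ((γ f : M') : F) = γ.liftNormal F f := (γ.liftNormal_commutes F f).symm
        change g i (γ f : M') = (γ (g' i f) : M')
        rw [h1, h1, hcommγ i _ (hM'E f.2)]
        rfl)
      (fun i j f => Subtype.ext (hcommg i j (hM'E f.2))) ⟨β, hβM⟩
    exact IntermediateField.mem_bot.mpr ⟨a, congrArg Subtype.val ha⟩
  obtain ⟨γ, hγ⟩ := u.exists_restrictScalars_eq (s := Set.range y)
    (by rintro _ ⟨i, rfl⟩; exact hu i)
  have h1 : γ ∈ E.fixingSubgroup := by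
    rw [IntermediateField.mem_fixingSubgroup_iff]
    intro f hf
    obtain ⟨a, rfl⟩ := IntermediateField.mem_bot.mp (hEbot hf)
    exact γ.commutes a
  rw [hEH, hmemH] at h1
  rwa [show ρ γ = u from AlgEquiv.ext hγ] at h1

end FixingSubgroup

section Kummer

variable {k F ι : Type*} [Field k] [Field F] [Algebra k F]

theorem IsTranscendenceBasis.update_of_pow_mem [Finite ι] [DecidableEq ι] {x : ι → F}
    (hx : IsTranscendenceBasis k x) (i : ι) {w : F} {p : ℕ}
    {c : k} (hw : w ^ p = x i + algebraMap k F c) :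
    IsTranscendenceBasis k (Function.update x i w) := by
  refine hx.update_of_isAlgebraic i w ?_
  set A := Algebra.adjoin k (Set.range (Function.update x i w))
  have hwA : w ∈ A := Algebra.subset_adjoin ⟨i, by simp⟩
  have h : x i ∈ A := by
    rw [← add_sub_cancel_right (x i) (algebraMap k F c), ← hw]
    exact sub_mem (pow_mem hwA p) (A.algebraMap_mem c)
  exact isAlgebraic_algebraMap (⟨x i, h⟩ : A)

/-- In a finitely generated extension, a transcendental element has `p`-th roots for only finitely
many `p`. -/
theorem IsTranscendenceBasis.exists_forall_root_notMem_adjoin [Finite ι] [IsAlgClosed F]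
    [CharZero F] {x : ι → F} (hx : IsTranscendenceBasis k x) {S : Set F} (hS : S.Finite)
    (hF : Algebra.IsAlgebraic (Algebra.adjoin k S) F) {f : F}
    (hf : f ∈ IntermediateField.adjoin k S) (hft : Transcendental k f) :
    ∃ B : ℕ, ∀ p > B, ∀ r : F, r ^ p = f → r ∉ IntermediateField.adjoin k S := by
  classical
  have hF' : Algebra.IsAlgebraic
      (Algebra.adjoin k (IntermediateField.adjoin k S : Set F)) F := by
    refine ⟨fun a => ?_⟩
    refine IsAlgebraic.adjoin_of_forall_isAlgebraic (s := S) ?_ (hF.isAlgebraic a)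
    rintro b ⟨hb, hb'⟩
    exact absurd (IntermediateField.subset_adjoin k S hb) hb'
  obtain ⟨s, hs, hfs, hsE⟩ := hx.exists_between (s := {f})
    (Set.singleton_subset_iff.mpr hf) ((algebraicIndependent_unique_type_iff).mpr hft) hF'
  obtain ⟨i, rfl⟩ := hfs rfl
  let L := IntermediateField.adjoin k (Set.range s)
  have := hs.isAlgebraic_field
  let M := IntermediateField.adjoin L S
  have : FiniteDimensional L M := by
    have := hS.to_subtype
    exact IntermediateField.finiteDimensional_adjoin fun a _ =>
      (Algebra.IsAlgebraic.isAlgebraic a).isIntegral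
  refine ⟨Module.finrank L M, fun p hp r hr hrE => ?_⟩
  have hrM : r ∈ M := by
    have : IntermediateField.adjoin k S ≤ M.restrictScalars k :=
      IntermediateField.adjoin_le_iff.mpr (IntermediateField.subset_adjoin L S)
    exact this hrE
  have hdeg : (minpoly L r).natDegree ≤ Module.finrank L M := by
    rw [show minpoly L r = minpoly L (⟨r, hrM⟩ : M) from
      minpoly.algebraMap_eq M.val.injective (⟨r, hrM⟩ : M)]
    exact minpoly.natDegree_le _
  have : NeZero p := ⟨by omega⟩
  obtain ⟨ζ, hζ⟩ := HasEnoughRootsOfUnity.exists_primitiveRoot F p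
  have hs0 : s i ≠ 0 := fun h => hft (h ▸ isAlgebraic_zero)
  have hroot (r' : F) (hr' : r' ^ p = s i) :
      r' ∈ (minpoly L r).aroots F := by
    have hup (a : F) (ha : a ^ p = s i) : IsTranscendenceBasis k (Function.update s i a) :=
      hs.update_of_pow_mem i (c := 0) (by rw [ha, map_zero, add_zero])
    obtain ⟨φ, hφ⟩ := (hup r hr).exists_algEquiv (hup r' hr')
    have hφr : φ r = r' := by simpa using hφ i
    obtain ⟨γ, hγ⟩ := φ.exists_restrictScalars_eq (s := Set.range s) <| by
      rintro _ ⟨j, rfl⟩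
      rcases eq_or_ne j i with rfl | hj
      · rw [← hr, map_pow, hφr, hr, hr']
      · simpa [hj] using hφ j
    have hne := minpoly.ne_zero (Algebra.IsAlgebraic.isAlgebraic (R := L) r).isIntegral
    rw [Polynomial.mem_aroots, ← hφr, ← hγ]
    exact ⟨hne, by rw [Polynomial.aeval_algHom_apply γ, minpoly.aeval, map_zero]⟩
  have hcard := hζ.card_nthRoots (s i)
  rw [if_pos ⟨r, hr⟩] at hcard
  have hle : Polynomial.nthRoots p (s i) ≤ (minpoly L r).aroots F := by
    rw [Multiset.le_iff_subset (hζ.nthRoots_nodup hs0)]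
    intro a ha
    exact hroot a ((Polynomial.mem_nthRoots (by omega)).mp ha)
  have h1 := Multiset.card_le_card hle
  have h2 := (Polynomial.card_roots' ((minpoly L r).map (algebraMap L F)))
  rw [Polynomial.natDegree_map] at h2
  rw [hcard] at h1
  have h3 : p ≤ (minpoly L r).natDegree := h1.trans h2
  omega

theorem AlgEquiv.exists_transcendental_div [IsAlgClosed k] (σ : F ≃ₐ[k] F) {a : F}
    (ha : Transcendental k a) (hσ : σ a ≠ a) :
    ∃ b : k, Transcendental k ((a + algebraMap k F b) / (σ a + algebraMap k F b)) := by
  by_contra! h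
  have hσa : Transcendental k (σ a) := fun h => ha <| by
    simpa using h.algHom (σ.symm : F →ₐ[k] F)
  have hne (b : k) : σ a + algebraMap k F b ≠ 0 := fun h0 => hσa <| by
    rw [eq_neg_of_add_eq_zero_left h0]
    exact isAlgebraic_algebraMap (A := F) b |>.neg
  have key (b : k) : ∃ c : k, a + algebraMap k F b =
      algebraMap k F c * (σ a + algebraMap k F b) := by
    obtain ⟨c, hc⟩ := IsAlgebraic.mem_range_algebraMap (not_not.mp (h b))
    exact ⟨c, by rw [hc, div_mul_cancel₀ _ (hne b)]⟩
  obtain ⟨c, hc⟩ := key 0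
  obtain ⟨c', hc'⟩ := key 1
  simp only [map_zero, add_zero, map_one] at hc hc'
  have h1 : algebraMap k F (c - c') * σ a = algebraMap k F (c' - 1) := by
    simp only [map_sub, map_one]
    linear_combination hc' - hc
  rcases eq_or_ne c c' with rfl | hcc
  · rw [sub_self, map_zero, zero_mul] at h1
    have h2 : algebraMap k F c = 1 := by
      rw [map_sub, map_one] at h1
      exact (sub_eq_zero.mp h1.symm)
    rw [h2, one_mul] at hc
    exact hσ hc.symm
  · have h2 : algebraMap k F (c - c') ≠ 0 := by
      rw [Ne, map_eq_zero]
      exact sub_ne_zero.mpr hcc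
    refine hσa ?_
    rw [← mul_div_cancel_left₀ (σ a) h2, h1, ← map_div₀]
    exact isAlgebraic_algebraMap _

/-- An automorphism fixing a power of `w` scales `w` by a root of unity. -/
theorem AlgEquiv.exists_apply_eq_mul_of_pow [IsAlgClosed k] (t : F ≃ₐ[k] F) {w : F} {p : ℕ}
    (hp : 0 < p) (h : t (w ^ p) = w ^ p) : ∃ ξ : k, ξ ^ p = 1 ∧ t w = algebraMap k F ξ * w := by
  rcases eq_or_ne w 0 with rfl | hw
  · exact ⟨1, one_pow p, by simp⟩
  have hroot : (t w / w) ^ p = 1 := by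
    rw [div_pow, ← map_pow, h, div_self (pow_ne_zero p hw)]
  have halg : IsAlgebraic k (t w / w) := .of_pow hp (hroot ▸ isAlgebraic_one)
  obtain ⟨ξ, hξ⟩ := halg.mem_range_algebraMap
  refine ⟨ξ, (algebraMap k F).injective ?_, ?_⟩
  · rw [map_pow, hξ, hroot, map_one]
  · rw [hξ, div_mul_cancel₀ _ hw]

/-- A group of automorphisms normalized by the stabilizer of a transcendence basis `x` and moving
`x i` contains elements of that stabilizer acting nontrivially on `p`-th roots of a translate
of `x i`, for all large `p`. -/
theorem IsTranscendenceBasis.exists_mem_forall_root_ne [Finite ι] [IsAlgClosed k] [IsAlgClosed F]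
    [CharZero k] {x : ι → F} (hx : IsTranscendenceBasis k x) {N : Subgroup (F ≃ₐ[k] F)}
    (hnorm : ∀ u : F ≃ₐ[k] F, (∀ i, u (x i) = x i) → ∀ σ ∈ N, u * σ * u⁻¹ ∈ N)
    {σ : F ≃ₐ[k] F} (hσN : σ ∈ N) {i : ι} (hσ : σ (x i) ≠ x i) :
    ∃ b : k, ∃ B : ℕ, ∀ p > B, ∀ w : F, w ^ p = x i + algebraMap k F b →
      ∃ ν ∈ N, (∀ j, ν (x j) = x j) ∧ ν w ≠ w := by
  have : CharZero F := charZero_of_injective_algebraMap (algebraMap k F).injective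
  have hxi : Transcendental k (x i) := hx.1.transcendental i
  obtain ⟨b, hb⟩ := σ⁻¹.exists_transcendental_div hxi fun h => hσ <| by
    conv_lhs => rw [← h]
    exact σ.apply_symm_apply _
  set S : Set F := Set.range x ∪ Set.range fun j => σ⁻¹ (x j)
  set E := IntermediateField.adjoin k S
  have hS : S.Finite := (Set.finite_range x).union (Set.finite_range _)
  have hxE (j) : x j ∈ E := IntermediateField.subset_adjoin k S (.inl ⟨j, rfl⟩)
  have hσxE (j) : σ⁻¹ (x j) ∈ E := IntermediateField.subset_adjoin k S (.inr ⟨j, rfl⟩)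
  have hF : Algebra.IsAlgebraic (Algebra.adjoin k S) F := by
    refine ⟨fun a => IsAlgebraic.adjoin_of_forall_isAlgebraic (s := Set.range x) ?_
      (hx.isAlgebraic.isAlgebraic a)⟩
    exact fun c hc => absurd (.inl hc.1) hc.2
  have : Algebra.IsAlgebraic E F := IntermediateField.isAlgebraic_adjoin_iff_top.mpr hF
  have := E.isGalois_of_isAlgClosed
  have hEb {a : F} (ha : a ∈ E) : a + algebraMap k F b ∈ E := add_mem ha (E.algebraMap_mem b)
  obtain ⟨B, hB⟩ := hx.exists_forall_root_notMem_adjoin hS hF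
    (div_mem (hEb (hxE i)) (hEb (hσxE i))) hb
  refine ⟨b, B, fun p hp w hw => ?_⟩
  have hw' : σ⁻¹ w ^ p = σ⁻¹ (x i) + algebraMap k F b := by
    rw [← map_pow, hw, map_add, AlgEquiv.commutes]
  have hr := hB p hp (w / σ⁻¹ w) (by rw [div_pow, hw, hw'])
  obtain ⟨τ, hτ⟩ : ∃ τ : F ≃ₐ[E] F, τ (w / σ⁻¹ w) ≠ w / σ⁻¹ w := by
    by_contra! h
    obtain ⟨e, he⟩ := IntermediateField.mem_bot.mp ((InfiniteGalois.mem_bot_iff_fixed _).mpr h)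
    exact hr (he ▸ e.2)
  let t : F ≃ₐ[k] F := AlgEquiv.restrictScalarsHom k τ
  have htE {a : F} (ha : a ∈ E) : t a = a := τ.commutes ⟨a, ha⟩
  have htE' {a : F} (ha : a ∈ E) : t⁻¹ a = a := τ⁻¹.commutes ⟨a, ha⟩
  refine ⟨t⁻¹ * σ * t * σ⁻¹, ?_, fun j => ?_, fun h => hτ ?_⟩
  · have := hnorm t⁻¹ (fun j => htE' (hxE j)) σ hσN
    rw [inv_inv] at this
    exact mul_mem this (inv_mem hσN)
  · simp only [AlgEquiv.mul_apply]
    rw [htE (hσxE j), ← AlgEquiv.mul_apply σ, mul_inv_cancel, AlgEquiv.one_apply, htE' (hxE j)]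
  · have hp0 : 0 < p := by omega
    obtain ⟨c, hc1, hc⟩ := t.exists_apply_eq_mul_of_pow hp0 (w := σ⁻¹ w)
      (by rw [hw', htE (hEb (hσxE i))])
    have htw : t w = algebraMap k F c * w := by
      have h1 := congrArg t h
      simp only [AlgEquiv.mul_apply] at h1
      rw [← AlgEquiv.mul_apply t t⁻¹, mul_inv_cancel, AlgEquiv.one_apply, hc, map_mul,
        AlgEquiv.commutes, ← AlgEquiv.mul_apply σ, mul_inv_cancel, AlgEquiv.one_apply] at h1
      exact h1.symm
    have hc0 : algebraMap k F c ≠ 0 := by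
      rw [Ne, map_eq_zero]
      rintro rfl
      simp [hp0.ne'] at hc1
    change t _ = _
    rw [map_div₀, htw, hc, mul_div_mul_left _ _ hc0]

end Kummer

section NormalizedByStabilizers

variable {k F ι : Type*} [Field k] [Field F] [Algebra k F]

/-- A group of automorphisms is normalized by the pointwise stabilizers of all transcendence bases
indexed by `ι`. -/
def IsBasisNormalized (ι : Type*) (N : Subgroup (F ≃ₐ[k] F)) : Prop :=
  ∀ x : ι → F, IsTranscendenceBasis k x → ∀ u : F ≃ₐ[k] F, (∀ i, u (x i) = x i) →
    ∀ σ ∈ N, u * σ * u⁻¹ ∈ N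

/-- An automorphism translating `w` fixes no subfield over which `w` is algebraic. -/
theorem AlgEquiv.not_isAlgebraic_adjoin_of_apply_eq_add_one [CharZero F] (g : F ≃ₐ[k] F)
    {s : Set F} (hg : ∀ a ∈ s, g a = a) {w : F} (hw : g w = w + 1) :
    ¬ IsAlgebraic (IntermediateField.adjoin k s) w := by
  intro halg
  obtain ⟨γ, hγ⟩ := g.exists_restrictScalars_eq hg
  have hγn (n : ℕ) : (γ ^ n) w = w + n := by
    induction n with
    | zero => simp
    | succ n ih =>
      rw [pow_succ', AlgEquiv.mul_apply, ih, map_add, map_natCast, hγ, hw]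
      push_cast
      ring
  refine Set.infinite_of_injective_forall_mem (f := fun n : ℕ => w + n)
    (fun a b h => by simpa using h) (fun n => ?_)
    ((minpoly (IntermediateField.adjoin k s) w).rootSet_finite F)
  rw [Polynomial.mem_rootSet, ← hγn]
  exact ⟨minpoly.ne_zero halg.isIntegral,
    by rw [Polynomial.aeval_algHom_apply (γ ^ n), minpoly.aeval, map_zero]⟩

theorem exists_injective_prime_gt (ι : Type*) [Finite ι] (B : ι → ℕ) :
    ∃ p : ι → ℕ, Function.Injective p ∧ (∀ i, (p i).Prime) ∧ ∀ i, B i < p i := by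
  have := Fintype.ofFinite ι
  let e := Fintype.equivFin ι
  refine ⟨fun i => Nat.nth Nat.Prime (∑ j, B j + e i), fun i j h => ?_,
    fun i => Nat.prime_nth_prime _, fun i => ?_⟩
  · have := Nat.nth_injective Nat.infinite_setOfPred_prime h
    exact e.injective (Fin.ext (by omega))
  · change B i < Nat.nth Nat.Prime (∑ j, B j + e i)
    have h1 := Nat.add_two_le_nth_prime (∑ j, B j + e i)
    have h2 := Finset.single_le_sum (f := B) (fun j _ => Nat.zero_le _) (Finset.mem_univ i)
    omega

theorem AlgEquiv.pow_apply_eq_mul (u : F ≃ₐ[k] F) {w : F} {ξ : k}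
    (h : u w = algebraMap k F ξ * w) (m : ℕ) : (u ^ m) w = algebraMap k F (ξ ^ m) * w := by
  induction m with
  | zero => simp
  | succ m ih =>
    rw [pow_succ, AlgEquiv.mul_apply, h, map_mul, AlgEquiv.commutes, ih, pow_succ, map_mul]
    ring

variable [Finite ι] [IsAlgClosed F] [CharZero k]

/-- A diagonal element scaling one member of a transcendence basis gives rise to a unit
translation of that member. -/
theorem IsBasisNormalized.exists_translation [DecidableEq ι] {N : Subgroup (F ≃ₐ[k] F)}
    (hN : IsBasisNormalized ι N) {y : ι → F} (hy : IsTranscendenceBasis k y) {i : ι}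
    {ν : F ≃ₐ[k] F} (hν : ν ∈ N) (hνj : ∀ j ≠ i, ν (y j) = y j) {ξ : k} (hξ : ξ ≠ 1)
    (hνi : ν (y i) = algebraMap k F ξ * y i) :
    ∃ g ∈ N, ∀ j, g (y j) = y j + algebraMap k F ((Pi.single i 1 : ι → k) j) := by
  have : CharZero F := charZero_of_injective_algebraMap (algebraMap k F).injective
  have hξ0 : ξ ≠ 0 := by
    rintro rfl
    rw [map_zero, zero_mul, map_eq_zero] at hνi
    exact hy.1.transcendental i (hνi ▸ isAlgebraic_zero)
  have hξ1 : ξ⁻¹ - 1 ≠ 0 := sub_ne_zero.mpr fun h => hξ (inv_eq_one.mp h)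
  set c : k := (ξ⁻¹ - 1)⁻¹
  obtain ⟨s, hsi, hsj, x', hx', hs⟩ := hy.exists_reflection i
    ((Algebra.adjoin k (y '' {i}ᶜ)).algebraMap_mem c)
  have hsi' : s⁻¹ (y i) = algebraMap k F c - y i := by
    refine s.symm_apply_eq.mpr ?_
    rw [map_sub, AlgEquiv.commutes, hsi, sub_sub_cancel]
  have hsj' (j) (hj : j ≠ i) : s⁻¹ (y j) = y j := s.symm_apply_eq.mpr (hsj j hj).symm
  have hνi' : ν⁻¹ (y i) = algebraMap k F ξ⁻¹ * y i := by
    refine ν.symm_apply_eq.mpr ?_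
    rw [map_mul, AlgEquiv.commutes, hνi, ← mul_assoc, ← map_mul, inv_mul_cancel₀ hξ0, map_one,
      one_mul]
  have hνj' (j) (hj : j ≠ i) : ν⁻¹ (y j) = y j := ν.symm_apply_eq.mpr (hνj j hj).symm
  refine ⟨s * ν * s⁻¹ * ν⁻¹, mul_mem (hN x' hx' s hs ν hν) (inv_mem hν), fun j => ?_⟩
  simp only [AlgEquiv.mul_apply]
  rcases eq_or_ne j i with rfl | hj
  · have h1 : algebraMap k F ξ⁻¹ * algebraMap k F ξ = 1 := by
      rw [← map_mul, inv_mul_cancel₀ hξ0, map_one]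
    have h2 : (algebraMap k F ξ⁻¹ - 1) * algebraMap k F c = 1 := by
      rw [← map_one (algebraMap k F), ← map_sub, ← map_mul, mul_inv_cancel₀ hξ1]
    rw [hνi', map_mul, AlgEquiv.commutes, hsi', map_mul, map_sub, AlgEquiv.commutes,
      AlgEquiv.commutes, hνi, map_mul, map_sub, map_mul, hsi]
    simp only [AlgEquiv.commutes, Pi.single_eq_same, map_one]
    linear_combination (y j - algebraMap k F c) * h1 + h2
  · simp [hνj' j hj, hsj' j hj, hνj j hj, hsj j hj, hj]

/-- A nontrivial group of automorphisms normalized by stabilizers of transcendence bases moves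
every transcendental element. -/
theorem IsBasisNormalized.exists_apply_ne [IsAlgClosed k] {N : Subgroup (F ≃ₐ[k] F)}
    (hN : IsBasisNormalized ι N) (hne : N ≠ ⊥) {x : ι → F} (hx : IsTranscendenceBasis k x)
    {z : F} (hz : Transcendental k z) : ∃ σ ∈ N, σ z ≠ z := by
  classical
  have : CharZero F := charZero_of_injective_algebraMap (algebraMap k F).injective
  by_contra! hfix
  obtain ⟨σ, hσ, hσ1⟩ := N.bot_or_exists_ne_one.resolve_left hne
  obtain ⟨α, hα⟩ : ∃ α, σ α ≠ α := by
    by_contra! h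
    exact hσ1 (AlgEquiv.ext h)
  by_cases halg : IsAlgebraic (IntermediateField.adjoin k {z}) α
  · have hαt : Transcendental k α := fun h => by
      obtain ⟨c, rfl⟩ := h.mem_range_algebraMap
      exact hα (σ.commutes c)
    obtain ⟨y, hy, hαy⟩ := hx.exists_superset (s := {α})
      (algebraicIndependent_unique_type_iff.mpr hαt)
    obtain ⟨i, rfl⟩ := hαy rfl
    obtain ⟨b, B, hB⟩ := hy.exists_mem_forall_root_ne (hN y hy) hσ hα
    obtain ⟨w, hw⟩ := IsAlgClosed.exists_pow_nat_eq (y i + algebraMap k F b) B.succ_pos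
    obtain ⟨ν, hν, hνy, hνw⟩ := hB (B + 1) B.lt_succ_self w hw
    obtain ⟨ξ, -, hξ⟩ := ν.exists_apply_eq_mul_of_pow B.succ_pos (w := w)
      (by rw [hw, map_add, AlgEquiv.commutes, hνy])
    obtain ⟨g, hg, hgy⟩ := hN.exists_translation (hy.update_of_pow_mem i hw) (i := i) (ξ := ξ) hν
      (fun j hj => by simp [hj, hνy]) (by rintro rfl; simp [hνw] at hξ) (by simpa using hξ)
    refine g.not_isAlgebraic_adjoin_of_apply_eq_add_one (s := {z}) (w := w) ?_ ?_ ?_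
    · rintro _ rfl
      exact hfix g hg
    · simpa using hgy i
    · refine .of_pow B.succ_pos (hw ▸ halg.add ?_)
      exact (isAlgebraic_algebraMap b).extendScalars (algebraMap k _).injective
  · rw [IntermediateField.isAlgebraic_adjoin_iff] at halg
    have hαz : α ≠ z := by
      rintro rfl
      exact halg (isAlgebraic_algebraMap
        (⟨α, Algebra.subset_adjoin rfl⟩ : Algebra.adjoin k {α}))
    have hind : AlgebraicIndepOn k id {α, z} :=
      .insert (algebraicIndependent_unique_type_iff.mpr hz) (by rwa [Set.image_id])
    obtain ⟨y, hy, hαy⟩ := hx.exists_superset hind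
    obtain ⟨l, rfl⟩ := hαy (.inl rfl)
    obtain ⟨i, rfl⟩ := hαy (.inr rfl)
    obtain ⟨s, hsi, -, x', hx', hs⟩ := hy.exists_reflection i (c := y l)
      (Algebra.subset_adjoin ⟨l, fun h => hαz (congrArg y h), rfl⟩)
    have h1 := hfix _ (hN x' hx' s⁻¹ (fun j => s.symm_apply_eq.mpr (hs j).symm) σ hσ)
    have h2 : σ (s (y i)) = s (y i) := by
      rw [inv_inv] at h1
      exact s.symm_apply_eq.mp h1
    rw [hsi, map_sub, hfix σ hσ, sub_left_inj] at h2
    exact hα h2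

/-- A nontrivial pointwise closed group of automorphisms normalized by the stabilizers of
transcendence bases contains all of these stabilizers. -/
theorem IsBasisNormalized.mem_of_forall_apply_eq [IsAlgClosed k] {N : Subgroup (F ≃ₐ[k] F)}
    (hN : IsBasisNormalized ι N) (hcl : IsPointwiseClosed N) (hne : N ≠ ⊥) {x : ι → F}
    (hx : IsTranscendenceBasis k x) {h : F ≃ₐ[k] F} (hh : ∀ i, h (x i) = x i) : h ∈ N := by
  classical
  have := Fintype.ofFinite ι
  choose σ hσ hσx using fun i => hN.exists_apply_ne hne hx (hx.1.transcendental i)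
  choose b B hB using fun i => hx.exists_mem_forall_root_ne (hN x hx) (hσ i) (hσx i)
  obtain ⟨p, hpinj, hp, hBp⟩ := exists_injective_prime_gt ι B
  choose y hy using fun i =>
    IsAlgClosed.exists_pow_nat_eq (x i + algebraMap k F (b i)) (hp i).pos
  choose ν hν hνx hνy using fun i => hB i (p i) (hBp i) (y i) (hy i)
  have hyb : IsTranscendenceBasis k y := hx.of_forall_isAlgebraic fun i => by
    set A := Algebra.adjoin k (Set.range y)
    have h1 : x i ∈ A := by
      rw [← add_sub_cancel_right (x i) (algebraMap k F (b i)), ← hy]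
      exact sub_mem (pow_mem (Algebra.subset_adjoin (Set.mem_range_self i)) _) (A.algebraMap_mem _)
    exact isAlgebraic_algebraMap (⟨x i, h1⟩ : A)
  have hscale (u : F ≃ₐ[k] F) (hu : ∀ i, u (x i) = x i) (i) :
      ∃ ξ : k, ξ ^ p i = 1 ∧ u (y i) = algebraMap k F ξ * y i :=
    u.exists_apply_eq_mul_of_pow (hp i).pos (by rw [hy, map_add, hu, AlgEquiv.commutes])
  choose ξ hξ1 hξ using fun i => hscale (ν i) (hνx i)
  let m (i : ι) : ℕ := ∏ j ∈ Finset.univ.erase i, p j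
  have hmj (i j) (hj : j ≠ i) : (ν i ^ m i) (y j) = y j := by
    obtain ⟨d, hd⟩ : p j ∣ m i :=
      Finset.dvd_prod_of_mem p (Finset.mem_erase.mpr ⟨hj, Finset.mem_univ j⟩)
    rw [(ν i).pow_apply_eq_mul (hξ i j), hd, pow_mul, hξ1, one_pow,
      map_one, one_mul]
  have hmi (i) : (ν i ^ m i) (y i) = algebraMap k F (ξ i i ^ m i) * y i :=
    (ν i).pow_apply_eq_mul (hξ i i) _
  have hprim (i) : IsPrimitiveRoot (ξ i i ^ m i) (p i) := by
    have := Fact.mk (hp i)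
    refine IsPrimitiveRoot.iff_orderOf.mpr (orderOf_eq_prime ?_ fun h1 => ?_)
    · rw [← pow_mul, mul_comm, pow_mul, hξ1, one_pow]
    · have hcop : (m i).Coprime (p i) := Nat.Coprime.prod_left fun j hj =>
        (Nat.coprime_primes (hp j) (hp i)).mpr (hpinj.ne (Finset.ne_of_mem_erase hj))
      have h2 : ξ i i = 1 := by simpa [hcop] using pow_gcd_eq_one.mpr ⟨h1, hξ1 i i⟩
      exact hνy i (by rw [hξ, h2, map_one, one_mul])
  choose g hg hgy using fun i => hN.exists_translation hyb (pow_mem (hν i) (m i)) (hmj i)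
    ((hprim i).ne_one (hp i).one_lt) (hmi i)
  have key (s : Finset ι) : ∃ μ ∈ N, (∀ j ∈ s, μ (y j) = h (y j)) ∧ ∀ j ∉ s, μ (y j) = y j := by
    induction s using Finset.induction_on with
    | empty => exact ⟨1, one_mem N, by simp, by simp⟩
    | insert i s his ih =>
      obtain ⟨μ, hμ, hμs, hμs'⟩ := ih
      obtain ⟨ζ, hζ1, hζ⟩ := hscale h hh i
      have : NeZero (p i) := ⟨(hp i).ne_zero⟩
      obtain ⟨e, -, he⟩ := (hprim i).eq_pow_of_pow_eq_one hζ1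
      have hfix (j) (hj : j ≠ i) : ((ν i ^ m i) ^ e) (y j) = y j := by
        simpa using (ν i ^ m i).pow_apply_eq_mul (ξ := 1) (by simpa using hmj i j hj) e
      refine ⟨μ * (ν i ^ m i) ^ e, mul_mem hμ (pow_mem (pow_mem (hν i) _) _), ?_, ?_⟩
      · intro j hj
        rw [AlgEquiv.mul_apply]
        rcases Finset.mem_insert.mp hj with rfl | hjs
        · rw [AlgEquiv.pow_apply_eq_mul _ (hmi j), he, map_mul, AlgEquiv.commutes, hμs' j his, hζ]
        · rw [hfix j fun hji => his (hji ▸ hjs), hμs j hjs]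
      · intro j hj
        rw [Finset.mem_insert, not_or] at hj
        rw [AlgEquiv.mul_apply, hfix j hj.1, hμs' j hj.2]
  obtain ⟨μ, hμ, hμy, -⟩ := key Finset.univ
  have h1 : μ⁻¹ * h ∈ N := hcl.mem_of_translations hyb (hN y hyb) g hg hgy fun i =>
    μ.symm_apply_eq.mpr (hμy i (Finset.mem_univ i)).symm
  simpa using mul_mem hμ h1

end NormalizedByStabilizers

section PointwiseTopology

open scoped Topology

variable {k F ι : Type*} [Field k] [Field F] [Algebra k F]

theorem isOpen_autTop_iff {V : Set (F ≃ₐ[k] F)} : IsOpen[autTop k F] V ↔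
    ∀ h ∈ V, ∃ S : Finset F, ∀ g : F ≃ₐ[k] F, (∀ a ∈ S, g a = h a) → g ∈ V := by
  let _ : TopologicalSpace F := ⊥
  have : DiscreteTopology F := ⟨rfl⟩
  constructor
  · intro hV h hh
    obtain ⟨W, hW, rfl⟩ := isOpen_induced_iff.mp hV
    obtain ⟨S, u, hu, hS⟩ := isOpen_pi_iff.mp hW _ hh
    exact ⟨S, fun g hg => hS fun a ha => by
      change g a ∈ u a
      rw [hg a ha]
      exact (hu a ha).2⟩
  · intro hV
    refine isOpen_induced_iff.mpr ⟨{f | ∃ h ∈ V, ∃ S : Finset F,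
      (∀ g : F ≃ₐ[k] F, (∀ a ∈ S, g a = h a) → g ∈ V) ∧ ∀ a ∈ S, f a = h a}, ?_, ?_⟩
    · refine isOpen_pi_iff.mpr ?_
      rintro f ⟨h, hh, S, hS, hf⟩
      exact ⟨S, fun a => {f a}, fun a _ => ⟨isOpen_discrete _, rfl⟩,
        fun f' hf' => ⟨h, hh, S, hS, fun a ha => (hf' a ha).trans (hf a ha)⟩⟩
    · ext g
      constructor
      · rintro ⟨h, hh, S, hS, hg⟩
        exact hS g hg
      · intro hg
        obtain ⟨S, hS⟩ := hV g hg
        exact ⟨g, hg, S, hS, fun _ _ => rfl⟩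

theorem isCompact_range_restrictScalarsHom (L : IntermediateField k F) [IsGalois L F] :
    @IsCompact _ (autTop k F)
      ((AlgEquiv.restrictScalarsHom k : (F ≃ₐ[L] F) →* (F ≃ₐ[k] F)).range : Set (F ≃ₐ[k] F)) := by
  let _ := autTop k F
  rw [MonoidHom.coe_range]
  refine isCompact_range (continuous_def.mpr fun V hV => ?_)
  refine isOpen_iff_forall_mem_open.mpr fun γ hγ => ?_
  obtain ⟨S, hS⟩ := isOpen_autTop_iff.mp hV _ hγ
  refine ⟨⋂ a ∈ S, {δ | γ⁻¹ * δ ∈ MulAction.stabilizer _ a},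
    fun δ hδ => hS _ fun a ha => ?_, ?_, ?_⟩
  · have h1 : γ⁻¹ (δ a) = a := (Set.mem_iInter₂.mp hδ a ha :)
    exact γ.symm_apply_eq.mp h1
  · refine isOpen_biInter_finset fun a _ => ?_
    exact (stabilizer_isOpen_of_isIntegral a).preimage (continuous_const_mul γ⁻¹)
  · refine Set.mem_iInter₂.mpr fun a _ => ?_
    rw [Set.mem_ofPred_eq, inv_mul_cancel]
    exact one_mem _

theorem IsTranscendenceBasis.mem_Gcirc [IsAlgClosed F] [CharZero k] {x : ι → F}
    (hx : IsTranscendenceBasis k x) {u : F ≃ₐ[k] F} (hu : ∀ i, u (x i) = x i) :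
    u ∈ Gcirc k F := by
  have := hx.isGalois
  obtain ⟨γ, hγ⟩ := u.exists_restrictScalars_eq (s := Set.range x)
    (by rintro _ ⟨i, rfl⟩; exact hu i)
  exact Subgroup.subset_closure ⟨_, isCompact_range_restrictScalarsHom _, γ, AlgEquiv.ext hγ⟩

theorem finite_orbit_of_isCompact {K : Subgroup (F ≃ₐ[k] F)}
    (hK : @IsCompact _ (autTop k F) (K : Set (F ≃ₐ[k] F))) (a : F) :
    ((fun g : F ≃ₐ[k] F => g a) '' K).Finite := by
  let _ := autTop k F
  let _ : TopologicalSpace F := ⊥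
  have : DiscreteTopology F := ⟨rfl⟩
  refine (hK.image ?_).finite_of_discrete
  exact (continuous_apply a).comp continuous_induced_dom

theorem isAlgebraic_fixedField_of_finite_orbit {K : Subgroup (F ≃ₐ[k] F)}
    (hK : ∀ a : F, ((fun g : F ≃ₐ[k] F => g a) '' K).Finite) :
    Algebra.IsAlgebraic (IntermediateField.fixedField K) F := by
  classical
  refine ⟨fun a => ?_⟩
  let P : Polynomial F := ∏ c ∈ (hK a).toFinset, (Polynomial.X - Polynomial.C c)
  have hPm : P.Monic := Polynomial.monic_prod_X_sub_C _ _
  have hPg (g : F ≃ₐ[k] F) (hg : g ∈ K) : P.map (g : F →+* F) = P := by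
    simp only [P, Polynomial.map_prod, Polynomial.map_sub, Polynomial.map_X, Polynomial.map_C]
    refine Finset.prod_bij' (fun c _ => g c) (fun c _ => g⁻¹ c) ?_ ?_ ?_ ?_ ?_
    · intro c hc
      obtain ⟨g', hg', rfl⟩ := (hK a).mem_toFinset.mp hc
      exact (hK a).mem_toFinset.mpr ⟨g * g', mul_mem hg hg', rfl⟩
    · intro c hc
      obtain ⟨g', hg', rfl⟩ := (hK a).mem_toFinset.mp hc
      exact (hK a).mem_toFinset.mpr ⟨g⁻¹ * g', mul_mem (inv_mem hg) hg', rfl⟩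
    · exact fun c _ => g.symm_apply_apply c
    · exact fun c _ => g.apply_symm_apply c
    · exact fun c _ => rfl
  have hlift : P ∈ Polynomial.lifts (algebraMap (IntermediateField.fixedField K) F) := by
    rw [Polynomial.lifts_iff_coeff_lifts]
    refine fun n =>
      ⟨⟨P.coeff n, (IntermediateField.mem_fixedField_iff _ _).mpr fun g hg => ?_⟩, rfl⟩
    conv_rhs => rw [← hPg g hg]
    rw [Polynomial.coeff_map]
    rfl
  obtain ⟨Q, hQ⟩ := (Polynomial.mem_lifts _).mp hlift
  refine ⟨Q, ?_, ?_⟩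
  · rintro rfl
    rw [Polynomial.map_zero] at hQ
    exact hPm.ne_zero hQ.symm
  · rw [Polynomial.aeval_def, ← Polynomial.eval_map, hQ, Polynomial.eval_prod]
    exact Finset.prod_eq_zero ((hK a).mem_toFinset.mpr ⟨1, one_mem K, rfl⟩) (by simp)

/-- A compact group of automorphisms fixes some transcendence basis. -/
theorem IsTranscendenceBasis.exists_fixed_of_isCompact {x : ι → F}
    (hx : IsTranscendenceBasis k x) {K : Subgroup (F ≃ₐ[k] F)}
    (hK : @IsCompact _ (autTop k F) (K : Set (F ≃ₐ[k] F))) :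
    ∃ z : ι → F, IsTranscendenceBasis k z ∧ ∀ g ∈ K, ∀ i, g (z i) = z i := by
  have halg := isAlgebraic_fixedField_of_finite_orbit (finite_orbit_of_isCompact hK)
  obtain ⟨z, hz, -, hzK⟩ := hx.exists_between
    (t := (IntermediateField.fixedField K : Set F)) (Set.empty_subset _)
    (algebraicIndependent_empty_type_iff.mpr (algebraMap k F).injective)
    (IntermediateField.isAlgebraic_adjoin_iff_top.mp <| by
      rwa [IntermediateField.adjoin_self])
  exact ⟨z, hz, fun g hg i => (IntermediateField.mem_fixedField_iff _ _).mp (hzK ⟨i, rfl⟩) g hg⟩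

theorem IsTranscendenceBasis.mem_Gcirc_of_eq [IsAlgClosed F] [CharZero k] {x : ι → F}
    (hx : IsTranscendenceBasis k x) {g h : F ≃ₐ[k] F} (hg : g ∈ Gcirc k F)
    (hgh : ∀ i, h (x i) = g (x i)) : h ∈ Gcirc k F := by
  have h1 := hx.mem_Gcirc (u := g⁻¹ * h) fun i => g.symm_apply_eq.mpr (hgh i)
  simpa using mul_mem hg h1

theorem isOpen_Gcirc [Finite ι] [IsAlgClosed F] [CharZero k] {x : ι → F}
    (hx : IsTranscendenceBasis k x) : IsOpen[autTop k F] (Gcirc k F : Set (F ≃ₐ[k] F)) :=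
  isOpen_autTop_iff.mpr fun _ hg => ⟨(Set.finite_range x).toFinset, fun _ hh =>
    hx.mem_Gcirc_of_eq hg fun i => hh (x i) (by simp)⟩

theorem isPointwiseClosed_map_subtype [Finite ι] [IsAlgClosed F] [CharZero k] {x : ι → F}
    (hx : IsTranscendenceBasis k x) {N : Subgroup (Gcirc k F)}
    (hN : @IsClosed _ (TopologicalSpace.induced Subtype.val (autTop k F))
      (N : Set (Gcirc k F))) : IsPointwiseClosed (N.map (Gcirc k F).subtype) := by
  intro h hh
  obtain ⟨_, ⟨ν, -, rfl⟩, hνx⟩ := hh (Set.finite_range x).toFinset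
  have hhG : h ∈ Gcirc k F := hx.mem_Gcirc_of_eq ν.2 fun i => (hνx (x i) (by simp)).symm
  refine ⟨⟨h, hhG⟩, ?_, rfl⟩
  by_contra hhN
  let _ := autTop k F
  obtain ⟨V, hV, hVN⟩ := isOpen_induced_iff.mp hN.isOpen_compl
  have hhV : h ∈ V := by
    have : (⟨h, hhG⟩ : Gcirc k F) ∈ Subtype.val ⁻¹' V := hVN ▸ hhN
    exact this
  obtain ⟨S, hS⟩ := isOpen_autTop_iff.mp hV h hhV
  obtain ⟨_, ⟨μ, hμN, rfl⟩, hμ⟩ := hh S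
  have : μ ∈ (N : Set (Gcirc k F))ᶜ := hVN ▸ hS _ hμ
  exact this hμN

end PointwiseTopology

/-- For `1 ≤ n < ∞`: the subgroup `G°` of `G` generated by the compact subgroups
is open, and is topologically simple: every closed normal proper subgroup of `G°`
(with its subspace topology) is trivial. -/
theorem statement1 (k F : Type*) [Field k] [Field F] [Algebra k F]
    [IsAlgClosed k] [IsAlgClosed F] [CharZero k] [CharZero F]
    (n : ℕ) (hn : 1 ≤ n) (hb : ∃ x : Fin n → F, IsTranscendenceBasis k x) :
    @IsOpen _ (autTop k F) ((Gcirc k F : Subgroup (F ≃ₐ[k] F)) : Set (F ≃ₐ[k] F)) ∧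
    ∀ N : Subgroup ↥(Gcirc k F), N.Normal →
      @IsClosed _ (TopologicalSpace.induced (Subtype.val) (autTop k F))
        (N : Set ↥(Gcirc k F)) →
      N ≠ ⊤ → N = ⊥ := by
  obtain ⟨x, hx⟩ := hb
  refine ⟨isOpen_Gcirc hx, fun N hNn hNc hN => by_contra fun hbot => hN ?_⟩
  have hcl := isPointwiseClosed_map_subtype hx hNc
  have hnorm : IsBasisNormalized (Fin n) (N.map (Gcirc k F).subtype) := by
    rintro z hz u hu _ ⟨σ, hσ, rfl⟩
    exact ⟨_, hNn.conj_mem σ hσ ⟨u, hz.mem_Gcirc hu⟩, by simp only [map_mul, map_inv]; rfl⟩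
  have hne : N.map (Gcirc k F).subtype ≠ ⊥ := fun h =>
    hbot ((Subgroup.map_eq_bot_iff_of_injective _ (Gcirc k F).subtype_injective).mp h)
  have hle : Gcirc k F ≤ N.map (Gcirc k F).subtype := by
    refine (Subgroup.closure_le _).mpr ?_
    rintro g ⟨K, hK, hg⟩
    obtain ⟨z, hz, hzK⟩ := hx.exists_fixed_of_isCompact hK
    exact hnorm.mem_of_forall_apply_eq hcl hne hz (hzK g hg)
  refine (Subgroup.eq_top_iff' N).mpr fun g => ?_
  obtain ⟨g', hg', h⟩ := hle g.2
  rwa [← Subtype.ext h]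
end

section
/- Suppose n = ∞. Then the subgroup G° of G generated by the union of all compact subgroups of G is dense in G. -/
open Algebra (adjoin adjoin_le)
open IntermediateField (fixedField)

section

variable {k F : Type*} [Field k] [Field F] [Algebra k F]

/-- Basic neighbourhoods in the topology of pointwise convergence. -/
theorem exists_finset_forall_eqOn_mem_of_isOpen_autTop {U : Set (F ≃ₐ[k] F)}
    (hU : @IsOpen _ (autTop k F) U) {g : F ≃ₐ[k] F} (hg : g ∈ U) :
    ∃ S : Finset F, ∀ h : F ≃ₐ[k] F, (∀ x ∈ S, h x = g x) → h ∈ U := by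
  let : TopologicalSpace F := ⊥
  obtain ⟨V, hV, rfl⟩ := isOpen_induced_iff.mp hU
  obtain ⟨S, u, hu, huV⟩ := isOpen_pi_iff.mp hV _ hg
  refine ⟨S, fun h hh ↦ huV fun x hx ↦ ?_⟩
  simpa only [hh x hx] using (hu x hx).2

/-- If `F` is algebraic over an intermediate field `K`, then `Gal(F/K)` is compact in the topology
of pointwise convergence. -/
theorem isCompact_fixingSubgroup_autTop [IsAlgClosed F] [CharZero F]
    (K : IntermediateField k F) [Algebra.IsAlgebraic K F] :
    @IsCompact _ (autTop k F) (K.fixingSubgroup : Set (F ≃ₐ[k] F)) := by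
  let : TopologicalSpace F := ⊥
  have : DiscreteTopology F := ⟨rfl⟩
  let := autTop k F
  have : CharZero K := (algebraMap K F).charZero
  have : IsAlgClosure K F := ⟨inferInstance, inferInstance⟩
  have : Normal K F := IsAlgClosure.normal K F
  have : IsGalois K F := ⟨⟩
  have hcont : Continuous fun g : F ≃ₐ[K] F ↦ g.restrictScalars k := by
    refine continuous_induced_rng.mpr (continuous_pi fun x ↦ ?_)
    refine continuous_discrete_rng.mpr fun y ↦ ?_
    refine isOpen_iff_mem_nhds.mpr fun g hg ↦ ?_
    have hopen : IsOpen ((g⁻¹ * ·) ⁻¹' (MulAction.stabilizer (F ≃ₐ[K] F) x : Set (F ≃ₐ[K] F))) :=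
      (stabilizer_isOpen_of_isIntegral (K := K) x).preimage (continuous_const_mul g⁻¹)
    refine Filter.mem_of_superset (hopen.mem_nhds (by simp)) fun h hh ↦ ?_
    have hgx : g x = y := hg
    have hhx : g.symm (h x) = x := hh
    change h x = y
    rw [← hgx, ← g.symm_apply_eq, hhx]
  convert isCompact_univ.image hcont
  ext g
  simp only [SetLike.mem_coe, IntermediateField.mem_fixingSubgroup_iff, Set.image_univ,
    Set.mem_range]
  constructor
  · intro hg
    exact ⟨AlgEquiv.ofRingEquiv (f := g.toRingEquiv) fun x ↦ hg x x.2, by ext; rfl⟩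
  · rintro ⟨h, rfl⟩ x hx
    exact h.commutes ⟨x, hx⟩

/-- An automorphism over whose fixed field `F` is algebraic lies in `G°`. -/
theorem mem_Gcirc_of_isAlgebraic_fixedField [IsAlgClosed F] [CharZero F] (τ : F ≃ₐ[k] F)
    [Algebra.IsAlgebraic (fixedField (Subgroup.zpowers τ)) F] : τ ∈ Gcirc k F :=
  Subgroup.subset_closure ⟨_, isCompact_fixingSubgroup_autTop (fixedField (Subgroup.zpowers τ)),
    (IntermediateField.le_iff_le _ _).mp le_rfl (Subgroup.mem_zpowers τ)⟩

theorem mem_fixedField_zpowers {τ : F ≃ₐ[k] F} {x : F} (hx : τ x = x) :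
    x ∈ fixedField (Subgroup.zpowers τ) := by
  rw [IntermediateField.mem_fixedField_iff]
  intro f hf
  have : Subgroup.zpowers τ ≤ MulAction.stabilizer (F ≃ₐ[k] F) x := by
    rwa [Subgroup.zpowers_le]
  exact this hf

/-- An automorphism of a subalgebra `R` of an algebraically closed field extends to an automorphism
of the field that fixes a transcendence basis over `R`. -/
theorem exists_algEquiv_extends_fixing_isTranscendenceBasis [IsAlgClosed F]
    (R : Subalgebra k F) (σ : R ≃ₐ[k] R) :
    ∃ (s : Set F) (τ : F ≃ₐ[k] F), IsTranscendenceBasis R ((↑) : s → F) ∧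
      (∀ r : R, τ r = σ r) ∧ ∀ x ∈ s, τ x = x := by
  obtain ⟨s, hs⟩ := exists_isTranscendenceBasis R F
  have := IsAlgClosed.isAlgClosure_of_transcendence_basis _ hs
  let e : adjoin R (Set.range ((↑) : s → F)) ≃+* adjoin R (Set.range ((↑) : s → F)) :=
    hs.1.aevalEquiv.symm.toRingEquiv.trans
      ((MvPolynomial.mapEquiv s σ.toRingEquiv).trans hs.1.aevalEquiv.toRingEquiv)
  have he : ∀ p : MvPolynomial s R, e (hs.1.aevalEquiv p) =
      hs.1.aevalEquiv (MvPolynomial.map (σ : R →+* R) p) := by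
    intro p
    simp only [e, RingEquiv.trans_apply]
    erw [AlgEquiv.symm_apply_apply]
    rfl
  let f := IsAlgClosure.equivOfEquiv F F e
  have hf : ∀ p : MvPolynomial s R, f (MvPolynomial.aeval ((↑) : s → F) p) =
      MvPolynomial.aeval ((↑) : s → F) (MvPolynomial.map (σ : R →+* R) p) := by
    intro p
    have := IsAlgClosure.equivOfEquiv_algebraMap F F e (hs.1.aevalEquiv p)
    rw [he] at this
    simpa only [AlgebraicIndependent.algebraMap_aevalEquiv] using this
  have hfR : ∀ r : R, f r = σ r := by
    intro r
    have := hf (MvPolynomial.C r)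
    rwa [MvPolynomial.map_C, MvPolynomial.aeval_C, MvPolynomial.aeval_C] at this
  refine ⟨s, AlgEquiv.ofRingEquiv (f := f) fun a ↦ ?_, hs, hfR, fun x hx ↦ ?_⟩
  · have := hfR (algebraMap k R a)
    rwa [σ.commutes] at this
  · have := hf (MvPolynomial.X ⟨x, hx⟩)
    rwa [MvPolynomial.map_X, MvPolynomial.aeval_X] at this

/-- An automorphism of a subalgebra `R` extends to an element of `G°` as soon as `R` is algebraic
over the fixed field of every extension. -/
theorem exists_mem_Gcirc_extends [IsAlgClosed F] [CharZero F]
    (R : Subalgebra k F) (σ : R ≃ₐ[k] R)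
    (hσ : ∀ τ : F ≃ₐ[k] F, (∀ r : R, τ r = σ r) →
      ∀ r : R, IsAlgebraic (fixedField (Subgroup.zpowers τ)) (r : F)) :
    ∃ τ ∈ Gcirc k F, ∀ r : R, τ r = σ r := by
  obtain ⟨s, τ, hs, hR, hfix⟩ := exists_algEquiv_extends_fixing_isTranscendenceBasis R σ
  refine ⟨τ, ?_, hR⟩
  let K := fixedField (Subgroup.zpowers τ)
  let C := _root_.algebraicClosure K F
  have hRC : ∀ r : R, (r : F) ∈ C := fun r ↦ mem_algebraicClosure_iff.mpr (hσ τ hR r)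
  have hsC : ∀ a ∈ adjoin R (Set.range ((↑) : s → F)), a ∈ C := by
    intro a ha
    induction ha using Algebra.adjoin_induction with
    | mem x hx =>
      obtain ⟨y, rfl⟩ := hx
      exact C.algebraMap_mem (⟨_, mem_fixedField_zpowers (hfix y y.2)⟩ : K)
    | algebraMap r => exact hRC r
    | add x y _ _ hx hy => exact add_mem hx hy
    | mul x y _ _ hx hy => exact mul_mem hx hy
  let : Algebra (adjoin R (Set.range ((↑) : s → F))) C :=
    ((algebraMap (adjoin R (Set.range ((↑) : s → F))) F).codRestrict C fun a ↦
      hsC a a.2).toAlgebra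
  have : IsScalarTower (adjoin R (Set.range ((↑) : s → F))) C F := .of_algebraMap_eq fun _ ↦ rfl
  have := hs.isAlgebraic
  have : Algebra.IsAlgebraic C F := Algebra.IsAlgebraic.extendScalars
    (R := adjoin R (Set.range ((↑) : s → F))) fun x y h ↦ Subtype.ext (congrArg (algebraMap C F) h)
  have : Algebra.IsAlgebraic K F := Algebra.IsAlgebraic.trans K C F
  exact mem_Gcirc_of_isAlgebraic_fixedField τ

/-- Two jointly independent families are exchanged by an element of `G°`. -/
theorem exists_mem_Gcirc_apply_eq [IsAlgClosed F] [CharZero F] {ι : Type*} {a b : ι → F}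
    (hab : AlgebraicIndependent k (Sum.elim a b)) :
    ∃ τ ∈ Gcirc k F, ∀ i, τ (a i) = b i := by
  let ρ := MvPolynomial.renameEquiv k (Equiv.sumComm ι ι)
  let σ := (hab.aevalEquiv.symm.trans ρ).trans hab.aevalEquiv
  have hρ : ∀ p, ρ (ρ p) = p := by
    intro p
    simp [ρ, MvPolynomial.rename_rename]
  have hσσ : ∀ r, σ (σ r) = r := by
    intro r
    simp [σ, hρ]
  obtain ⟨τ, hτ, hτσ⟩ := exists_mem_Gcirc_extends _ σ fun τ hτ r ↦ by
    have hmul : τ (r * σ r) = r * σ r := by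
      rw [map_mul, hτ, hτ, hσσ, mul_comm]
    have hadd : τ (r + σ r) = r + σ r := by
      rw [map_add, hτ, hτ, hσσ, add_comm]
    let K := fixedField (Subgroup.zpowers τ)
    let A : K := ⟨_, mem_fixedField_zpowers hadd⟩
    let B : K := ⟨_, mem_fixedField_zpowers hmul⟩
    refine ⟨Polynomial.X ^ 2 - Polynomial.C A * Polynomial.X + Polynomial.C B, ?_, ?_⟩
    · apply Polynomial.Monic.ne_zero
      monicity!
    · simp only [map_add, map_sub, map_mul, map_pow, Polynomial.aeval_X, Polynomial.aeval_C]
      change (r : F) ^ 2 - (r + σ r : F) * r + (r * σ r : F) = 0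
      ring
  refine ⟨τ, hτ, fun i ↦ ?_⟩
  have h1 : ∀ j, ((hab.aevalEquiv (MvPolynomial.X j) : _) : F) = Sum.elim a b j := by
    intro j
    simp
  have h2 : σ (hab.aevalEquiv (MvPolynomial.X (Sum.inl i))) =
      hab.aevalEquiv (MvPolynomial.X (Sum.inr i)) := by
    simp [σ, ρ]
  have := hτσ (hab.aevalEquiv (MvPolynomial.X (Sum.inl i)))
  rwa [h2, h1, h1] at this

/-- An automorphism fixing `A` agrees with an element of `G°` on everything algebraic over `A`. -/
theorem exists_mem_Gcirc_eqOn_isAlgebraic [IsAlgClosed F] [CharZero F] (A : Subalgebra k F)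
    (w : F ≃ₐ[k] F) (hw : ∀ x ∈ A, w x = x) :
    ∃ τ ∈ Gcirc k F, ∀ x : F, IsAlgebraic A x → τ x = w x := by
  let R : Subalgebra k F := (Subalgebra.algebraicClosure A F).restrictScalars k
  let w' : F ≃ₐ[A] F := AlgEquiv.ofRingEquiv (f := w.toRingEquiv) fun x ↦ hw x x.2
  have hR : ∀ x, IsAlgebraic A x ↔ x ∈ R := fun x ↦ Iff.rfl
  have h1 : ∀ r : R, w r ∈ R := fun r ↦ (hR _).mp (((hR _).mpr r.2).algHom (w' : F →ₐ[A] F))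
  have h2 : ∀ r : R, w.symm r ∈ R :=
    fun r ↦ (hR _).mp (((hR _).mpr r.2).algHom (w'.symm : F →ₐ[A] F))
  let σ : R ≃ₐ[k] R := AlgEquiv.ofAlgHom
    (((w : F →ₐ[k] F).comp R.val).codRestrict R h1)
    (((w.symm : F →ₐ[k] F).comp R.val).codRestrict R h2)
    (by ext r; exact w.apply_symm_apply r) (by ext r; exact w.symm_apply_apply r)
  have hσ : ∀ r : R, (σ r : F) = w r := fun _ ↦ rfl
  obtain ⟨τ, hτ, hτσ⟩ := exists_mem_Gcirc_extends R σ fun τ hτ r ↦ by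
    let K := fixedField (Subgroup.zpowers τ)
    have hAK : ∀ a : A, (a : F) ∈ K := fun a ↦ mem_fixedField_zpowers <| by
      have haR : (a : F) ∈ R := (hR _).mp (isAlgebraic_algebraMap a)
      rw [hτ ⟨a, haR⟩, hσ]
      exact hw a a.2
    let : Algebra A K := ((algebraMap A F).codRestrict K hAK).toAlgebra
    have : IsScalarTower A K F := .of_algebraMap_eq fun _ ↦ rfl
    have hinj : Function.Injective (algebraMap A K) :=
      fun x y h ↦ Subtype.ext (congrArg (algebraMap K F) h)
    exact IsAlgebraic.extendScalars hinj ((hR _).mpr r.2)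
  exact ⟨τ, hτ, fun x hx ↦ (hτσ ⟨x, hx⟩).trans (hσ _)⟩

/-- A finite set is algebraic over an initial segment of a transcendence basis. -/
theorem IsTranscendenceBasis.exists_isAlgebraic_adjoin_image_Iio {x : ℕ → F}
    (hx : IsTranscendenceBasis k x) {S : Set F} (hS : S.Finite) :
    ∃ N, ∀ s ∈ S, IsAlgebraic (adjoin k (x '' Set.Iio N)) s := by
  have hclosure : ∀ (T : Set F) (s : F),
      s ∈ (AlgebraicIndependent.matroid k F).closure T ↔ IsAlgebraic (adjoin k T) s := by
    intro T s
    rw [AlgebraicIndependent.matroid_closure_eq]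
    rfl
  have hsub : S ⊆ (AlgebraicIndependent.matroid k F).closure (Set.range x) :=
    fun s _ ↦ (hclosure _ s).mpr (hx.isAlgebraic.isAlgebraic s)
  obtain ⟨T, hTx, hT, -, hST⟩ :=
    Matroid.exists_subset_finite_closure_of_subset_closure hS hsub
  obtain ⟨N, hN⟩ := (hT.preimage hx.1.injective.injOn).bddAbove
  refine ⟨N + 1, fun s hs ↦ (hclosure _ s).mp ?_⟩
  refine Matroid.closure_subset_closure _ (fun y hy ↦ ?_) (hST hs)
  obtain ⟨i, rfl⟩ := hTx hy
  exact ⟨i, Nat.lt_succ_of_le (hN hy), rfl⟩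

/-- Any automorphism agrees with an element of `G°` on an initial segment of a countably infinite
transcendence basis. -/
theorem exists_mem_Gcirc_eqOn_initial [IsAlgClosed F] [CharZero F] {x : ℕ → F}
    (hx : IsTranscendenceBasis k x) (g : F ≃ₐ[k] F) (m : ℕ) :
    ∃ h ∈ Gcirc k F, ∀ i < m, h (x i) = g (x i) := by
  obtain ⟨N', hN'⟩ := hx.exists_isAlgebraic_adjoin_image_Iio
    (S := (fun i ↦ g (x i)) '' Set.Iio m) ((Set.finite_Iio m).image _)
  let N := N' + m
  let A := adjoin k (x '' Set.Iio N')
  let t : Fin m → F := fun i ↦ x i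
  let u : Fin m → F := fun i ↦ x (N + i)
  have htu : AlgebraicIndependent k (Sum.elim t u) := by
    have hinj : Function.Injective (Sum.elim (fun i : Fin m ↦ (i : ℕ)) fun i : Fin m ↦ N + i) := by
      rintro (i | i) (j | j) h <;> simp only [Sum.elim_inl, Sum.elim_inr] at h <;>
        simp only [Sum.inl.injEq, Sum.inr.injEq, Fin.ext_iff, reduceCtorEq] <;> omega
    convert hx.1.comp _ hinj using 1
    ext (i | i) <;> rfl
  have hs : AlgebraicIndependent k fun i ↦ g (t i) :=
    (hx.1.comp _ Fin.val_injective).map' (f := (g : F →ₐ[k] F)) g.injective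
  have huA : AlgebraicIndependent A u := by
    have hd : Disjoint (Set.Iio N') (Set.Ici N') := by
      simp [Set.disjoint_left]
    exact (hx.1.adjoin_of_disjoint hd).comp
      (fun i : Fin m ↦ ⟨N + i, by simp only [Set.mem_Ici, N]; omega⟩)
      fun i j h ↦ by simpa [Fin.ext_iff] using h
  have hus : AlgebraicIndependent k (Sum.elim u fun i ↦ g (t i)) := by
    refine hs.sumElim_of_tower (S := Subalgebra.algebraicClosure A F) ?_
      (huA.extendScalars _)
    rintro _ ⟨i, rfl⟩
    exact ⟨⟨_, hN' _ ⟨i, i.2, rfl⟩⟩, rfl⟩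
  obtain ⟨τ₁, h₁, ht⟩ := exists_mem_Gcirc_apply_eq htu
  obtain ⟨τ₂, h₂, hu⟩ := exists_mem_Gcirc_apply_eq hus
  refine ⟨τ₂ * τ₁, mul_mem h₂ h₁, fun i hi ↦ ?_⟩
  rw [AlgEquiv.mul_apply]
  exact (congrArg τ₂ (ht ⟨i, hi⟩)).trans (hu ⟨i, hi⟩)

end

/-- If `n = ∞` (countably infinite transcendence degree), the subgroup `G°` of `G`
generated by the union of all compact subgroups of `G` is dense in `G`. -/
theorem statement2 (k F : Type*) [Field k] [Field F] [Algebra k F]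
    [IsAlgClosed k] [IsAlgClosed F] [CharZero k] [CharZero F]
    (hn : ∃ x : ℕ → F, IsTranscendenceBasis k x) :
    @Dense _ (autTop k F) ((Gcirc k F : Subgroup (F ≃ₐ[k] F)) : Set (F ≃ₐ[k] F)) := by
  obtain ⟨x, hx⟩ := hn
  let := autTop k F
  intro g
  rw [mem_closure_iff]
  intro U hU hg
  obtain ⟨S, hS⟩ := exists_finset_forall_eqOn_mem_of_isOpen_autTop hU hg
  obtain ⟨m, hm⟩ := hx.exists_isAlgebraic_adjoin_image_Iio S.finite_toSet
  obtain ⟨h, hh, hhg⟩ := exists_mem_Gcirc_eqOn_initial hx g m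
  have hfix : adjoin k (x '' Set.Iio m) ≤
      AlgHom.equalizer ((h⁻¹ * g : F ≃ₐ[k] F) : F →ₐ[k] F) (AlgHom.id k F) := by
    refine adjoin_le ?_
    rintro _ ⟨i, hi, rfl⟩
    change h.symm (g (x i)) = x i
    rw [← hhg i hi, AlgEquiv.symm_apply_apply]
  obtain ⟨v, hv, hvw⟩ := exists_mem_Gcirc_eqOn_isAlgebraic _ (h⁻¹ * g) fun y hy ↦ hfix hy
  refine ⟨h * v, hS _ fun s hs ↦ ?_, mul_mem hh hv⟩
  rw [AlgEquiv.mul_apply, hvw s (hm s hs)]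
  exact h.apply_symm_apply (g s)
end

section
/- Suppose n = ∞. Then: (i) every G-stable ℚ-subspace W' of an admissible representation W of G is admissible, and the quotient representation W/W' is admissible; (ii) if W is a smooth representation of G and W' ⊆ W is a G-stable subspace such that both W' and W/W' are admissible, then W is admissible. (In other words, the admissible representations form a Serre subcategory of the category of smooth representations of G.) -/
universe u

section Reps

variable {k F : Type*} [Field k] [Field F] [Algebra k F]
variable {W : Type u} [AddCommGroup W] [Module ℚ W]

/-- The subspace of vectors fixed by a subgroup `U` of `G = Aut(F/k)`. -/
def fixedSubmodule (ρ : Representation ℚ (F ≃ₐ[k] F) W)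
    (U : Subgroup (F ≃ₐ[k] F)) : Submodule ℚ W where
  carrier := {w | ∀ g ∈ U, ρ g w = w}
  add_mem' := by
    intro a b ha hb g hg
    rw [map_add, ha g hg, hb g hg]
  zero_mem' := fun g _ => map_zero _
  smul_mem' := by
    intro c w hw g hg
    rw [map_smul, hw g hg]

/-- A representation of `G = Aut(F/k)` is smooth if the stabilizer of every
vector is open. -/
def IsSmoothRep (ρ : Representation ℚ (F ≃ₐ[k] F) W) : Prop :=
  ∀ w : W, @IsOpen _ (autTop k F) {g : F ≃ₐ[k] F | ρ g w = w}

/-- A representation of `G = Aut(F/k)` is admissible if it is smooth and the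
fixed subspace of every open subgroup is finite-dimensional over `ℚ`. -/
def IsAdmissibleRep (ρ : Representation ℚ (F ≃ₐ[k] F) W) : Prop :=
  IsSmoothRep ρ ∧ ∀ U : Subgroup (F ≃ₐ[k] F),
    @IsOpen _ (autTop k F) (U : Set (F ≃ₐ[k] F)) →
      FiniteDimensional ℚ ↥(fixedSubmodule ρ U)

/-- The subrepresentation on a `G`-stable subspace. -/
def subRep (ρ : Representation ℚ (F ≃ₐ[k] F) W) (W' : Submodule ℚ W)
    (h : ∀ g : F ≃ₐ[k] F, ∀ w ∈ W', ρ g w ∈ W') :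
    Representation ℚ (F ≃ₐ[k] F) ↥W' where
  toFun g := (ρ g).restrict (p := W') (q := W') (fun w hw => h g w hw)
  map_one' := by
    apply LinearMap.ext
    intro w
    apply Subtype.ext
    simp [LinearMap.restrict_apply]
  map_mul' g₁ g₂ := by
    apply LinearMap.ext
    intro w
    apply Subtype.ext
    simp [LinearMap.restrict_apply]

/-- The quotient representation on `W ⧸ W'` for a `G`-stable subspace `W'`. -/
def quotRep (ρ : Representation ℚ (F ≃ₐ[k] F) W) (W' : Submodule ℚ W)
    (h : ∀ g : F ≃ₐ[k] F, ∀ w ∈ W', ρ g w ∈ W') :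
    Representation ℚ (F ≃ₐ[k] F) (W ⧸ W') where
  toFun g := W'.mapQ W' (ρ g) (fun w hw => h g w hw)
  map_one' := by
    apply LinearMap.ext
    intro x
    obtain ⟨y, rfl⟩ := Submodule.Quotient.mk_surjective W' x
    simp [Submodule.mapQ_apply]
  map_mul' g₁ g₂ := by
    apply LinearMap.ext
    intro x
    obtain ⟨y, rfl⟩ := Submodule.Quotient.mk_surjective W' x
    simp [Submodule.mapQ_apply]

end Reps

open Polynomial in
/-- An endomorphism of prime order `p` of a rational vector space of dimension less than `p - 1`
is trivial. -/
theorem LinearMap.eq_one_of_pow_prime_eq_one {V : Type*} [AddCommGroup V] [Module ℚ V]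
    [FiniteDimensional ℚ V] {p : ℕ} (hp : p.Prime) (hdim : Module.finrank ℚ V < p - 1)
    (f : V →ₗ[ℚ] V) (hf : f ^ p = 1) : f = 1 := by
  have : Fact p.Prime := ⟨hp⟩
  have hcop : IsCoprime (cyclotomic p ℚ) (minpoly ℚ f) := by
    refine (cyclotomic.irreducible_rat hp.pos).coprime_iff_not_dvd.2 fun hdvd => ?_
    have h1 := natDegree_le_of_dvd (hdvd.trans (LinearMap.minpoly_dvd_charpoly f))
      f.charpoly_monic.ne_zero
    rw [LinearMap.charpoly_natDegree, natDegree_cyclotomic, Nat.totient_prime hp] at h1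
    omega
  have hdvd : minpoly ℚ f ∣ cyclotomic p ℚ * (X - 1) := by
    rw [cyclotomic_prime_mul_X_sub_one]
    exact minpoly.dvd ℚ f (by simp [hf])
  obtain ⟨q, hq⟩ := hcop.symm.dvd_of_dvd_mul_left hdvd
  have h := congrArg (aeval f) hq
  simpa [sub_eq_zero] using h

section Extension

variable {k F : Type*} [Field k] [Field F] [Algebra k F]

/-- An automorphism of the polynomial ring on a transcendence basis of an algebraically closed
field extends to the field. -/
theorem IsTranscendenceBasis.exists_algEquiv_extend {A F ι : Type*} [CommRing A] [IsDomain A]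
    [Field F] [Algebra A F] [IsAlgClosed F] {v : ι → F} (hv : IsTranscendenceBasis A v)
    (φ : MvPolynomial ι A ≃ₐ[A] MvPolynomial ι A) :
    ∃ s : F ≃ₐ[A] F, ∀ q, s (MvPolynomial.aeval v q) = MvPolynomial.aeval v (φ q) := by
  have := IsAlgClosed.isAlgClosure_of_transcendence_basis v hv
  let e : Algebra.adjoin A (Set.range v) ≃ₐ[A] Algebra.adjoin A (Set.range v) :=
    (hv.1.aevalEquiv.symm.trans φ).trans hv.1.aevalEquiv
  have key (a) : IsAlgClosure.equivOfEquiv F F e.toRingEquiv (algebraMap _ F a) =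
      algebraMap _ F (e a) := IsAlgClosure.equivOfEquiv_algebraMap F F e.toRingEquiv a
  refine ⟨AlgEquiv.ofRingEquiv (f := IsAlgClosure.equivOfEquiv F F e.toRingEquiv) fun a => ?_,
    fun q => ?_⟩
  · have := key (algebraMap A _ a)
    rwa [e.commutes, ← IsScalarTower.algebraMap_apply] at this
  · have := key (hv.1.aevalEquiv q)
    simpa [e] using this

/-- An automorphism fixing a set pointwise fixes the subalgebra it generates. -/
theorem apply_eq_of_mem_adjoin {S : Set F} {g : F ≃ₐ[k] F} (hg : ∀ x ∈ S, g x = x)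
    {a : F} (ha : a ∈ Algebra.adjoin k S) : g a = a := by
  have h : Algebra.adjoin k S ≤ AlgHom.equalizer (g : F →ₐ[k] F) (AlgHom.id k F) :=
    Algebra.adjoin_le hg
  exact h ha

/-- If `F` has an infinite transcendence basis then every finite set admits an element
transcendental over it. -/
theorem exists_transcendental_adjoin {ι : Type*} [Infinite ι] {v : ι → F}
    (hv : IsTranscendenceBasis k v) (S : Finset F) :
    ∃ z : F, Transcendental (Algebra.adjoin k (S : Set F)) z := by
  by_contra! h
  have : Algebra.IsAlgebraic (Algebra.adjoin k (S : Set F)) F :=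
    ⟨fun x => by simpa [Transcendental] using h x⟩
  obtain ⟨t, hts, ht⟩ := exists_isTranscendenceBasis_subset (R := k) (S : Set F)
  have hfin : Finite t := S.finite_toSet.subset hts
  have h1 := hv.lift_cardinalMk_eq ht
  have h2 := Cardinal.lt_aleph0_of_finite t
  rw [← Cardinal.lift_lt_aleph0, ← h1, Cardinal.lift_lt_aleph0] at h2
  exact (Cardinal.aleph0_le_mk ι).not_gt h2

/-- Two elements successively transcendental over `S` are algebraically independent over `S`. -/
theorem algebraicIndepOn_pair {S : Set F} {x y : F} (hx : Transcendental (Algebra.adjoin k S) x)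
    (hy : Transcendental (Algebra.adjoin k (insert x S)) y) :
    AlgebraicIndepOn (Algebra.adjoin k S) id ({y, x} : Set F) := by
  have h1 : AlgebraicIndepOn (Algebra.adjoin k S) id ({x} : Set F) :=
    (algebraicIndependent_singleton_iff (⟨x, rfl⟩ : ({x} : Set F))).2 hx
  have hle : ∀ a ∈ Algebra.adjoin (Algebra.adjoin k S) ({x} : Set F),
      a ∈ Algebra.adjoin k (insert x S) := by
    intro a ha
    induction ha using Algebra.adjoin_induction with
    | mem a ha => exact Algebra.subset_adjoin (by simp_all)
    | algebraMap r => exact Algebra.adjoin_mono (Set.subset_insert x S) r.2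
    | add a b _ _ ha hb => exact add_mem ha hb
    | mul a b _ _ ha hb => exact mul_mem ha hb
  let f : Algebra.adjoin (Algebra.adjoin k S) ({x} : Set F) →+* Algebra.adjoin k (insert x S) :=
    (algebraMap _ F).codRestrict _ fun a => hle a a.2
  refine h1.insert ?_
  rw [Set.image_id]
  refine Transcendental.of_ringHom_of_comp_eq f (RingHom.id F) hy (fun a b hab => ?_) rfl
  exact Subtype.ext (congrArg (fun r : Algebra.adjoin k (insert x S) => (r : F)) hab)

/-- If `x, y` are algebraically independent over `S` and `ζ ≠ 1` is a `p`-th root of unity in `k`,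
there is an automorphism over `S` mapping `x` to `y` and having order `p` on `k(S, x, y)`. -/
theorem exists_algEquiv_pair [IsAlgClosed F] {S : Set F} {x y : F}
    (hx : Transcendental (Algebra.adjoin k S) x)
    (hy : Transcendental (Algebra.adjoin k (insert x S)) y) {p : ℕ} {ζ : k} (hζ : ζ ≠ 1)
    (hζp : ζ ^ p = 1) (hp : p ≠ 0) :
    ∃ s : F ≃ₐ[k] F, (∀ a ∈ S, s a = a) ∧ s x = y ∧ s y = (1 + ζ) • y - ζ • x ∧
      (s ^ p) x = x ∧ (s ^ p) y = y := by
  classical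
  obtain ⟨t, htsub, ht⟩ := exists_isTranscendenceBasis_superset (algebraicIndepOn_pair hx hy)
  have hxy : x ≠ y := by
    rintro rfl
    exact hy (isAlgebraic_algebraMap
      (⟨x, Algebra.subset_adjoin (Set.mem_insert x S)⟩ : Algebra.adjoin k (insert x S)))
  have hζ0 : ζ ≠ 0 := by
    rintro rfl
    simp [hp] at hζp
  let i : t := ⟨x, htsub (by simp)⟩
  let j : t := ⟨y, htsub (by simp)⟩
  have hij : i ≠ j := fun h => hxy (congrArg Subtype.val h)
  let c (a : k) : MvPolynomial t (Algebra.adjoin k S) :=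
    MvPolynomial.C (algebraMap k (Algebra.adjoin k S) a)
  let f : MvPolynomial t (Algebra.adjoin k S) →ₐ[Algebra.adjoin k S]
      MvPolynomial t (Algebra.adjoin k S) := MvPolynomial.aeval fun l =>
    if l = i then .X j else if l = j then c (1 + ζ) * .X j - c ζ * .X i else .X l
  let g : MvPolynomial t (Algebra.adjoin k S) →ₐ[Algebra.adjoin k S]
      MvPolynomial t (Algebra.adjoin k S) := MvPolynomial.aeval fun l =>
    if l = i then c ζ⁻¹ * (c (1 + ζ) * .X i - .X j) else if l = j then .X i else .X l
  have hc : c ζ * c ζ⁻¹ = 1 := by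
    simp only [c, ← map_mul, mul_inv_cancel₀ hζ0, map_one]
  have hfc (a) : f (c a) = c a := MvPolynomial.algHom_C ..
  have hgc (a) : g (c a) = c a := MvPolynomial.algHom_C ..
  have hfi : f (.X i) = .X j := by simp [f]
  have hfj : f (.X j) = c (1 + ζ) * .X j - c ζ * .X i := by simp [f, hij.symm]
  have hgi : g (.X i) = c ζ⁻¹ * (c (1 + ζ) * .X i - .X j) := by simp [g]
  have hgj : g (.X j) = .X i := by simp [g, hij.symm]
  have hfg : f.comp g = AlgHom.id _ _ := by
    ext1 l
    by_cases hli : l = i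
    · subst hli
      simp only [AlgHom.comp_apply, hgi, map_mul, map_sub, hfc, hfi, hfj, AlgHom.id_apply]
      linear_combination (MvPolynomial.X i) * hc
    · by_cases hlj : l = j
      · subst hlj
        simp [hgj, hfi]
      · simp [f, g, hli, hlj]
  have hgf : g.comp f = AlgHom.id _ _ := by
    ext1 l
    by_cases hli : l = i
    · subst hli
      simp [hgj, hfi]
    · by_cases hlj : l = j
      · subst hlj
        simp only [AlgHom.comp_apply, hfj, map_mul, map_sub, hgc, hgi, hgj, AlgHom.id_apply]
        linear_combination (MvPolynomial.X j - c (1 + ζ) * MvPolynomial.X i) * hc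
      · simp [f, g, hli, hlj]
  obtain ⟨s, hs⟩ := ht.exists_algEquiv_extend (AlgEquiv.ofAlgHom f g hfg hgf)
  have hsx : s x = y := by simpa [hfi, i, j] using hs (.X i)
  have hsy : s y = (1 + ζ) • y - ζ • x := by
    have := hs (.X j)
    simpa [hfj, i, j, c, Algebra.smul_def, add_mul] using this
  have hs1 : (s.restrictScalars k) (y - ζ • x) = y - ζ • x := by
    simp only [map_sub, map_smul, AlgEquiv.restrictScalars_apply, hsx, hsy, add_smul, one_smul]
    abel
  have hs2 : (s.restrictScalars k) (y - x) = ζ • (y - x) := by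
    simp only [map_sub, AlgEquiv.restrictScalars_apply, hsx, hsy, add_smul, one_smul, smul_sub]
    abel
  have hs1n (n : ℕ) : (s.restrictScalars k ^ n) (y - ζ • x) = y - ζ • x := by
    induction n with
    | zero => simp
    | succ n ih => rw [pow_succ, AlgEquiv.mul_apply, hs1, ih]
  have hs2n (n : ℕ) : (s.restrictScalars k ^ n) (y - x) = ζ ^ n • (y - x) := by
    induction n with
    | zero => simp
    | succ n ih => rw [pow_succ, AlgEquiv.mul_apply, hs2, map_smul, ih, smul_smul, pow_succ']
  have h1 := hs1n p
  have h2 := hs2n p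
  rw [hζp, one_smul] at h2
  have hxfix : (s.restrictScalars k ^ p) x = x := by
    have hd : (1 - ζ) • x = (y - ζ • x) - (y - x) := by
      rw [sub_smul, one_smul]
      abel
    have hd' := congrArg (s.restrictScalars k ^ p) hd
    rw [map_sub, h1, h2, ← hd, map_smul] at hd'
    exact smul_right_injective F (sub_ne_zero.2 hζ.symm) hd'
  refine ⟨s.restrictScalars k, fun a ha => ?_, hsx, hsy, hxfix, ?_⟩
  · exact s.commutes ⟨a, Algebra.subset_adjoin ha⟩
  · have := h2
    rw [map_sub, hxfix] at this
    exact sub_left_injective this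

end Extension

section Topology

variable {k F : Type*} [Field k] [Field F] [Algebra k F]

/-- A subgroup is open iff it contains the pointwise stabilizer of a finite set. -/
theorem isOpen_autTop_iff_s6 (U : Subgroup (F ≃ₐ[k] F)) :
    @IsOpen _ (autTop k F) (U : Set (F ≃ₐ[k] F)) ↔
      ∃ S : Finset F, fixingSubgroup (F ≃ₐ[k] F) (S : Set F) ≤ U := by
  let _ : TopologicalSpace F := ⊥
  have : DiscreteTopology F := ⟨rfl⟩
  let _ : TopologicalSpace (F ≃ₐ[k] F) := autTop k F
  have hcont : Continuous fun (g : F ≃ₐ[k] F) (x : F) => g x := continuous_induced_dom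
  constructor
  · intro hU
    obtain ⟨V, hV, hVU⟩ := isOpen_induced_iff.1 hU
    have h1 : (fun x : F => (1 : F ≃ₐ[k] F) x) ∈ V := by
      rw [← Set.mem_preimage (f := fun (g : F ≃ₐ[k] F) (x : F) => g x), hVU]
      exact U.one_mem
    obtain ⟨S, u, hu, hSu⟩ := isOpen_pi_iff.1 hV _ h1
    refine ⟨S, fun g hg => ?_⟩
    change g ∈ (U : Set (F ≃ₐ[k] F))
    rw [← hVU]
    refine hSu fun x hx => ?_
    have hgx : g x = x := (mem_fixingSubgroup_iff _).1 hg x hx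
    simpa [hgx] using (hu x hx).2
  · rintro ⟨S, hS⟩
    rw [isOpen_iff_forall_mem_open]
    intro g hg
    refine ⟨{h | ∀ x ∈ S, h x = g x}, fun h hh => ?_, ?_, fun x _ => rfl⟩
    · have : g⁻¹ * h ∈ U := hS <| (mem_fixingSubgroup_iff _).2 fun x hx => by
        have hhx : h x = g x := hh x hx
        simp [AlgEquiv.smul_def, AlgEquiv.mul_apply, hhx, AlgEquiv.aut_inv]
      simpa using U.mul_mem hg this
    · have : {h : F ≃ₐ[k] F | ∀ x ∈ S, h x = g x} = ⋂ x ∈ S, {h | h x = g x} := by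
        ext
        simp
      rw [this]
      refine isOpen_biInter_finset fun x _ => ?_
      exact (isOpen_discrete {g x}).preimage ((continuous_apply x).comp hcont)

end Topology

section Admissible

variable {k F : Type*} [Field k] [Field F] [Algebra k F]
variable {W : Type u} [AddCommGroup W] [Module ℚ W]

/-- The stabilizer of a vector. -/
def vectorStabilizer (ρ : Representation ℚ (F ≃ₐ[k] F) W) (w : W) :
    Subgroup (F ≃ₐ[k] F) where
  carrier := {g | ρ g w = w}
  mul_mem' := by
    intro a b (ha : ρ a w = w) (hb : ρ b w = w)
    change ρ (a * b) w = w
    rw [map_mul, Module.End.mul_apply, hb, ha]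
  one_mem' := by simp
  inv_mem' := by
    intro a (ha : ρ a w = w)
    change ρ a⁻¹ w = w
    conv_lhs => rw [← ha]
    simp

/-- A representation is smooth iff each vector is fixed by the pointwise stabilizer of some
finite set. -/
theorem isSmoothRep_iff (ρ : Representation ℚ (F ≃ₐ[k] F) W) :
    IsSmoothRep ρ ↔ ∀ w, ∃ S : Finset F,
      w ∈ fixedSubmodule ρ (fixingSubgroup (F ≃ₐ[k] F) (S : Set F)) :=
  forall_congr' fun w => isOpen_autTop_iff_s6 (vectorStabilizer ρ w)

theorem fixedSubmodule_anti (ρ : Representation ℚ (F ≃ₐ[k] F) W) {U V : Subgroup (F ≃ₐ[k] F)}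
    (h : U ≤ V) : fixedSubmodule ρ V ≤ fixedSubmodule ρ U :=
  fun _ hw g hg => hw g (h hg)

/-- Invariants of the stabilizer of `S ∪ {x, y}`, for `x, y` algebraically independent over `S`,
are all fixed by some automorphism over `S` mapping `x` to `y`. -/
theorem IsAdmissibleRep.exists_algEquiv_map_eq [IsAlgClosed k] [CharZero k] [IsAlgClosed F]
    {ρ : Representation ℚ (F ≃ₐ[k] F) W} (hρ : IsAdmissibleRep ρ) {S : Set F} (hS : S.Finite)
    {x y : F} (hx : Transcendental (Algebra.adjoin k S) x)
    (hy : Transcendental (Algebra.adjoin k (insert x S)) y) :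
    ∃ s ∈ fixingSubgroup (F ≃ₐ[k] F) S, s x = y ∧
      ∀ w ∈ fixedSubmodule ρ (fixingSubgroup (F ≃ₐ[k] F) (insert x S)), ρ s w = w := by
  classical
  set T : Set F := insert y (insert x S) with hT
  set V := fixedSubmodule ρ (fixingSubgroup (F ≃ₐ[k] F) T) with hVdef
  have hTfin : T.Finite := (hS.insert x).insert y
  have : FiniteDimensional ℚ V := hρ.2 _ <| (isOpen_autTop_iff_s6 _).2
    ⟨hTfin.toFinset, by rw [hTfin.coe_toFinset]⟩
  obtain ⟨p, hle, hp⟩ := Nat.exists_infinite_primes (Module.finrank ℚ V + 2)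
  have : NeZero (p : k) := ⟨Nat.cast_ne_zero.2 hp.ne_zero⟩
  obtain ⟨ζ, hζ⟩ := HasEnoughRootsOfUnity.exists_primitiveRoot k p
  obtain ⟨s, hsS, hsx, hsy, hpx, hpy⟩ := exists_algEquiv_pair hx hy
    (hζ.ne_one hp.one_lt) hζ.pow_eq_one hp.ne_zero
  have hpowS (n : ℕ) : ∀ a ∈ S, (s ^ n) a = a := by
    intro a ha
    induction n with
    | zero => simp
    | succ n ih => rw [pow_succ, AlgEquiv.mul_apply, hsS a ha, ih]
  have hstab : ∀ w ∈ V, ρ s w ∈ V := by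
    intro w hw g hg
    have hg' (a) (ha : a ∈ T) : g a = a := (mem_fixingSubgroup_iff _).1 hg a ha
    have hmem : s⁻¹ * g * s ∈ fixingSubgroup (F ≃ₐ[k] F) T := by
      refine (mem_fixingSubgroup_iff _).2 fun a ha => ?_
      suffices h : g (s a) = s a by
        simp [AlgEquiv.smul_def, AlgEquiv.mul_apply, h, AlgEquiv.aut_inv]
      rcases ha with rfl | rfl | ha
      · rw [hsy, map_sub, map_smul, map_smul, hg' a (by simp [hT]), hg' x (by simp [hT])]
      · rw [hsx, hg' y (by simp [hT])]
      · rw [hsS a ha, hg' a (by simp [hT, ha])]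
    have := congrArg (ρ s) (hw _ hmem)
    rwa [← Module.End.mul_apply, ← map_mul, mul_assoc, mul_inv_cancel_left, map_mul,
      Module.End.mul_apply] at this
  have hsp : s ^ p ∈ fixingSubgroup (F ≃ₐ[k] F) T := by
    refine (mem_fixingSubgroup_iff _).2 fun a ha => ?_
    rcases ha with rfl | rfl | ha
    · exact hpy
    · exact hpx
    · exact hpowS p a ha
  have hone : (ρ s).restrict hstab = 1 := by
    refine LinearMap.eq_one_of_pow_prime_eq_one hp (by omega) _ ?_
    ext w
    rw [Module.End.pow_restrict, LinearMap.coe_restrict_apply, ← map_pow]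
    exact w.2 _ hsp
  refine ⟨s, (mem_fixingSubgroup_iff _).2 hsS, hsx, fun w hw => ?_⟩
  have hwV : w ∈ V :=
    fixedSubmodule_anti ρ (fixingSubgroup_antitone _ F (Set.subset_insert y _)) hw
  exact congrArg Subtype.val (LinearMap.congr_fun hone ⟨w, hwV⟩)

/-- Admissible representations are homotopy invariant: adjoining a transcendental element creates
no new invariants. -/
theorem IsAdmissibleRep.fixedSubmodule_insert_le [IsAlgClosed k] [CharZero k] [IsAlgClosed F]
    (hn : ∃ x : ℕ → F, IsTranscendenceBasis k x)
    {ρ : Representation ℚ (F ≃ₐ[k] F) W} (hρ : IsAdmissibleRep ρ) {S : Set F} (hS : S.Finite)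
    {x : F} (hx : Transcendental (Algebra.adjoin k S) x) :
    fixedSubmodule ρ (fixingSubgroup (F ≃ₐ[k] F) (insert x S)) ≤
      fixedSubmodule ρ (fixingSubgroup (F ≃ₐ[k] F) S) := by
  classical
  intro w hw σ hσ
  have hσS (a) (ha : a ∈ S) : σ a = a := (mem_fixingSubgroup_iff _).1 hσ a ha
  obtain ⟨v, hv⟩ := hn
  obtain ⟨y, hy⟩ := exists_transcendental_adjoin hv (insert x (insert (σ x) hS.toFinset))
  have hmono {R : Set F} (hR : R ⊆ insert x (insert (σ x) S)) :
      Transcendental (Algebra.adjoin k R) y := by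
    refine Transcendental.of_tower_top_of_subalgebra_le (Algebra.adjoin_mono ?_) hy
    simpa using hR
  have hσx : Transcendental (Algebra.adjoin k S) (σ x) := by
    refine hx.ringHom_of_comp_eq (RingHom.id _) (σ : F →+* F) Function.surjective_id σ.injective ?_
    ext a
    exact (apply_eq_of_mem_adjoin hσS a.2).symm
  obtain ⟨s, hs, hsx, hsw⟩ := hρ.exists_algEquiv_map_eq hS hx
    (hmono (Set.insert_subset_insert (Set.subset_insert _ _)))
  obtain ⟨t, ht, htx, htw⟩ := hρ.exists_algEquiv_map_eq hS hσx (hmono (Set.subset_insert _ _))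
  have hσw : ρ σ w ∈ fixedSubmodule ρ (fixingSubgroup (F ≃ₐ[k] F) (insert (σ x) S)) := by
    intro g hg
    have hg' (a) (ha : a ∈ insert (σ x) S) : g a = a := (mem_fixingSubgroup_iff _).1 hg a ha
    have hmem : σ⁻¹ * g * σ ∈ fixingSubgroup (F ≃ₐ[k] F) (insert x S) := by
      refine (mem_fixingSubgroup_iff _).2 fun a ha => ?_
      suffices h : g (σ a) = σ a by
        simp [AlgEquiv.smul_def, AlgEquiv.mul_apply, h, AlgEquiv.aut_inv]
      rcases ha with rfl | ha
      · exact hg' _ (by simp)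
      · rw [hσS a ha, hg' a (by simp [ha])]
    have := congrArg (ρ σ) (hw _ hmem)
    rwa [← Module.End.mul_apply, ← map_mul, mul_assoc, mul_inv_cancel_left, map_mul,
      Module.End.mul_apply] at this
  have hmem : s⁻¹ * (t * σ) ∈ fixingSubgroup (F ≃ₐ[k] F) (insert x S) := by
    refine (mem_fixingSubgroup_iff _).2 fun a ha => ?_
    suffices h : t (σ a) = s a by
      simp [AlgEquiv.smul_def, AlgEquiv.mul_apply, h, AlgEquiv.aut_inv]
    rcases ha with rfl | ha
    · rw [htx, hsx]
    · rw [hσS a ha, show t a = a from (mem_fixingSubgroup_iff _).1 ht a ha,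
        show s a = a from (mem_fixingSubgroup_iff _).1 hs a ha]
  have h := congrArg (ρ s) (hw _ hmem)
  rw [← Module.End.mul_apply, ← map_mul, mul_inv_cancel_left, map_mul, Module.End.mul_apply,
    htw _ hσw, hsw w hw] at h
  exact h

/-- If `x` is algebraic over `S`, averaging replaces an invariant of the stabilizer of `S ∪ {x}` by
an invariant of the stabilizer of `S`, without changing its class modulo a subspace in which its
orbit is constant. -/
theorem exists_fixed_sub_mem_of_isAlgebraic (ρ : Representation ℚ (F ≃ₐ[k] F) W) {S : Set F}
    {x : F} (hx : IsAlgebraic (Algebra.adjoin k S) x) (W' : Submodule ℚ W) {w : W}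
    (hw : w ∈ fixedSubmodule ρ (fixingSubgroup (F ≃ₐ[k] F) (insert x S)))
    (hconst : ∀ g ∈ fixingSubgroup (F ≃ₐ[k] F) S, ρ g w - w ∈ W') :
    ∃ w₁ ∈ fixedSubmodule ρ (fixingSubgroup (F ≃ₐ[k] F) S), w₁ - w ∈ W' := by
  classical
  set U := fixingSubgroup (F ≃ₐ[k] F) S with hU
  have hUS {g} (hg : g ∈ U) (a) (ha : a ∈ S) : g a = a := (mem_fixingSubgroup_iff _).1 hg a ha
  obtain ⟨q, hq0, hq⟩ := hx
  let O : Set W := (fun g => ρ g w) '' (U : Set (F ≃ₐ[k] F))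
  have hroots : ((fun g : F ≃ₐ[k] F => g x) '' (U : Set (F ≃ₐ[k] F))).Finite := by
    refine (q.rootSet_finite F).subset ?_
    rintro _ ⟨g, hg, rfl⟩
    refine (Polynomial.mem_rootSet_of_ne hq0).2 ?_
    have hcomp : (algebraMap (Algebra.adjoin k S) F).comp (RingHom.id _) =
        (g : F →+* F).comp (algebraMap (Algebra.adjoin k S) F) := by
      ext a
      exact (apply_eq_of_mem_adjoin (hUS hg) a.2).symm
    have := Polynomial.map_aeval_eq_aeval_map hcomp q x
    rw [hq, map_zero, Polynomial.map_id] at this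
    exact this.symm
  have hO : O.Finite := by
    refine (hroots.image fun z => if h : ∃ g ∈ U, g x = z then ρ h.choose w else 0).subset ?_
    rintro _ ⟨g, hg, rfl⟩
    refine ⟨g x, ⟨g, hg, rfl⟩, ?_⟩
    have h : ∃ g' ∈ U, g' x = g x := ⟨g, hg, rfl⟩
    have hmem : g⁻¹ * h.choose ∈ fixingSubgroup (F ≃ₐ[k] F) (insert x S) := by
      refine (mem_fixingSubgroup_iff _).2 fun a ha => ?_
      suffices h' : h.choose a = g a by
        simp [AlgEquiv.smul_def, AlgEquiv.mul_apply, h', AlgEquiv.aut_inv]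
      rcases ha with rfl | ha
      · exact h.choose_spec.2
      · rw [hUS h.choose_spec.1 a ha, hUS hg a ha]
    have := congrArg (ρ g) (hw _ hmem)
    rw [← Module.End.mul_apply, ← map_mul, mul_inv_cancel_left] at this
    simpa [h] using this
  have hne : (hO.toFinset.card : ℚ) ≠ 0 := by
    have hwO : w ∈ hO.toFinset := hO.mem_toFinset.2 ⟨1, U.one_mem, by simp⟩
    exact Nat.cast_ne_zero.2 (Finset.card_ne_zero_of_mem hwO)
  refine ⟨(hO.toFinset.card : ℚ)⁻¹ • ∑ o ∈ hO.toFinset, o, fun g hg => ?_, ?_⟩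
  · rw [map_smul, map_sum]
    congr 1
    refine Finset.sum_bij (fun o _ => ρ g o) ?_ ?_ ?_ fun _ _ => rfl
    · intro o ho
      obtain ⟨g', hg', rfl⟩ := hO.mem_toFinset.1 ho
      exact hO.mem_toFinset.2 ⟨g * g', U.mul_mem hg hg', by simp⟩
    · intro a _ b _ hab
      have := congrArg (ρ g⁻¹) hab
      simpa using this
    · intro o ho
      obtain ⟨g', hg', rfl⟩ := hO.mem_toFinset.1 ho
      refine ⟨ρ (g⁻¹ * g') w, hO.mem_toFinset.2 ⟨_, U.mul_mem (U.inv_mem hg) hg', rfl⟩, ?_⟩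
      simp
  · have : (hO.toFinset.card : ℚ)⁻¹ • ∑ o ∈ hO.toFinset, o - w =
        (hO.toFinset.card : ℚ)⁻¹ • ∑ o ∈ hO.toFinset, (o - w) := by
      rw [Finset.sum_sub_distrib, Finset.sum_const, smul_sub, ← Nat.cast_smul_eq_nsmul ℚ,
        inv_smul_smul₀ hne]
    rw [this]
    refine W'.smul_mem _ (W'.sum_mem fun o ho => ?_)
    obtain ⟨g, hg, rfl⟩ := hO.mem_toFinset.1 ho
    exact hconst g hg

/-- Invariants of pointwise stabilizers of finite sets lift along quotients of admissible
representations. -/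
theorem IsAdmissibleRep.exists_fixed_sub_mem [IsAlgClosed k] [CharZero k] [IsAlgClosed F]
    (hn : ∃ x : ℕ → F, IsTranscendenceBasis k x)
    {ρ : Representation ℚ (F ≃ₐ[k] F) W} (hρ : IsAdmissibleRep ρ) (W' : Submodule ℚ W)
    {S : Set F} (hS : S.Finite) {w : W}
    (hconst : ∀ g ∈ fixingSubgroup (F ≃ₐ[k] F) S, ρ g w - w ∈ W')
    (hst : ∀ g : F ≃ₐ[k] F, ∀ w ∈ W', ρ g w ∈ W') :
    ∃ w₁ ∈ fixedSubmodule ρ (fixingSubgroup (F ≃ₐ[k] F) S), w₁ - w ∈ W' := by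
  classical
  obtain ⟨T, hT⟩ := (isSmoothRep_iff ρ).1 hρ.1 w
  replace hT := fixedSubmodule_anti ρ
    (fixingSubgroup_antitone _ F (Set.subset_union_left (s := (T : Set F)) (t := S))) hT
  induction T using Finset.induction_on generalizing w with
  | empty => exact ⟨w, by simpa using hT, by simp⟩
  | insert x T _ ih =>
    rw [Finset.coe_insert, Set.insert_union] at hT
    have hle : fixingSubgroup (F ≃ₐ[k] F) ((T : Set F) ∪ S) ≤ fixingSubgroup (F ≃ₐ[k] F) S :=
      fixingSubgroup_antitone _ F Set.subset_union_right
    by_cases hx : IsAlgebraic (Algebra.adjoin k ((T : Set F) ∪ S)) x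
    · obtain ⟨w₁, hw₁, hsub⟩ := exists_fixed_sub_mem_of_isAlgebraic ρ hx W' hT
        fun g hg => hconst g (hle hg)
      obtain ⟨w₂, hw₂, hsub₂⟩ := ih (w := w₁) (fun g hg => by
        have h := W'.sub_mem (W'.add_mem (hst g _ hsub) (hconst g hg)) hsub
        rw [map_sub] at h
        convert h using 1
        abel) hw₁
      exact ⟨w₂, hw₂, by simpa using W'.add_mem hsub₂ hsub⟩
    · exact ih hconst (hρ.fixedSubmodule_insert_le hn (T.finite_toSet.union hS) hx hT)

end Admissible

section Serre

variable {k F : Type*} [Field k] [Field F] [Algebra k F]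
variable {W : Type u} [AddCommGroup W] [Module ℚ W]
variable {ρ : Representation ℚ (F ≃ₐ[k] F) W} {W' : Submodule ℚ W}
variable {hst : ∀ g : F ≃ₐ[k] F, ∀ w ∈ W', ρ g w ∈ W'}

theorem mem_fixedSubmodule_subRep {U : Subgroup (F ≃ₐ[k] F)} {w : W'} :
    w ∈ fixedSubmodule (subRep ρ W' hst) U ↔ (w : W) ∈ fixedSubmodule ρ U :=
  forall₂_congr fun _ _ => Subtype.ext_iff

theorem mk_mem_fixedSubmodule_quotRep {U : Subgroup (F ≃ₐ[k] F)} {w : W} :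
    W'.mkQ w ∈ fixedSubmodule (quotRep ρ W' hst) U ↔ ∀ g ∈ U, ρ g w - w ∈ W' :=
  forall₂_congr fun _ _ => Submodule.Quotient.eq W'

theorem mkQ_mem_fixedSubmodule {U : Subgroup (F ≃ₐ[k] F)} {w : W}
    (hw : w ∈ fixedSubmodule ρ U) : W'.mkQ w ∈ fixedSubmodule (quotRep ρ W' hst) U :=
  mk_mem_fixedSubmodule_quotRep.2 fun g hg => by simp [hw g hg]

theorem IsAdmissibleRep.subRep (hρ : IsAdmissibleRep ρ) : IsAdmissibleRep (subRep ρ W' hst) := by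
  refine ⟨(isSmoothRep_iff _).2 fun w => ?_, fun U hU => ?_⟩
  · obtain ⟨S, hS⟩ := (isSmoothRep_iff ρ).1 hρ.1 w
    exact ⟨S, mem_fixedSubmodule_subRep.2 hS⟩
  · have := hρ.2 U hU
    refine Module.Finite.of_injective (W'.subtype.restrict (q := fixedSubmodule ρ U)
      fun w hw => mem_fixedSubmodule_subRep.1 hw) fun a b hab => ?_
    exact Subtype.ext (Subtype.ext (congrArg (fun c : fixedSubmodule ρ U => (c : W)) hab))

theorem IsAdmissibleRep.quotRep [IsAlgClosed k] [CharZero k] [IsAlgClosed F]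
    (hn : ∃ x : ℕ → F, IsTranscendenceBasis k x) (hρ : IsAdmissibleRep ρ) :
    IsAdmissibleRep (quotRep ρ W' hst) := by
  refine ⟨(isSmoothRep_iff _).2 fun v => ?_, fun U hU => ?_⟩
  · obtain ⟨w, rfl⟩ := W'.mkQ_surjective v
    obtain ⟨S, hS⟩ := (isSmoothRep_iff ρ).1 hρ.1 w
    exact ⟨S, mkQ_mem_fixedSubmodule hS⟩
  · obtain ⟨S, hS⟩ := (isOpen_autTop_iff_s6 U).1 hU
    have := hρ.2 _ ((isOpen_autTop_iff_s6 (fixingSubgroup (F ≃ₐ[k] F) (S : Set F))).2 ⟨S, le_rfl⟩)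
    refine Submodule.finiteDimensional_of_le
      (S₂ := (fixedSubmodule ρ (fixingSubgroup (F ≃ₐ[k] F) (S : Set F))).map W'.mkQ) fun v hv => ?_
    obtain ⟨w, rfl⟩ := W'.mkQ_surjective v
    obtain ⟨w₁, hw₁, hsub⟩ := hρ.exists_fixed_sub_mem hn W' S.finite_toSet
      (mk_mem_fixedSubmodule_quotRep.1 (fixedSubmodule_anti _ hS hv)) hst
    exact ⟨w₁, hw₁, (Submodule.Quotient.eq W').2 hsub⟩

theorem IsAdmissibleRep.of_subRep_of_quotRep (hρ : IsSmoothRep ρ)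
    (hsub : IsAdmissibleRep (_root_.subRep ρ W' hst))
    (hquot : IsAdmissibleRep (_root_.quotRep ρ W' hst)) : IsAdmissibleRep ρ := by
  refine ⟨hρ, fun U hU => ?_⟩
  have := hsub.2 U hU
  have := hquot.2 U hU
  let f : fixedSubmodule ρ U →ₗ[ℚ] fixedSubmodule (_root_.quotRep ρ W' hst) U :=
    W'.mkQ.restrict fun _ hw => mkQ_mem_fixedSubmodule hw
  have hker (w : LinearMap.ker f) : ((w : fixedSubmodule ρ U) : W) ∈ W' :=
    (Submodule.Quotient.mk_eq_zero W').1 (congrArg Subtype.val (LinearMap.mem_ker.1 w.2))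
  let g : LinearMap.ker f →ₗ[ℚ] fixedSubmodule (_root_.subRep ρ W' hst) U :=
    (((fixedSubmodule ρ U).subtype ∘ₗ (LinearMap.ker f).subtype).codRestrict W' hker).codRestrict _
      fun w => mem_fixedSubmodule_subRep.2 w.1.2
  have : FiniteDimensional ℚ (LinearMap.ker f) := by
    refine Module.Finite.of_injective g fun a b hab => ?_
    exact Subtype.ext (Subtype.ext (congrArg
      (fun c : fixedSubmodule (_root_.subRep ρ W' hst) U => ((c : W') : W)) hab))
  have : FiniteDimensional ℚ (fixedSubmodule ρ U ⧸ LinearMap.ker f) :=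
    Module.Finite.equiv f.quotKerEquivRange.symm
  exact Module.Finite.of_submodule_quotient (LinearMap.ker f)

end Serre

/-- Suppose `n = ∞`.  IsAdmissibleRep representations form a Serre subcategory of the
category of smooth representations of `G = Aut(F/k)`:
(i) `G`-stable subspaces and quotients of admissible representations are admissible;
(ii) extensions of admissible representations by admissible ones (within smooth
representations) are admissible. -/
theorem statement6 (k F : Type*) [Field k] [Field F] [Algebra k F]
    [IsAlgClosed k] [IsAlgClosed F] [CharZero k] [CharZero F]
    (hn : ∃ x : ℕ → F, IsTranscendenceBasis k x) :
    (∀ (W : Type u) [AddCommGroup W] [Module ℚ W]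
      (ρ : Representation ℚ (F ≃ₐ[k] F) W) (W' : Submodule ℚ W)
      (hst : ∀ g : F ≃ₐ[k] F, ∀ w ∈ W', ρ g w ∈ W'),
        IsAdmissibleRep ρ → IsAdmissibleRep (subRep ρ W' hst) ∧ IsAdmissibleRep (quotRep ρ W' hst)) ∧
    (∀ (W : Type u) [AddCommGroup W] [Module ℚ W]
      (ρ : Representation ℚ (F ≃ₐ[k] F) W) (W' : Submodule ℚ W)
      (hst : ∀ g : F ≃ₐ[k] F, ∀ w ∈ W', ρ g w ∈ W'),
        IsSmoothRep ρ → IsAdmissibleRep (subRep ρ W' hst) → IsAdmissibleRep (quotRep ρ W' hst) →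
          IsAdmissibleRep ρ) := by
  exact ⟨fun _ _ _ _ _ _ hρ => ⟨hρ.subRep, hρ.quotRep hn⟩,
    fun _ _ _ _ _ _ => IsAdmissibleRep.of_subRep_of_quotRep⟩
end
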